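/- Let n ≥ 4 and let K be an imaginary n-quadratic field. Then the class number h(K) is even. -/

import Mathlib

open Module

namespace S18

abbrev dbl (A : Type*) [AddCommGroup A] : A →+ A := nsmulAddMonoidHom 2

lemma dbl_index_congr {A B : Type*} [AddCommGroup A] [AddCommGroup B] (e : A ≃+ B) :
    (dbl A).range.index = (dbl B).range.index := by
  have h : (dbl A).range.map (e : A →+ B) = (dbl B).range := by
    ext x
    simp only [AddSubgroup.mem_map, AddMonoidHom.mem_range, nsmulAddMonoidHom_apply]
    constructor
    · rintro ⟨_, ⟨a, rfl⟩, rfl⟩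
      exact ⟨e a, by simp⟩
    · rintro ⟨b, rfl⟩
      exact ⟨2 • e.symm b, ⟨e.symm b, rfl⟩, by simp⟩
  rw [← h, AddSubgroup.index_map_of_injective _ e.injective]
  have : (e : A →+ B).range = ⊤ := AddMonoidHom.range_eq_top.2 e.surjective
  rw [this]; simp

lemma dbl_ker_congr {A B : Type*} [AddCommGroup A] [AddCommGroup B] (e : A ≃+ B) :
    Nat.card (dbl A).ker = Nat.card (dbl B).ker := by
  refine Nat.card_congr (Equiv.subtypeEquiv e.toEquiv ?_)
  intro a
  simp only [AddMonoidHom.mem_ker, nsmulAddMonoidHom_apply]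
  constructor
  · intro h
    have := congrArg e h
    simpa using this
  · intro h
    apply e.injective
    simpa using h

lemma fg_index (A : Type*) [AddCommGroup A] [Module.Finite ℤ A] :
    (dbl A).range.index = 2 ^ finrank ℤ A * Nat.card (dbl A).ker := by
  have : AddGroup.FG A := Module.Finite.iff_addGroup_fg.1 inferInstance
  obtain ⟨n, ι, _, p, hp, e, ⟨f⟩⟩ := AddCommGroup.equiv_free_prod_directSum_zmod A
  classical
  let T := DirectSum ι (fun i => ZMod (p i ^ e i))
  have : ∀ i, NeZero (p i ^ e i) := fun i => ⟨pow_ne_zero _ (hp i).ne_zero⟩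
  have : Finite T := Finite.of_equiv _ (DirectSum.addEquivProd (fun i => ZMod (p i ^ e i))).symm.toEquiv
  let f' : A ≃+ (Fin n → ℤ) × T := f.trans (Finsupp.addEquivFunOnFinite.prodCongr (AddEquiv.refl _))
  have hrank : finrank ℤ A = n := by
    let g : A →ₗ[ℤ] (Fin n → ℤ) := (LinearMap.fst ℤ _ _).comp f'.toAddMonoidHom.toIntLinearMap
    have hg : Function.Surjective g := by
      intro y
      obtain ⟨a, ha⟩ := f'.surjective (y, 0)
      exact ⟨a, by change (f' a).1 = y; rw [ha]⟩
    have h1 := Submodule.finrank_quotient_add_finrank (LinearMap.ker g)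
    have h2 : finrank ℤ (A ⧸ LinearMap.ker g) = n := by
      rw [(g.quotKerEquivOfSurjective hg).finrank_eq]; simp
    have h3 : finrank ℤ (LinearMap.ker g) = 0 := by
      rw [finrank_eq_zero_iff_isTorsion]
      intro x
      have hpos : 0 < Nat.card T := Nat.card_pos
      refine ⟨⟨(Nat.card T : ℤ), mem_nonZeroDivisors_of_ne_zero (by exact_mod_cast hpos.ne')⟩, ?_⟩
      apply Subtype.ext
      apply f'.injective
      have hx : (f' x.1).1 = 0 := x.2
      change f' ((Nat.card T : ℤ) • x.1) = f' 0
      rw [map_zero, natCast_zsmul, map_nsmul]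
      ext1
      · simp [hx]
      · simp [Prod.snd]
    omega
  rw [dbl_index_congr f', dbl_ker_congr f', hrank]
  have hr : (dbl ((Fin n → ℤ) × T)).range = ((dbl (Fin n → ℤ)).range).prod (dbl T).range := by
    rw [← AddMonoidHom.range_prodMap]; rfl
  have hk : (dbl ((Fin n → ℤ) × T)).ker = ((dbl (Fin n → ℤ)).ker).prod (dbl T).ker := by
    ext x
    simp [AddSubgroup.mem_prod, Prod.ext_iff]
  have hT : (dbl T).range.index = Nat.card (dbl T).ker := by
    have h1 := AddSubgroup.card_mul_index (dbl T).range
    have h2 := AddSubgroup.card_mul_index (dbl T).ker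
    rw [AddSubgroup.index_ker] at h2
    have : 0 < Nat.card (dbl T).range := Nat.card_pos
    apply Nat.eq_of_mul_eq_mul_left this
    rw [h1, ← h2, mul_comm]
  have hF : (dbl (Fin n → ℤ)).range.index = 2 ^ n := by
    have : (dbl (Fin n → ℤ)).range = AddSubgroup.pi Set.univ (fun _ => AddSubgroup.zmultiples (2:ℤ)) := by
      ext x
      simp only [AddMonoidHom.mem_range, nsmulAddMonoidHom_apply, AddSubgroup.mem_pi, Int.mem_zmultiples_iff]
      constructor
      · rintro ⟨y, rfl⟩ i _
        simp
      · intro h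
        choose y hy using fun i => h i (Set.mem_univ _)
        exact ⟨y, by ext i; simp [hy i]⟩
    rw [this, AddSubgroup.index_pi]
    simp [Int.index_zmultiples]
  have hkF : (dbl (Fin n → ℤ)).ker = ⊥ := by
    ext x
    simp [funext_iff]
  rw [hr, hk, AddSubgroup.index_prod, hT, hF, hkF]
  congr 1
  rw [Nat.card_congr (AddSubgroup.prodEquiv _ _).toEquiv, Nat.card_prod]
  simp

instance dbl_ker_finite (A : Type*) [AddCommGroup A] [Module.Finite ℤ A] :
    Finite (dbl A).ker := by
  have : Module.Finite ℤ (AddSubgroup.toIntSubmodule (dbl A).ker) := inferInstance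
  refine Module.finite_of_fg_torsion (AddSubgroup.toIntSubmodule (dbl A).ker) ?_
  rintro ⟨x, hx⟩
  refine ⟨⟨2, mem_nonZeroDivisors_of_ne_zero (by norm_num)⟩, Subtype.ext ?_⟩
  have h : 2 • x = 0 := hx
  change (2:ℤ) • x = 0
  exact_mod_cast h

lemma dbl_index_ne_zero (A : Type*) [AddCommGroup A] [Module.Finite ℤ A] :
    (dbl A).range.index ≠ 0 := by
  rw [fg_index]
  have : 0 < Nat.card (dbl A).ker := Nat.card_pos
  positivity

/-- abstract Herbrand-type lemma -/
lemma herbrand {E F : Type*} [AddCommGroup E] [AddCommGroup F] [Module.Finite ℤ E] [Module.Finite ℤ F]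
    (i : F →+ E) (hi : Function.Injective i) (N : E →+ F) (σ : E →+ E)
    (hiN : ∀ x, i (N x) = x + σ x) (hσi : ∀ y, σ (i y) = i y)
    (hfix : ∀ x, σ x = x → ∃ y, i y = x)
    (h90 : ∀ x, N x = 0 → ∃ u, x = u - σ u)
    (neg : E) (hneg : neg ≠ 0) (hneg2 : neg + neg = 0) (hNneg : N neg = 0)
    (hF2 : Nat.card (dbl F).ker ≤ 2)
    (hrank : 2 * finrank ℤ F < finrank ℤ E) : False := by
  have hNi : ∀ y, N (i y) = 2 • y := by
    intro y; apply hi; rw [hiN, hσi, map_nsmul, two_nsmul]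
  have hσσ : ∀ x, σ (σ x) = x := by
    intro x
    have := hσi (N x)
    rw [hiN, map_add] at this
    have h2 : σ x + σ (σ x) = σ x + x := by rw [this, add_comm]
    exact add_left_cancel h2
  have hNσ : ∀ x, N (σ x) = N x := by
    intro x; apply hi; rw [hiN, hiN, hσσ, add_comm]
  let f : E →+ N.ker :=
    { toFun := fun u => ⟨u - σ u, by rw [AddMonoidHom.mem_ker, map_sub, hNσ, sub_self]⟩
      map_zero' := by simp
      map_add' := by intro x y; apply Subtype.ext; simp; abel }
  have hf : ∀ u, (f u : E) = u - σ u := fun u => rfl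
  have hfs : Function.Surjective f := by
    rintro ⟨x, hx⟩
    obtain ⟨u, hu⟩ := h90 x hx
    exact ⟨u, Subtype.ext hu.symm⟩
  have : Module.Finite ℤ N.ker := Module.Finite.of_surjective f.toIntLinearMap hfs
  have hr : finrank ℤ E = finrank ℤ N.ker + finrank ℤ F := by
    have h1 := Submodule.finrank_quotient_add_finrank (LinearMap.ker f.toIntLinearMap)
    rw [(f.toIntLinearMap.quotKerEquivOfSurjective hfs).finrank_eq] at h1
    have hk : LinearMap.ker f.toIntLinearMap = LinearMap.range i.toIntLinearMap := by
      ext x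
      simp only [LinearMap.mem_ker, LinearMap.mem_range, AddMonoidHom.coe_toIntLinearMap]
      constructor
      · intro h
        apply hfix
        have := congrArg Subtype.val h
        rw [hf] at this
        exact (sub_eq_zero.1 this).symm
      · rintro ⟨y, rfl⟩
        apply Subtype.ext
        rw [hf, hσi]; simp
    rw [hk, LinearMap.finrank_range_of_inj hi] at h1
    exact h1.symm
  have hE := fg_index N.ker
  have hFi := fg_index F
  have hkE : 2 ≤ Nat.card (dbl N.ker).ker := by
    have : Nontrivial (dbl N.ker).ker := by
      refine ⟨⟨0, ⟨⟨neg, hNneg⟩, ?_⟩, ?_⟩⟩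
      · rw [AddMonoidHom.mem_ker]; apply Subtype.ext; simp [two_nsmul, hneg2]
      · intro h
        apply hneg
        exact (congrArg (fun z => (z.1.1 : E)) h).symm
    exact Finite.one_lt_card
  have hle : (dbl N.ker).range.index ≤ (dbl F).range.index := by
    have hA : (dbl N.ker).range.index = ((dbl N.ker).range.comap f).index :=
      (AddSubgroup.index_comap_of_surjective _ hfs).symm
    have hH : (dbl F).range.comap N ≤ (dbl N.ker).range.comap f := by
      intro u hu
      obtain ⟨y, hy⟩ := AddSubgroup.mem_comap.1 hu
      rw [nsmulAddMonoidHom_apply] at hy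
      rw [AddSubgroup.mem_comap]
      refine ⟨⟨u - i y, ?_⟩, ?_⟩
      · rw [AddMonoidHom.mem_ker, map_sub, hNi, hy, sub_self]
      · apply Subtype.ext
        simp only [nsmulAddMonoidHom_apply, AddSubgroup.coe_nsmul, hf]
        have h3 : i (N u) = 2 • i y := by rw [← hy, map_nsmul]
        rw [hiN] at h3
        have : σ u = 2 • i y - u := by rw [← h3]; abel
        rw [this]; abel
    have hF0 : (dbl F).range.index ≠ 0 := dbl_index_ne_zero F
    have h1 : ((dbl F).range.comap N).index ≤ (dbl F).range.index := by
      rw [AddSubgroup.index_comap]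
      exact Nat.le_of_dvd (Nat.pos_of_ne_zero hF0) (AddSubgroup.relIndex_dvd_index_of_normal _ _)
    rw [hA]
    refine le_trans (Nat.le_of_dvd (Nat.pos_of_ne_zero ?_) (AddSubgroup.index_dvd_of_le hH)) h1
    rw [AddSubgroup.index_comap]
    intro h0
    exact hF0 (AddSubgroup.index_eq_zero_of_relIndex_eq_zero h0)
  rw [hE, hFi] at hle
  have : 2 ^ (finrank ℤ F + 1) * 2 ≤ 2 ^ finrank ℤ F * 2 := by
    calc 2 ^ (finrank ℤ F + 1) * 2 ≤ 2 ^ (finrank ℤ N.ker) * Nat.card (dbl N.ker).ker := by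
          apply Nat.mul_le_mul _ hkE
          exact Nat.pow_le_pow_right (by norm_num) (by omega)
      _ ≤ _ := hle
      _ ≤ _ := Nat.mul_le_mul_left _ hF2
  rw [pow_succ] at this
  have h0 : 0 < 2 ^ finrank ℤ F := by positivity
  omega
end S18

open Module NumberField

namespace S18

lemma herbrand_mul {E F : Type*} [CommGroup E] [CommGroup F] [Module.Finite ℤ (Additive E)]
    [Module.Finite ℤ (Additive F)]
    (i : F →* E) (hi : Function.Injective i) (N : E →* F) (σ : E →* E)
    (hiN : ∀ x, i (N x) = x * σ x) (hσi : ∀ y, σ (i y) = i y)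
    (hfix : ∀ x, σ x = x → ∃ y, i y = x)
    (h90 : ∀ x, N x = 1 → ∃ u, x * σ u = u)
    (neg : E) (hneg : neg ≠ 1) (hneg2 : neg * neg = 1) (hNneg : N neg = 1)
    (hF2 : Nat.card (dbl (Additive F)).ker ≤ 2)
    (hrank : 2 * finrank ℤ (Additive F) < finrank ℤ (Additive E)) : False :=
  herbrand (E := Additive E) (F := Additive F) (MonoidHom.toAdditive i) hi
    (MonoidHom.toAdditive N) (MonoidHom.toAdditive σ) hiN hσi hfix
    (fun x hx => by
      obtain ⟨u, hu⟩ := h90 (Additive.toMul x) hx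
      exact ⟨Additive.ofMul u, eq_sub_iff_add_eq.2 hu⟩)
    (Additive.ofMul neg) hneg hneg2 hNneg hF2 hrank

lemma h90_ring {R B : Type*} [CommRing R] [CommRing B] [IsDomain B] [Algebra R B]
    [Module.FaithfullyFlat R B]
    (hprinc : ∀ I : Ideal R, (I ^ 2).IsPrincipal → I.IsPrincipal)
    (σ : B ≃ₐ[R] B) (hσσ : ∀ x, σ (σ x) = x) (hfix : ∀ x, σ x = x → ∃ y, algebraMap R B y = x)
    (s t : B) (hst : s * t = 1) (θ : B) (hs : σ s = -s) (hθ : θ - σ θ = s)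
    (η : B) (hη : η * σ η = 1) : ∃ u v : B, u * v = 1 ∧ η * σ u = u := by
  have hs0 : s ≠ 0 := left_ne_zero_of_mul_eq_one hst
  obtain ⟨α, hα0, hα⟩ : ∃ α : B, α ≠ 0 ∧ η * σ α = α := by
    by_cases h : 1 + η = 0
    · refine ⟨s, hs0, ?_⟩
      have : η = -1 := by linear_combination h
      rw [this, hs]; ring
    · refine ⟨1 + η, h, ?_⟩
      rw [map_add, map_one, mul_add, hη]; ring
  have ht : σ t = -t := by
    have := congrArg σ hst
    rw [map_mul, hs, map_one] at this
    linear_combination (-t) * this - (σ t) * hst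
  set I : Ideal B := Ideal.span {α} with hI
  have hIσ : ∀ x ∈ I, σ x ∈ I := by
    intro x hx
    obtain ⟨y, rfl⟩ := Ideal.mem_span_singleton'.1 hx
    rw [map_mul]
    have : σ α = α * σ η := by
      have := congrArg σ hα
      rw [map_mul, hσσ] at this
      rw [← this]; ring
    rw [this]
    exact Ideal.mem_span_singleton'.2 ⟨σ y * σ η, by ring⟩
  set 𝔞 : Ideal R := I.comap (algebraMap R B) with h𝔞
  have hmap : 𝔞.map (algebraMap R B) = I := by
    apply le_antisymm Ideal.map_comap_le
    intro x hx
    have hv : ∃ v, algebraMap R B v = (x - σ x) * t := by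
      apply hfix
      rw [map_mul, map_sub, hσσ, ht]; ring
    obtain ⟨v, hv⟩ := hv
    have hu : ∃ u, algebraMap R B u = x - algebraMap R B v * θ := by
      apply hfix
      rw [map_sub, map_mul, AlgEquiv.commutes]
      have h1 : algebraMap R B v * s = x - σ x := by
        rw [hv]; linear_combination (x - σ x) * hst
      rw [← hθ] at h1
      linear_combination h1
    obtain ⟨u, hu⟩ := hu
    have hvI : algebraMap R B v ∈ I := by
      rw [hv]; exact I.mul_mem_right _ (I.sub_mem hx (hIσ x hx))
    have huI : algebraMap R B u ∈ I := by
      rw [hu]; exact I.sub_mem hx (I.mul_mem_right _ hvI)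
    have : x = algebraMap R B u + algebraMap R B v * θ := by rw [hu]; ring
    rw [this]
    exact Ideal.add_mem _ (Ideal.mem_map_of_mem _ huI)
      (Ideal.mul_mem_right _ _ (Ideal.mem_map_of_mem _ hvI))
  have hp : (𝔞 ^ 2).IsPrincipal := by
    obtain ⟨n, hn⟩ := hfix (α * σ α) (by rw [map_mul, hσσ]; ring)
    refine ⟨n, ?_⟩
    rw [Ideal.submodule_span_eq]
    apply Ideal.map_injective_of_faithfullyFlat (B := B)
    rw [Ideal.map_pow, hmap, Ideal.map_span, Set.image_singleton, hn, hI, Ideal.span_singleton_pow,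
      Ideal.span_singleton_eq_span_singleton]
    refine ⟨⟨σ η, η, by rw [mul_comm]; exact hη, hη⟩, ?_⟩
    change α ^ 2 * σ η = α * σ α
    have : σ α = α * σ η := by
      have := congrArg σ hα
      rw [map_mul, hσσ] at this
      rw [← this]; ring
    rw [this]; ring
  obtain ⟨c, hc⟩ := (hprinc 𝔞 hp).principal
  rw [Ideal.submodule_span_eq] at hc
  rw [hc, Ideal.map_span, Set.image_singleton, hI, Ideal.span_singleton_eq_span_singleton] at hmap
  obtain ⟨w, hw⟩ := hmap
  refine ⟨w, (w⁻¹ : Bˣ), by simp, ?_⟩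
  have hc0 : algebraMap R B c ≠ 0 := by
    intro h; rw [h, zero_mul] at hw; exact hα0 hw.symm
  apply mul_left_cancel₀ hc0
  rw [hw, ← hα, ← hw, map_mul, AlgEquiv.commutes]; ring

lemma princ_of_sq {K : Type*} [Field K] [NumberField K]
    (hodd : Odd (Nat.card (ClassGroup (𝓞 K)))) (I : Ideal (𝓞 K)) (h : (I ^ 2).IsPrincipal) :
    I.IsPrincipal := by
  refine Ideal.IsPrincipal.of_isPrincipal_pow_of_coprime (n := 2) ?_ h
  rw [← Nat.card_eq_fintype_card]
  exact (Nat.coprime_two_left).2 hodd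

lemma card_inf_complex (K : Type*) [Field K] [NumberField K] [IsTotallyComplex K] :
    finrank ℚ K = 2 * Fintype.card (InfinitePlace K) := by
  rw [InfinitePlace.card_eq_nrRealPlaces_add_nrComplexPlaces, IsTotallyComplex.nrRealPlaces_eq_zero,
    zero_add, IsTotallyComplex.finrank]

lemma units_two_tors (K : Type*) [Field K] [NumberField K] :
    Nat.card (dbl (Additive (𝓞 K)ˣ)).ker ≤ 2 := by
  have : ∀ x : (dbl (Additive (𝓞 K)ˣ)).ker, x.1 = Additive.ofMul 1 ∨ x.1 = Additive.ofMul (-1) := by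
    rintro ⟨x, hx⟩
    have h : (Additive.toMul x) ^ 2 = 1 := hx
    have h2 : ((Additive.toMul x : (𝓞 K)ˣ) : 𝓞 K) ^ 2 = 1 := by
      rw [← Units.val_pow_eq_pow_val, h]; rfl
    rcases (by have h4 : ((Additive.toMul x : (𝓞 K)ˣ) - 1 : 𝓞 K) * ((Additive.toMul x : (𝓞 K)ˣ) + 1) = 0 := by { linear_combination h2 }
               rcases mul_eq_zero.1 h4 with h | h
               · exact Or.inl (sub_eq_zero.1 h)
               · exact Or.inr (eq_neg_of_add_eq_zero_left h) :
        ((Additive.toMul x : (𝓞 K)ˣ) : 𝓞 K) = 1 ∨ ((Additive.toMul x : (𝓞 K)ˣ) : 𝓞 K) = -1) with h3 | h3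
    · left; exact Units.ext h3
    · right; exact Units.ext h3
  classical
  let f : (dbl (Additive (𝓞 K)ˣ)).ker → Bool := fun x => decide (x.1 = Additive.ofMul 1)
  have hf : Function.Injective f := by
    intro x y hxy
    simp only [f, decide_eq_decide] at hxy
    apply Subtype.ext
    rcases this x with h | h
    · rw [h, hxy.1 h]
    · rcases this y with h' | h'
      · rw [h', hxy.2 h']
      · rw [h, h']
  simpa using Nat.card_le_card_of_injective f hf

lemma uml_aux {K L : Type*} [Field K] [NumberField K] [Field L] [NumberField L] [Algebra K L]
    [IsTotallyComplex K] (hodd : Odd (Nat.card (ClassGroup (𝓞 K)))) (h2 : finrank K L = 2)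
    (σ : L ≃ₐ[K] L) (hσσ : ∀ x, σ (σ x) = x) (hfix : ∀ x, σ x = x → ∃ y, algebraMap K L y = x)
    (s t : 𝓞 L) (hst : s * t = 1) (θ : 𝓞 L) (hs : σ s = -s) (hθ : (θ : L) - σ θ = s) : False := by
  let S : 𝓞 L ≃ₐ[𝓞 K] 𝓞 L := RingOfIntegers.mapAlgEquiv σ
  have hS : ∀ x : 𝓞 L, ((S x : 𝓞 L) : L) = σ x := fun x => rfl
  have hSS : ∀ x, S (S x) = x := fun x => RingOfIntegers.ext (by rw [hS, hS, hσσ])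
  have hSfix : ∀ x, S x = x → ∃ y, algebraMap (𝓞 K) (𝓞 L) y = x := by
    intro x hx
    obtain ⟨y, hy⟩ := hfix x (by rw [← hS, hx])
    have hyi : IsIntegral ℤ y := by
      have : IsIntegral ℤ (algebraMap K L y) := by rw [hy]; exact x.isIntegral_coe
      exact (isIntegral_algebraMap_iff (algebraMap K L).injective).1 this
    exact ⟨⟨y, hyi⟩, RingOfIntegers.ext hy⟩
  have hinj : Function.Injective (algebraMap (𝓞 K) (𝓞 L)) := FaithfulSMul.algebraMap_injective _ _
  have key := h90_ring (R := 𝓞 K) (B := 𝓞 L) (princ_of_sq hodd) S hSS hSfix s t hst θ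
    (RingOfIntegers.ext (by rw [hS, hs]; rfl)) (RingOfIntegers.ext (by
      have : ((θ - S θ : 𝓞 L) : L) = (θ : L) - σ θ := by rw [← hS]; rfl
      rw [this, hθ]))
  -- the norm
  have hN : ∀ x : (𝓞 L)ˣ, ∃ y : (𝓞 K)ˣ, Units.map (algebraMap (𝓞 K) (𝓞 L)).toMonoidHom y
      = x * Units.map S.toRingEquiv.toRingHom.toMonoidHom x := by
    intro x
    obtain ⟨y, hy⟩ := hSfix ((x : 𝓞 L) * S x) (by rw [map_mul, hSS, mul_comm])
    obtain ⟨z, hz⟩ := hSfix (((x⁻¹ : (𝓞 L)ˣ) : 𝓞 L) * S (x⁻¹ : (𝓞 L)ˣ)) (by rw [map_mul, hSS, mul_comm])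
    have hyz : y * z = 1 := by
      apply hinj
      rw [map_mul, hy, hz, map_one]
      have : S (x : 𝓞 L) * S (x⁻¹ : (𝓞 L)ˣ) = 1 := by rw [← map_mul]; simp
      calc _ = ((x : 𝓞 L) * (x⁻¹ : (𝓞 L)ˣ)) * (S (x : 𝓞 L) * S (x⁻¹ : (𝓞 L)ˣ)) := by ring
        _ = 1 := by rw [this]; simp
    refine ⟨⟨y, z, hyz, by rw [mul_comm, hyz]⟩, Units.ext hy⟩
  choose N hN using hN
  have hinjU : Function.Injective (Units.map (algebraMap (𝓞 K) (𝓞 L)).toMonoidHom) :=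
    Units.map_injective hinj
  let Nh : (𝓞 L)ˣ →* (𝓞 K)ˣ := MonoidHom.mk' N (by
    intro x y; apply hinjU; rw [hN, map_mul, map_mul, hN, hN]; 
    exact mul_mul_mul_comm _ _ _ _)
  have hLc : IsTotallyComplex L := isTotallyComplex_of_algebra K L
  refine herbrand_mul (E := (𝓞 L)ˣ) (F := (𝓞 K)ˣ)
    (Units.map (algebraMap (𝓞 K) (𝓞 L)).toMonoidHom) hinjU Nh
    (Units.map S.toRingEquiv.toRingHom.toMonoidHom) hN ?_ ?_ ?_ (-1) ?_ ?_ ?_ (units_two_tors K) ?_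
  · intro y
    exact Units.ext (S.commutes (y : 𝓞 K))
  · intro x hx
    have h1 : S ((x : (𝓞 L)ˣ) : 𝓞 L) = (x : (𝓞 L)ˣ) := congrArg (fun z : (𝓞 L)ˣ => (z : 𝓞 L)) hx
    obtain ⟨y, hy⟩ := hSfix _ h1
    obtain ⟨z, hz⟩ := hSfix ((((x : (𝓞 L)ˣ)⁻¹ : (𝓞 L)ˣ)) : 𝓞 L) (by
      have : S ((x : (𝓞 L)ˣ) : 𝓞 L) * S (((x : (𝓞 L)ˣ)⁻¹ : (𝓞 L)ˣ)) = 1 := by rw [← map_mul]; simp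
      rw [h1] at this
      exact (Units.inv_eq_of_mul_eq_one_right this).symm)
    have hyz : y * z = 1 := by
      apply hinj
      rw [map_mul, hy, hz, map_one]
      simp
    exact ⟨(⟨y, z, hyz, by rw [mul_comm, hyz]⟩ : (𝓞 K)ˣ), Units.ext hy⟩
  · intro x hx
    have h1 : N x = 1 := hx
    have h2 := hN x
    rw [h1, map_one] at h2
    have h3 := congrArg (fun z : (𝓞 L)ˣ => (z : 𝓞 L)) h2
    obtain ⟨u, v, huv, hu⟩ := key ((x : (𝓞 L)ˣ) : 𝓞 L) h3.symm
    refine ⟨(⟨u, v, huv, by rw [mul_comm, huv]⟩ : (𝓞 L)ˣ), ?_⟩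
    exact Units.ext hu
  · intro h
    have h1 : (-1 : (𝓞 L)ˣ) = 1 := h
    have := congrArg (fun z : (𝓞 L)ˣ => (z : 𝓞 L)) h1
    simp only [Units.val_neg, Units.val_one] at this
    have h0 : (2 : 𝓞 L) = 0 := by linear_combination -this
    exact two_ne_zero h0
  · change (-1 : (𝓞 L)ˣ) * (-1) = 1
    simp
  · apply hinjU
    change Units.map (algebraMap (𝓞 K) (𝓞 L)).toMonoidHom (N (-1)) = _
    rw [hN]
    apply Units.ext
    simp
  · rw [Units.finrank_eq, Units.finrank_eq, Units.rank, Units.rank]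
    have h3 := card_inf_complex K
    have h4 := card_inf_complex L
    have h5 := Module.finrank_mul_finrank ℚ K L
    have h6 : 0 < Fintype.card (InfinitePlace K) := Fintype.card_pos
    rw [h2] at h5
    omega

end S18

open Module NumberField

namespace S18

lemma quad_int {F : Type*} [Field F] {a b x : F} (ha : IsIntegral ℤ a) (hb : IsIntegral ℤ b)
    (hx : x ^ 2 = a * x + b) : IsIntegral ℤ x := by
  have : IsIntegral (integralClosure ℤ F) x := by
    refine ⟨Polynomial.X ^ 2 - (Polynomial.C ⟨a, ha⟩ * Polynomial.X + Polynomial.C ⟨b, hb⟩), ?_, ?_⟩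
    · monicity!
    · simp only [Polynomial.eval₂_sub, Polynomial.eval₂_add, Polynomial.eval₂_mul,
        Polynomial.eval₂_pow, Polynomial.eval₂_X, Polynomial.eval₂_C]
      rw [hx]
      exact sub_self _
  exact isIntegral_trans x this

lemma uml {K : Type*} [Field K] [NumberField K] [IsTotallyComplex K]
    (hodd : Odd (Nat.card (ClassGroup (𝓞 K)))) (ε : (𝓞 K)ˣ) (a b : 𝓞 K)
    (hab : a ^ 2 - ε = 4 * b) : ∃ y : K, y ^ 2 = ((ε : 𝓞 K) : K) := by
  by_contra hno
  push Not at hno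
  let p : Polynomial K := Polynomial.X ^ 2 - Polynomial.C ((ε : 𝓞 K) : K)
  have hdeg : p.natDegree = 2 := Polynomial.natDegree_X_pow_sub_C
  have hp : Irreducible p := by
    rw [Polynomial.irreducible_iff_roots_eq_zero_of_degree_le_three (by omega) (by omega)]
    rw [Multiset.eq_zero_iff_forall_notMem]
    intro y hy
    have := Polynomial.isRoot_of_mem_roots hy
    simp [p, sub_eq_zero] at this
    exact hno y this
  have : Fact (Irreducible p) := ⟨hp⟩
  let L := AdjoinRoot p
  have hfd : FiniteDimensional K L := (AdjoinRoot.powerBasis hp.ne_zero).finite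
  have h2 : finrank K L = 2 := by
    rw [(AdjoinRoot.powerBasis hp.ne_zero).finrank, AdjoinRoot.powerBasis_dim, hdeg]
  have hq : Algebra.IsQuadraticExtension K L := ⟨h2⟩
  have : CharZero L := charZero_of_injective_algebraMap (algebraMap K L).injective
  have : FiniteDimensional ℚ L := FiniteDimensional.trans ℚ K L
  have : NumberField L := ⟨⟩
  let s : L := AdjoinRoot.root p
  have hs2 : s ^ 2 = algebraMap K L ((ε : 𝓞 K) : K) := by
    have := AdjoinRoot.eval₂_root p
    simp only [p, Polynomial.eval₂_sub, Polynomial.eval₂_pow, Polynomial.eval₂_X,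
      Polynomial.eval₂_C] at this
    exact sub_eq_zero.1 this
  have hcard : Fintype.card (L ≃ₐ[K] L) = 2 := by
    rw [← Nat.card_eq_fintype_card, IsGalois.card_aut_eq_finrank, h2]
  obtain ⟨σ, hσ⟩ : ∃ σ : L ≃ₐ[K] L, σ ≠ 1 := by
    have : Nontrivial (L ≃ₐ[K] L) := Fintype.one_lt_card_iff_nontrivial.1 (by omega)
    exact exists_ne 1
  have hall : ∀ τ : L ≃ₐ[K] L, τ = 1 ∨ τ = σ := by
    intro τ
    by_contra hc
    push Not at hc
    classical
    have : ({1, σ, τ} : Finset (L ≃ₐ[K] L)).card ≤ 2 := hcard ▸ Finset.card_le_univ _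
    rw [Finset.card_eq_three.2 ⟨1, σ, τ, hσ.symm, hc.1.symm, hc.2.symm, rfl⟩] at this
    omega
  have hσσ : ∀ x, σ (σ x) = x := by
    intro x
    have h : σ * σ = 1 := by
      rcases hall (σ * σ) with h | h
      · exact h
      · exact absurd (mul_left_cancel (h.trans (mul_one σ).symm)) hσ
    exact congrArg (fun τ : L ≃ₐ[K] L => τ x) h
  have hfix : ∀ x, σ x = x → ∃ y, algebraMap K L y = x := by
    intro x hx
    have : x ∈ (⊥ : IntermediateField K L) := by
      rw [IsGalois.mem_bot_iff_fixed]
      intro τ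
      rcases hall τ with h | h
      · rw [h]; rfl
      · rw [h, hx]
    exact IntermediateField.mem_bot.1 this
  have hσs : σ s = -s := by
    have : (σ s) ^ 2 = s ^ 2 := by rw [← map_pow, hs2, AlgEquiv.commutes]
    rcases sq_eq_sq_iff_eq_or_eq_neg.1 this with h | h
    · obtain ⟨y, hy⟩ := hfix s h
      exfalso
      apply hno y
      apply (algebraMap K L).injective
      rw [map_pow, hy, hs2]
    · exact h
  have hsi : IsIntegral ℤ s := quad_int (a := 0) (b := algebraMap K L ((ε : 𝓞 K) : K)) isIntegral_zero
    ((ε : 𝓞 K).isIntegral_coe.algebraMap) (by rw [hs2]; ring)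
  set t : L := s * algebraMap K L (((ε⁻¹ : (𝓞 K)ˣ) : 𝓞 K) : K) with ht
  have hti : IsIntegral ℤ t := hsi.mul ((((ε⁻¹ : (𝓞 K)ˣ) : 𝓞 K)).isIntegral_coe.algebraMap)
  have hst : s * t = 1 := by
    rw [ht, ← mul_assoc, ← sq, hs2, ← map_mul, ← map_mul]
    simp
  set θ : L := (algebraMap K L (a : K) + s) / 2 with hθ
  have habK : (a : K) ^ 2 - ((ε : 𝓞 K) : K) = 4 * (b : K) := by
    have := congrArg (algebraMap (𝓞 K) K) hab
    rw [map_sub, map_pow, map_mul, map_ofNat] at this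
    exact this
  have habL : (algebraMap K L (a : K)) ^ 2 - algebraMap K L ((ε : 𝓞 K) : K) = 4 * algebraMap K L (b : K) := by
    rw [← map_pow, ← map_sub, habK, map_mul, map_ofNat]
  have hθi : IsIntegral ℤ θ := quad_int (a := algebraMap K L (a : K)) (b := - algebraMap K L (b : K))
    a.isIntegral_coe.algebraMap b.isIntegral_coe.algebraMap.neg (by
      rw [hθ]; linear_combination (1/4 : L) * hs2 - (1/4 : L) * habL)
  refine uml_aux (K := K) (L := L) hodd h2 σ hσσ hfix ⟨s, hsi⟩ ⟨t, hti⟩ (RingOfIntegers.ext hst) ⟨θ, hθi⟩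
    hσs ?_
  change θ - σ θ = s
  rw [hθ, map_div₀, map_add, AlgEquiv.commutes, hσs, map_ofNat]
  ring

lemma ml {K : Type*} [Field K] [NumberField K] [IsTotallyComplex K]
    (hodd : Odd (Nat.card (ClassGroup (𝓞 K)))) (δ b : 𝓞 K) (𝔞 : Ideal (𝓞 K))
    (h𝔞 : 𝔞 ^ 2 = Ideal.span {δ}) (h2 : IsCoprime δ 2) (hb : (4 : 𝓞 K) ∣ δ - b ^ 2) :
    ∃ y : K, y ^ 2 = (δ : K) := by
  obtain ⟨γ, hγ⟩ := (princ_of_sq hodd 𝔞 ⟨δ, by rw [h𝔞]⟩).principal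
  rw [Ideal.submodule_span_eq] at hγ
  rw [hγ, Ideal.span_singleton_pow, Ideal.span_singleton_eq_span_singleton] at h𝔞
  obtain ⟨ε, hε⟩ := h𝔞
  have h4 : IsCoprime γ 4 := by
    have h1 : IsCoprime (γ ^ 2 * ε) (4 : 𝓞 K) := by
      rw [hε]
      have : (4 : 𝓞 K) = 2 ^ 2 := by norm_num
      rw [this]; exact h2.pow_right
    exact (IsCoprime.of_mul_left_left h1).of_isCoprime_of_dvd_left (dvd_pow_self _ two_ne_zero)
  obtain ⟨u, v, huv⟩ := h4
  obtain ⟨c, hc⟩ := hb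
  obtain ⟨y, hy⟩ := uml hodd ε (b * u) (-c * u ^ 2 + ε * (-2 * v + 4 * v ^ 2)) (by
    have h1 : (u * γ) = 1 - v * 4 := by linear_combination huv
    have h3 : (ε : 𝓞 K) * (u * γ) ^ 2 = δ * u ^ 2 := by rw [← hε]; ring
    rw [h1] at h3
    linear_combination -u ^ 2 * hc - h3)
  refine ⟨y * γ, ?_⟩
  rw [mul_pow, hy, ← hε]
  push_cast
  simp [mul_comm]

end S18

open Module NumberField IsDedekindDomain

namespace S18

section SUnits
variable {k : Type*} [Field k] [NumberField k]

/-- `S`-units -/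
def SU (S : Finset (HeightOneSpectrum (𝓞 k))) : Subgroup kˣ where
  carrier := {x | ∀ v, v ∉ S → v.valuationOfNeZero x = 1}
  mul_mem' := by
    intro a b ha hb v hv
    rw [map_mul, ha v hv, hb v hv, one_mul]
  one_mem' := by intro v _; exact map_one _
  inv_mem' := by
    intro a ha v hv
    rw [map_inv, ha v hv, inv_one]

lemma mem_SU {S : Finset (HeightOneSpectrum (𝓞 k))} {x : kˣ} :
    x ∈ SU S ↔ ∀ v, v ∉ S → v.valuationOfNeZero x = 1 := Iff.rfl

lemma val_le_one_iff (v : HeightOneSpectrum (𝓞 k)) (x : kˣ) :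
    v.valuation k (x : k) ≤ 1 ↔ v.valuationOfNeZero x ≤ 1 := by
  rw [← HeightOneSpectrum.valuationOfNeZero_eq]
  exact WithZero.coe_le_coe (b := 1)

lemma val_lt_one_iff (v : HeightOneSpectrum (𝓞 k)) (x : kˣ) :
    v.valuation k (x : k) < 1 ↔ v.valuationOfNeZero x < 1 := by
  rw [← HeightOneSpectrum.valuationOfNeZero_eq]
  exact WithZero.coe_lt_coe (b := 1)

lemma mem_iff_val (v : HeightOneSpectrum (𝓞 k)) (a : 𝓞 k) (x : kˣ) (h : (x : k) = a) :
    a ∈ v.asIdeal ↔ v.valuationOfNeZero x < 1 := by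
  rw [← val_lt_one_iff, h]
  exact (HeightOneSpectrum.valuation_lt_one_iff_mem v a).symm

lemma val_int_le (v : HeightOneSpectrum (𝓞 k)) (a : 𝓞 k) (x : kˣ) (h : (x : k) = a) :
    v.valuationOfNeZero x ≤ 1 := by
  rw [← val_le_one_iff, h]
  exact HeightOneSpectrum.valuation_le_one v a

lemma not_mem_iff_val (v : HeightOneSpectrum (𝓞 k)) (a : 𝓞 k) (x : kˣ) (h : (x : k) = a) :
    a ∉ v.asIdeal ↔ v.valuationOfNeZero x = 1 := by
  rw [mem_iff_val v a x h, not_lt]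
  exact ⟨fun h' => le_antisymm (val_int_le v a x h) h', fun h' => h'.ge⟩

lemma int_of_val (x : kˣ) (h : ∀ v : HeightOneSpectrum (𝓞 k), v.valuationOfNeZero x ≤ 1) :
    ∃ a : 𝓞 k, (x : k) = a := by
  obtain ⟨a, ha⟩ := HeightOneSpectrum.mem_integers_of_valuation_le_one (R := 𝓞 k) k (x : k)
    (fun v => (val_le_one_iff v x).2 (h v))
  exact ⟨a, ha.symm⟩

lemma exists_gen (P : HeightOneSpectrum (𝓞 k)) :
    ∃ x : kˣ, ∃ a : 𝓞 k, (x : k) = a ∧ P.valuationOfNeZero x < 1 ∧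
      ∀ v : HeightOneSpectrum (𝓞 k), v ≠ P → v.valuationOfNeZero x = 1 := by
  have hP0 : P.asIdeal ≠ 0 := P.ne_bot
  have hpr : (P.asIdeal ^ Fintype.card (ClassGroup (𝓞 k))).IsPrincipal := by
    rw [← ClassGroup.mk0_eq_one_iff (pow_mem (mem_nonZeroDivisors_of_ne_zero hP0) _)]
    have := pow_card_eq_one (x := ClassGroup.mk0 ⟨P.asIdeal, mem_nonZeroDivisors_of_ne_zero hP0⟩)
    rw [← map_pow] at this
    exact this
  obtain ⟨a, ha⟩ := hpr.principal
  rw [Ideal.submodule_span_eq] at ha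
  have ha0 : a ≠ 0 := by
    rintro rfl
    rw [Ideal.span_singleton_eq_bot.2 rfl] at ha
    exact pow_ne_zero _ hP0 ha
  have ha0' : (a : k) ≠ 0 := by simpa using ha0
  have hpos : Fintype.card (ClassGroup (𝓞 k)) ≠ 0 := Fintype.card_ne_zero
  refine ⟨Units.mk0 a ha0', a, rfl, ?_, ?_⟩
  · rw [← mem_iff_val P a _ rfl]
    have : a ∈ P.asIdeal ^ Fintype.card (ClassGroup (𝓞 k)) := by
      rw [ha]; exact Ideal.mem_span_singleton_self a
    exact Ideal.pow_le_self hpos this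
  · intro v hv
    rw [← not_mem_iff_val v a _ rfl]
    intro hav
    apply hv
    have h1 : P.asIdeal ^ Fintype.card (ClassGroup (𝓞 k)) ≤ v.asIdeal := by
      rw [ha, Ideal.span_singleton_le_iff_mem]; exact hav
    have h2 : P.asIdeal ≤ v.asIdeal := Ideal.IsPrime.le_of_pow_le h1
    have h3 := P.isMaximal.eq_of_le v.isPrime.ne_top h2
    exact (HeightOneSpectrum.ext h3).symm

lemma exists_Pi (S : Finset (HeightOneSpectrum (𝓞 k))) :
    ∃ x : kˣ, (∀ v ∈ S, v.valuationOfNeZero x < 1) ∧ ∀ v, v ∉ S → v.valuationOfNeZero x = 1 := by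
  classical
  choose g a hga hg1 hg2 using exists_gen (k := k)
  refine ⟨∏ P ∈ S, g P, ?_, ?_⟩
  · intro v hv
    rw [map_prod, ← Finset.mul_prod_erase S _ hv, Finset.prod_eq_one, mul_one]
    · exact hg1 v
    · intro P hP
      exact hg2 P v (Finset.ne_of_mem_erase hP).symm
  · intro v hv
    rw [map_prod, Finset.prod_eq_one]
    intro P hP
    exact hg2 P v (by rintro rfl; exact hv hP)

/-- integral representatives modulo squares -/
lemma su_rep (S : Finset (HeightOneSpectrum (𝓞 k))) (x : kˣ) (hx : x ∈ SU S) :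
    ∃ y ∈ SU S, ∃ δ : 𝓞 k, ((x * y ^ 2 : kˣ) : k) = δ := by
  obtain ⟨π, hπ1, hπ2⟩ := exists_Pi S
  let M : ℕ := ∑ v ∈ S, (Multiplicative.toAdd (v.valuationOfNeZero x)).natAbs
  refine ⟨π ^ M, (SU S).pow_mem (mem_SU.2 hπ2) M, int_of_val _ ?_⟩
  intro v
  by_cases hv : v ∈ S
  · have h1 := hπ1 v hv
    have h2 : (Multiplicative.toAdd (v.valuationOfNeZero x)).natAbs ≤ M :=
      Finset.single_le_sum (f := fun v => (Multiplicative.toAdd (v.valuationOfNeZero x)).natAbs)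
        (fun _ _ => Nat.zero_le _) hv
    rw [← Multiplicative.toAdd_le, toAdd_one, map_mul, map_pow, map_pow, ← pow_mul, toAdd_mul, toAdd_pow]
    rw [← Multiplicative.toAdd_lt, toAdd_one] at h1
    have h3 : (M * 2) • Multiplicative.toAdd (v.valuationOfNeZero π) ≤ -((M : ℤ) * 2) := by
      rw [nsmul_eq_mul]; push_cast; nlinarith
    omega
  · rw [map_mul, map_pow, map_pow, hx v hv, hπ2 v hv]; simp

/-- the valuation map -/
noncomputable def suVal (S : Finset (HeightOneSpectrum (𝓞 k))) : Additive (SU S) →+ (S → ℤ) where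
  toFun x := fun v => Multiplicative.toAdd (v.1.valuationOfNeZero (Additive.toMul x).1)
  map_zero' := by ext v; simp
  map_add' := by intro x y; ext v; simp

noncomputable def suUnit (S : Finset (HeightOneSpectrum (𝓞 k))) : Additive (𝓞 k)ˣ →+ Additive (SU S) :=
  MonoidHom.toAdditive ((Units.map (algebraMap (𝓞 k) k : 𝓞 k →* k)).codRestrict (SU S)
    (fun x v _ => HeightOneSpectrum.valuation_of_unit_eq v x))

lemma suUnit_inj (S : Finset (HeightOneSpectrum (𝓞 k))) : Function.Injective (suUnit S) := by
  intro x y h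
  have h1 : Units.map (algebraMap (𝓞 k) k : 𝓞 k →* k) (Additive.toMul x)
    = Units.map (algebraMap (𝓞 k) k : 𝓞 k →* k) (Additive.toMul y) := congrArg (fun z => (Additive.toMul z).1) h
  exact Units.map_injective (RingOfIntegers.coe_injective) h1

lemma suVal_ker (S : Finset (HeightOneSpectrum (𝓞 k))) :
    LinearMap.ker (suVal S).toIntLinearMap = LinearMap.range (suUnit S).toIntLinearMap := by
  ext x
  simp only [LinearMap.mem_ker, LinearMap.mem_range, AddMonoidHom.coe_toIntLinearMap]
  constructor
  · intro h
    have hv : ∀ v : HeightOneSpectrum (𝓞 k), v.valuationOfNeZero (Additive.toMul x).1 = 1 := by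
      intro v
      by_cases hv : v ∈ S
      · exact congrFun h ⟨v, hv⟩
      · exact (Additive.toMul x).2 v hv
    obtain ⟨a, ha⟩ := int_of_val (Additive.toMul x).1 (fun v => (hv v).le)
    obtain ⟨b, hb⟩ := int_of_val (Additive.toMul x).1⁻¹ (fun v => by rw [map_inv, hv v, inv_one])
    have hab : a * b = 1 := by
      apply RingOfIntegers.ext
      change (a : k) * (b : k) = 1
      rw [← ha, ← hb]; simp
    exact ⟨Additive.ofMul ⟨a, b, hab, by rw [mul_comm, hab]⟩, Subtype.ext (Units.ext ha.symm)⟩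
  · rintro ⟨y, rfl⟩
    ext v
    exact congrArg Multiplicative.toAdd (HeightOneSpectrum.valuation_of_unit_eq v.1 (Additive.toMul y))

instance su_finite (S : Finset (HeightOneSpectrum (𝓞 k))) : Module.Finite ℤ (Additive (SU S)) := by
  have h1 : (LinearMap.ker (suVal S).toIntLinearMap).FG := by
    rw [suVal_ker]; exact Submodule.FG.of_finite
  refine ⟨Submodule.fg_of_fg_map_of_fg_inf_ker (suVal S).toIntLinearMap ?_ ?_⟩
  · exact IsNoetherian.noetherian _
  · rwa [top_inf_eq]

lemma su_rank (S : Finset (HeightOneSpectrum (𝓞 k))) :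
    Fintype.card (InfinitePlace k) + S.card ≤ finrank ℤ (Additive (SU S)) + 1 := by
  have h1 := Submodule.finrank_quotient_add_finrank (LinearMap.ker (suVal S).toIntLinearMap)
  rw [((suVal S).toIntLinearMap.quotKerEquivRange).finrank_eq, suVal_ker,
    LinearMap.finrank_range_of_inj (f := (suUnit S).toIntLinearMap) (suUnit_inj S), Units.finrank_eq, Units.rank] at h1
  have h6 : 0 < Fintype.card (InfinitePlace k) := Fintype.card_pos
  have h2 : S.card ≤ finrank ℤ (LinearMap.range (suVal S).toIntLinearMap) := by
    classical
    choose g a hga hg1 hg2 using exists_gen (k := k)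
    have hgS : ∀ P : S, g P ∈ SU S := by
      intro P v hv
      exact hg2 P v (by rintro rfl; exact hv P.2)
    let b : S → LinearMap.range (suVal S).toIntLinearMap := fun P =>
      ⟨suVal S (Additive.ofMul ⟨g P, hgS P⟩), LinearMap.mem_range_self _ _⟩
    have hb : LinearIndependent ℤ b := by
      rw [Fintype.linearIndependent_iff]
      intro c hc P
      have h3 := congrFun (congrArg Subtype.val hc) P
      rw [AddSubmonoidClass.coe_finsetSum, Finset.sum_apply, Finset.sum_eq_single P] at h3
      · have h4 : c P * Multiplicative.toAdd (P.1.valuationOfNeZero (g P)) = 0 := h3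
        rcases mul_eq_zero.1 h4 with h | h
        · exact h
        · have := hg1 P.1
          rw [← Multiplicative.toAdd_lt, toAdd_one] at this
          omega
      · intro Q _ hQ
        change c Q * Multiplicative.toAdd (P.1.valuationOfNeZero (g Q)) = 0
        rw [hg2 Q.1 P.1 (fun h => hQ (Subtype.ext h.symm))]
        simp
      · simp
    have := hb.fintype_card_le_finrank
    simpa using this
  omega

lemma su_index (S : Finset (HeightOneSpectrum (𝓞 k))) :
    ∃ r, Fintype.card (InfinitePlace k) + S.card ≤ r ∧
      (powMonoidHom 2 : SU S →* SU S).range.index = 2 ^ r := by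
  refine ⟨finrank ℤ (Additive (SU S)) + 1, su_rank S, ?_⟩
  have h1 := fg_index (Additive (SU S))
  have h2 : Nat.card (dbl (Additive (SU S))).ker = 2 := by
    apply le_antisymm
    · have : ∀ x : (dbl (Additive (SU S))).ker, ((Additive.toMul x.1 : SU S) : kˣ) = 1 ∨
          ((Additive.toMul x.1 : SU S) : kˣ) = -1 := by
        rintro ⟨x, hx⟩
        have h : (Additive.toMul x) ^ 2 = 1 := hx
        have h2 : (((Additive.toMul x : SU S) : kˣ) : k) ^ 2 = 1 := by
          rw [← Units.val_pow_eq_pow_val, ← Subgroup.coe_pow, h]; rfl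
        rcases sq_eq_one_iff.1 h2 with h3 | h3
        · left; exact Units.ext h3
        · right; exact Units.ext h3
      classical
      let f : (dbl (Additive (SU S))).ker → Bool := fun x => decide (((Additive.toMul x.1 : SU S) : kˣ) = 1)
      have hf : Function.Injective f := by
        intro x y hxy
        simp only [f, decide_eq_decide] at hxy
        apply Subtype.ext
        apply Subtype.ext
        change ((Additive.toMul x.1 : SU S) : kˣ) = ((Additive.toMul y.1 : SU S) : kˣ)
        rcases this x with h | h
        · rw [h, hxy.1 h]
        · rcases this y with h' | h'
          · rw [h', hxy.2 h']
          · rw [h, h']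
      simpa using Nat.card_le_card_of_injective f hf
    · have : Nontrivial (dbl (Additive (SU S))).ker := by
        have hm : (-1 : kˣ) ∈ SU S := by
          intro v _
          have := HeightOneSpectrum.valuation_of_unit_eq (K := k) v (-1)
          rw [← this]; congr 1
        refine ⟨⟨0, ⟨Additive.ofMul ⟨-1, hm⟩, ?_⟩, ?_⟩⟩
        · change (⟨-1, hm⟩ : SU S) ^ 2 = 1
          apply Subtype.ext; simp
        · intro h
          have h0 : (1 : kˣ) = -1 := 
            congrArg (fun z : (dbl (Additive (SU S))).ker => ((Additive.toMul z.1 : SU S) : kˣ)) h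
          have := congrArg Units.val h0
          simp only [Units.val_one, Units.val_neg] at this
          have h5 : (2 : k) = 0 := by linear_combination this
          exact two_ne_zero h5
      exact Finite.one_lt_card
  rw [h2] at h1
  rw [pow_succ, ← h1]
  rfl

end SUnits
end S18

open Module NumberField IsDedekindDomain

namespace S18

lemma sq_index_finite (G : Type*) [CommGroup G] [Finite G] :
    (powMonoidHom 2 : G →* G).range.index = Nat.card (powMonoidHom 2 : G →* G).ker := by
  have h1 := Subgroup.card_mul_index (powMonoidHom 2 : G →* G).range
  have h2 := Subgroup.card_mul_index (powMonoidHom 2 : G →* G).ker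
  rw [Subgroup.index_ker] at h2
  have : 0 < Nat.card (powMonoidHom 2 : G →* G).range := Nat.card_pos
  apply Nat.eq_of_mul_eq_mul_left this
  rw [h1, ← h2, mul_comm]

lemma card_hom_le (G K : Type*) [Group G] [Finite G] [Field K] :
    Finite (G →* K) ∧ Nat.card (G →* K) ≤ Nat.card G := by
  have := Fintype.ofFinite G
  have h := linearIndependent_monoidHom G K
  have hf : Finite (G →* K) := h.finite
  have := Fintype.ofFinite (G →* K)
  refine ⟨hf, ?_⟩
  have := h.fintype_card_le_finrank
  rw [Module.finrank_fintype_fun_eq_card] at this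
  rwa [Nat.card_eq_fintype_card, Nat.card_eq_fintype_card]

lemma map_sq_of_factors {R B : Type*} [CommRing R] [IsDedekindDomain R] [CommRing B] [Algebra R B]
    (I : Ideal R) (hI : I ≠ ⊥)
    (h : ∀ v : HeightOneSpectrum R, I ≤ v.asIdeal → ∃ P : Ideal B, v.asIdeal.map (algebraMap R B) = P ^ 2) :
    ∃ P : Ideal B, I.map (algebraMap R B) = P ^ 2 := by
  classical
  have key : ∀ s : Multiset (Ideal R), (∀ J ∈ s, ∃ P : Ideal B, J.map (algebraMap R B) = P ^ 2) →
      ∃ P : Ideal B, s.prod.map (algebraMap R B) = P ^ 2 := by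
    intro s
    induction s using Multiset.induction_on with
    | empty => intro _; exact ⟨1, by rw [Multiset.prod_zero, one_pow, Ideal.one_eq_top, Ideal.map_top, Ideal.one_eq_top]⟩
    | cons a s ih =>
      intro hs
      obtain ⟨P, hP⟩ := hs a (Multiset.mem_cons_self a s)
      obtain ⟨Q, hQ⟩ := ih (fun J hJ => hs J (Multiset.mem_cons_of_mem hJ))
      exact ⟨P * Q, by rw [Multiset.prod_cons, Ideal.map_mul, hP, hQ, mul_pow]⟩
  have := key (UniqueFactorizationMonoid.normalizedFactors I) (by
    intro J hJ
    have hp := UniqueFactorizationMonoid.prime_of_normalized_factor J hJ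
    exact h ⟨J, Ideal.isPrime_of_prime hp, hp.ne_zero⟩
      (Ideal.dvd_iff_le.1 (UniqueFactorizationMonoid.dvd_of_mem_normalizedFactors hJ)))
  rwa [Ideal.prod_normalizedFactors_eq_self hI] at this

section mod4
variable (k : Type*) [Field k] [NumberField k]

abbrev A4 := (𝓞 k ⧸ Ideal.span {(4 : 𝓞 k)})ˣ

instance : Finite (𝓞 k ⧸ Ideal.span {(4 : 𝓞 k)}) := 
  Ideal.finiteQuotientOfFreeOfNeBot _ (by simp)

lemma card_mod2 : Nat.card (𝓞 k ⧸ Ideal.span {(2 : 𝓞 k)}) = 2 ^ finrank ℚ k := by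
  have h := Ideal.absNorm_span_singleton (S := 𝓞 k) (2 : 𝓞 k)
  rw [Ideal.absNorm_apply, Submodule.cardQuot_apply] at h
  have h2 : (2 : 𝓞 k) = algebraMap ℤ (𝓞 k) 2 := by simp
  rw [h2, Algebra.norm_algebraMap, RingOfIntegers.rank] at h
  rw [h2, h, Int.natAbs_pow]
  rfl

lemma A4_index : (powMonoidHom 2 : A4 k →* A4 k).range.index ≤ 2 ^ finrank ℚ k := by
  rw [sq_index_finite, ← card_mod2]
  have hex : ∀ u : (powMonoidHom 2 : A4 k →* A4 k).ker, ∃ w : 𝓞 k,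
      (u.1 : 𝓞 k ⧸ Ideal.span {(4 : 𝓞 k)}) = Ideal.Quotient.mk _ (1 + 2 * w) := by
    rintro ⟨u, hu⟩
    obtain ⟨x, hx⟩ := Ideal.Quotient.mk_surjective (u : 𝓞 k ⧸ Ideal.span {(4 : 𝓞 k)})
    have h1 : u ^ 2 = 1 := hu
    have h2 : Ideal.Quotient.mk (Ideal.span {(4 : 𝓞 k)}) (x ^ 2 - 1) = 0 := by
      rw [map_sub, map_pow, hx, map_one, ← Units.val_pow_eq_pow_val, h1, Units.val_one, sub_self]
    rw [Ideal.Quotient.eq_zero_iff_mem, Ideal.mem_span_singleton] at h2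
    obtain ⟨c, hc⟩ := h2
    have hint : IsIntegral ℤ (((x : k) - 1) / 2) := by
      refine quad_int (a := -1) (b := (c : k)) isIntegral_one.neg c.isIntegral_coe ?_
      have : (x : k) ^ 2 - 1 = 4 * c := by
        have := congrArg (algebraMap (𝓞 k) k) hc
        rw [map_sub, map_pow, map_mul, map_ofNat, map_one] at this
        exact this
      linear_combination (1 / 4 : k) * this
    refine ⟨⟨_, hint⟩, ?_⟩
    rw [← hx]
    congr 1
    apply RingOfIntegers.ext
    change (x : k) = 1 + algebraMap (𝓞 k) k 2 * (((x : k) - 1) / 2)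
    rw [map_ofNat]
    ring
  choose w hw using hex
  have hfin : Finite (𝓞 k ⧸ Ideal.span {(2 : 𝓞 k)}) := Ideal.finiteQuotientOfFreeOfNeBot _ (by simp)
  refine Nat.card_le_card_of_injective (fun u => Ideal.Quotient.mk (Ideal.span {(2 : 𝓞 k)}) (w u)) ?_
  intro u u' h
  apply Subtype.ext
  apply Units.ext
  rw [hw, hw, Ideal.Quotient.eq, Ideal.mem_span_singleton]
  rw [Ideal.Quotient.eq, Ideal.mem_span_singleton] at h
  obtain ⟨c, hc⟩ := h
  exact ⟨c, by linear_combination 2 * hc⟩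

end mod4
end S18

open Module NumberField IsDedekindDomain

namespace S18

section counting
variable {k K : Type*} [Field k] [NumberField k] [Field K] [NumberField K] [Algebra k K]

/-- S-units that are squares in `K` -/
def Tsq (K : Type*) [Field K] [Algebra k K] (S : Finset (HeightOneSpectrum (𝓞 k))) : Subgroup (SU S) where
  carrier := {x | ∃ y : K, y ^ 2 = algebraMap k K ((x : kˣ) : k)}
  mul_mem' := by
    rintro a b ⟨y, hy⟩ ⟨z, hz⟩
    exact ⟨y * z, by rw [mul_pow, hy, hz]; simp⟩
  one_mem' := ⟨1, by simp⟩
  inv_mem' := by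
    rintro a ⟨y, hy⟩
    exact ⟨y⁻¹, by rw [inv_pow, hy]; simp⟩

lemma su_not_mem {S : Finset (HeightOneSpectrum (𝓞 k))} (x : SU S) (δ : 𝓞 k)
    (h : ((x : kˣ) : k) = δ) (v : HeightOneSpectrum (𝓞 k)) (hv : v ∉ S) : δ ∉ v.asIdeal := by
  rw [not_mem_iff_val v δ x.1 h]
  exact x.2 v hv

lemma coprime_two {S : Finset (HeightOneSpectrum (𝓞 k))} (hS2 : ∀ v ∈ S, (2 : 𝓞 k) ∉ v.asIdeal)
    (δ : 𝓞 k) (h : ∀ v : HeightOneSpectrum (𝓞 k), v ∉ S → δ ∉ v.asIdeal) : IsCoprime δ 2 := by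
  rw [← Ideal.isCoprime_span_singleton_iff, Ideal.isCoprime_iff_sup_eq]
  by_contra hne
  obtain ⟨M, hM, hle⟩ := Ideal.exists_le_maximal _ hne
  have h2 : (2 : 𝓞 k) ∈ M := hle (Ideal.mem_sup_right (Ideal.mem_span_singleton_self _))
  have hδ : δ ∈ M := hle (Ideal.mem_sup_left (Ideal.mem_span_singleton_self _))
  have hM0 : M ≠ ⊥ := by
    rintro rfl
    rw [Ideal.mem_bot] at h2
    exact two_ne_zero h2
  let v : HeightOneSpectrum (𝓞 k) := ⟨M, hM.isPrime, hM0⟩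
  by_cases hv : v ∈ S
  · exact hS2 v hv h2
  · exact h v hv hδ

lemma coprime_four {R : Type*} [CommRing R] {δ : R} (h : IsCoprime δ 2) : IsCoprime δ 4 := by
  have : (4 : R) = 2 ^ 2 := by norm_num
  rw [this]; exact h.pow_right

/-- S-units congruent to squares mod 4 -/
def T4 (S : Finset (HeightOneSpectrum (𝓞 k))) : Subgroup (SU S) where
  carrier := {x | ∃ y : SU S, ∃ δ b : 𝓞 k, (((x * y ^ 2 : SU S) : kˣ) : k) = δ ∧ (4 : 𝓞 k) ∣ δ - b ^ 2}
  mul_mem' := by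
    rintro x x' ⟨y, δ, b, h, c, hc⟩ ⟨y', δ', b', h', c', hc'⟩
    refine ⟨y * y', δ * δ', b * b', ?_, ?_⟩
    · have : (x * x' * (y * y') ^ 2 : SU S) = (x * y ^ 2) * (x' * y' ^ 2) := by
        rw [mul_pow]; exact mul_mul_mul_comm _ _ _ _
      rw [this, Subgroup.coe_mul, Units.val_mul, h, h']
      exact (map_mul (algebraMap (𝓞 k) k) δ δ').symm
    · exact ⟨c * δ' + b ^ 2 * c', by linear_combination δ' * hc + b ^ 2 * hc'⟩
  one_mem' := ⟨1, 1, 1, by simp, by simp⟩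
  inv_mem' := by
    rintro x ⟨y, δ, b, h, hc⟩
    refine ⟨x * y, δ, b, ?_, hc⟩
    rw [← h]; congr 2
    rw [mul_pow, sq x]; group

lemma sq_le_T4 (S : Finset (HeightOneSpectrum (𝓞 k))) : (powMonoidHom 2 : SU S →* SU S).range ≤ T4 S := by
  rintro _ ⟨x, rfl⟩
  exact ⟨x⁻¹, 1, 1, by simp, by simp⟩

lemma T4_le_Tsq [IsTotallyComplex K] (hodd : Odd (Nat.card (ClassGroup (𝓞 K))))
    (S : Finset (HeightOneSpectrum (𝓞 k))) (hS2 : ∀ v ∈ S, (2 : 𝓞 k) ∉ v.asIdeal)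
    (hSsq : ∀ v ∈ S, ∃ P : Ideal (𝓞 K), v.asIdeal.map (algebraMap (𝓞 k) (𝓞 K)) = P ^ 2) :
    T4 S ≤ Tsq K S := by
  rintro x ⟨y, δ, b, h, hb⟩
  have hδ := su_not_mem _ δ h
  have hcop := coprime_two hS2 δ hδ
  have hδ0 : δ ≠ 0 := by
    rintro rfl
    have h1 : (((x * y ^ 2 : SU S) : kˣ) : k) = 0 := by rw [h]; simp
    exact (Units.ne_zero _) h1
  obtain ⟨P, hP⟩ := map_sq_of_factors (B := 𝓞 K) (Ideal.span {δ}) (by simpa using hδ0) (by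
    intro v hv
    apply hSsq
    by_contra hvS
    exact hδ v hvS (hv (Ideal.mem_span_singleton_self δ)))
  rw [Ideal.map_span, Set.image_singleton] at hP
  obtain ⟨z, hz⟩ := ml hodd (algebraMap (𝓞 k) (𝓞 K) δ) (algebraMap (𝓞 k) (𝓞 K) b) P hP.symm
    (by
      have := hcop.map (algebraMap (𝓞 k) (𝓞 K))
      rwa [map_ofNat] at this)
    (by
      have := map_dvd (algebraMap (𝓞 k) (𝓞 K)) hb
      rwa [map_ofNat, map_sub, map_pow] at this)
  have hz' : z ^ 2 = algebraMap k K (δ : k) := hz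
  have hy0 : algebraMap k K ((y : kˣ) : k) ≠ 0 := by simp
  refine ⟨z / algebraMap k K ((y : kˣ) : k), ?_⟩
  rw [div_pow, hz', ← h, div_eq_iff (pow_ne_zero _ hy0)]
  simp

lemma Tsq_index [IsGalois k K] (S : Finset (HeightOneSpectrum (𝓞 k))) :
    (powMonoidHom 2 : SU S →* SU S).range.relIndex (Tsq K S) ≤ finrank k K := by
  have hfd : FiniteDimensional k K := FiniteDimensional.right ℚ k K
  rw [← IsGalois.card_aut_eq_finrank k K]
  obtain ⟨hf, hle⟩ := card_hom_le (K ≃ₐ[k] K) K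
  refine le_trans ?_ hle
  choose y hy using fun x : Tsq K S => x.2
  have hy0 : ∀ x, y x ≠ 0 := by
    intro x h0
    have := hy x
    rw [h0, zero_pow two_ne_zero] at this
    exact (map_ne_zero (algebraMap k K)).2 (Units.ne_zero _) this.symm
  have hpm : ∀ x (τ : K ≃ₐ[k] K), τ (y x) = y x ∨ τ (y x) = - y x := by
    intro x τ
    apply sq_eq_sq_iff_eq_or_eq_neg.1
    rw [← map_pow, hy, AlgEquiv.commutes]
  let χ : Tsq K S → ((K ≃ₐ[k] K) →* K) := fun x =>
    { toFun := fun τ => τ (y x) / y x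
      map_one' := by
        change y x / y x = 1
        exact div_self (hy0 x)
      map_mul' := by
        intro τ ρ
        change τ (ρ (y x)) / y x = _
        rcases hpm x ρ with h | h
        · rw [h, div_self (hy0 x), mul_one]
        · rw [h, map_neg, neg_div, neg_div, div_self (hy0 x)]; ring }
  have hχ : ∀ x x', χ x = χ x' → ∃ w : SU S, w ^ 2 = (x : SU S) / x' := by
    intro x x' h
    have h1 : ∀ τ : K ≃ₐ[k] K, τ (y x / y x') = y x / y x' := by
      intro τ
      have := congrArg (fun f : (K ≃ₐ[k] K) →* K => f τ) h
      change τ (y x) / y x = τ (y x') / y x' at this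
      rw [map_div₀]
      have h0 := hy0 x
      have h0' := hy0 x'
      have h0'' : τ (y x') ≠ 0 := by simpa using h0'
      field_simp at this ⊢
      linear_combination this
    have h2 : y x / y x' ∈ (⊥ : IntermediateField k K) := (IsGalois.mem_bot_iff_fixed _).2 h1
    obtain ⟨w, hw⟩ := IntermediateField.mem_bot.1 h2
    have hw0 : w ≠ 0 := by
      rintro rfl
      rw [map_zero] at hw
      exact div_ne_zero (hy0 x) (hy0 x') hw.symm
    have hw2 : (Units.mk0 w hw0) ^ 2 = (x : SU S).1 / (x' : SU S).1 := by
      apply Units.ext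
      apply (algebraMap k K).injective
      rw [Units.val_pow_eq_pow_val, Units.val_mk0, map_pow, hw, div_pow, hy, hy, Units.val_div_eq_div_val, map_div₀]
    refine ⟨⟨Units.mk0 w hw0, ?_⟩, Subtype.ext hw2⟩
    intro v hv
    have h3 := congrArg v.valuationOfNeZero hw2
    rw [map_pow, map_div, x.1.2 v hv, x'.1.2 v hv, div_one] at h3
    have h4 := congrArg Multiplicative.toAdd h3
    rw [toAdd_pow, toAdd_one] at h4
    have h5 : Multiplicative.toAdd (v.valuationOfNeZero (Units.mk0 w hw0)) = 0 := by
      simpa using h4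
    exact h5
  rw [Subgroup.relIndex, Subgroup.index]
  refine Nat.card_le_card_of_injective (fun q => χ q.out) ?_
  intro q q' h
  obtain ⟨w, hw⟩ := hχ _ _ h.symm
  rw [← Quotient.out_eq' q, ← Quotient.out_eq' q']
  refine QuotientGroup.eq.2 ?_
  rw [Subgroup.mem_subgroupOf]
  refine ⟨w, ?_⟩
  change w ^ 2 = _
  rw [hw]
  simp [div_eq_mul_inv, mul_comm]

lemma T4_inj (S : Finset (HeightOneSpectrum (𝓞 k))) (hS2 : ∀ v ∈ S, (2 : 𝓞 k) ∉ v.asIdeal) :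
    (T4 S).index ≤ (powMonoidHom 2 : A4 k →* A4 k).range.index ∧
    (∀ u : 𝓞 k, IsCoprime u 2 → (∀ δ c : 𝓞 k, (∀ v, v ∉ S → δ ∉ v.asIdeal) → ¬ (4 : 𝓞 k) ∣ δ - u * c ^ 2) →
      (T4 S).index < (powMonoidHom 2 : A4 k →* A4 k).range.index) := by
  have hrep : ∀ x : SU S, ∃ y : SU S, ∃ δ : 𝓞 k, (((x * y ^ 2 : SU S) : kˣ) : k) = δ := by
    intro x
    obtain ⟨y, hy, δ, h⟩ := su_rep S x.1 x.2
    exact ⟨⟨y, hy⟩, δ, h⟩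
  choose y δ hδ using hrep
  have hcop : ∀ x, IsCoprime (δ x) 2 := fun x => coprime_two hS2 _ (su_not_mem _ _ (hδ x))
  have hunit : ∀ u : 𝓞 k, IsCoprime u 2 → ∃ w : A4 k, (w : 𝓞 k ⧸ Ideal.span {(4 : 𝓞 k)}) = Ideal.Quotient.mk _ u := by
    intro u hu
    obtain ⟨a, b, hab⟩ := coprime_four hu
    have h1 : Ideal.Quotient.mk (Ideal.span {(4 : 𝓞 k)}) u * Ideal.Quotient.mk _ a = 1 := by
      rw [← map_mul, ← map_one (Ideal.Quotient.mk (Ideal.span {(4 : 𝓞 k)})), Ideal.Quotient.eq, Ideal.mem_span_singleton]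
      exact ⟨-b, by linear_combination hab⟩
    exact ⟨⟨_, _, h1, by rw [mul_comm, h1]⟩, rfl⟩
  choose w hw using fun x => hunit (δ x) (hcop x)
  have hcong : ∀ (a b : 𝓞 k) (wa wb : A4 k), (wa : 𝓞 k ⧸ Ideal.span {(4 : 𝓞 k)}) = Ideal.Quotient.mk _ a →
      (wb : 𝓞 k ⧸ Ideal.span {(4 : 𝓞 k)}) = Ideal.Quotient.mk _ b →
      (QuotientGroup.mk wa : A4 k ⧸ (powMonoidHom 2 : A4 k →* A4 k).range) = QuotientGroup.mk wb →
      ∃ c : 𝓞 k, (4 : 𝓞 k) ∣ b - a * c ^ 2 := by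
    intro a b wa wb ha hb h
    rw [QuotientGroup.eq] at h
    obtain ⟨z, hz⟩ := h
    obtain ⟨c, hc⟩ := Ideal.Quotient.mk_surjective (z : 𝓞 k ⧸ Ideal.span {(4 : 𝓞 k)})
    refine ⟨c, ?_⟩
    rw [← Ideal.mem_span_singleton, ← Ideal.Quotient.eq, map_mul, map_pow, hc, ← ha, ← hb]
    have hz' : z ^ 2 = wa⁻¹ * wb := hz
    rw [← Units.val_pow_eq_pow_val, ← Units.val_mul, hz']
    simp
  let φ : SU S ⧸ T4 S → A4 k ⧸ (powMonoidHom 2 : A4 k →* A4 k).range := fun q => QuotientGroup.mk (w q.out)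
  have hφ : Function.Injective φ := by
    intro q q' h
    obtain ⟨c, hc⟩ := hcong _ _ _ _ (hw q.out) (hw q'.out) h
    rw [← Quotient.out_eq' q, ← Quotient.out_eq' q']
    refine QuotientGroup.eq.2 ?_
    have : q.out⁻¹ * q'.out = ((q.out)⁻¹) ^ 2 * (q.out * q'.out) := by
      rw [sq]; group
    rw [this]
    refine (T4 S).mul_mem (sq_le_T4 S ⟨_, rfl⟩) ?_
    refine ⟨y q.out * y q'.out, δ q.out * δ q'.out, δ q.out * c, ?_, ?_⟩
    · have : (q.out * q'.out * (y q.out * y q'.out) ^ 2 : SU S) =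
          (q.out * (y q.out) ^ 2) * (q'.out * (y q'.out) ^ 2) := by
        rw [mul_pow]; exact mul_mul_mul_comm _ _ _ _
      rw [this, Subgroup.coe_mul, Units.val_mul, hδ, hδ]
      exact (map_mul (algebraMap (𝓞 k) k) _ _).symm
    · obtain ⟨e, he⟩ := hc
      exact ⟨δ q.out * e, by linear_combination δ q.out * he⟩
  refine ⟨Nat.card_le_card_of_injective φ hφ, ?_⟩
  intro u hu hno
  obtain ⟨wu, hwu⟩ := hunit u hu
  have hns : ¬ Function.Surjective φ := by
    intro hs
    obtain ⟨q, hq⟩ := hs (QuotientGroup.mk wu)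
    obtain ⟨c, hc⟩ := hcong _ _ _ _ hwu (hw q.out) hq.symm
    exact hno (δ q.out) c (su_not_mem _ _ (hδ _)) hc
  rw [Subgroup.index, Subgroup.index]
  refine lt_of_le_of_ne (Nat.card_le_card_of_injective φ hφ) ?_
  intro heq
  exact hns (((Nat.bijective_iff_injective_and_card φ).2 ⟨hφ, heq⟩).2)

lemma neg_one_mem_SU (S : Finset (HeightOneSpectrum (𝓞 k))) : (-1 : kˣ) ∈ SU S := by
  intro v hv
  have h2 : v.valuationOfNeZero (-1 : kˣ) ^ 2 = 1 := by rw [← map_pow]; simp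
  have h4 := congrArg Multiplicative.toAdd h2
  rw [toAdd_pow, toAdd_one] at h4
  have h5 : Multiplicative.toAdd (v.valuationOfNeZero (-1 : kˣ)) = 0 := by
    simpa using h4
  exact h5

theorem counting [IsTotallyComplex K] [IsGalois k K] (hodd : Odd (Nat.card (ClassGroup (𝓞 K))))
    (S : Finset (HeightOneSpectrum (𝓞 k))) (hS2 : ∀ v ∈ S, (2 : 𝓞 k) ∉ v.asIdeal)
    (hSsq : ∀ v ∈ S, ∃ P : Ideal (𝓞 K), v.asIdeal.map (algebraMap (𝓞 k) (𝓞 K)) = P ^ 2)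
    (e : ℕ) (he : finrank k K = 2 ^ e) :
    Fintype.card (InfinitePlace k) + S.card ≤ finrank ℚ k + e ∧
    (∀ u : 𝓞 k, IsCoprime u 2 → (∀ δ c : 𝓞 k, (∀ v, v ∉ S → δ ∉ v.asIdeal) → ¬ (4 : 𝓞 k) ∣ δ - u * c ^ 2) →
      Fintype.card (InfinitePlace k) + S.card + 1 ≤ finrank ℚ k + e) ∧
    ((∃ y : K, y ^ 2 = -1) → (∀ c : 𝓞 k, ¬ (4 : 𝓞 k) ∣ c ^ 2 + 1) →
      Fintype.card (InfinitePlace k) + S.card + 1 ≤ finrank ℚ k + e) := by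
  obtain ⟨r, hr, hidx⟩ := su_index S
  have h1 := Subgroup.relIndex_mul_index (sq_le_T4 S)
  rw [hidx] at h1
  obtain ⟨t, -, ht⟩ := (Nat.dvd_prime_pow Nat.prime_two).1 (Dvd.intro_left _ h1)
  obtain ⟨a, -, ha⟩ := (Nat.dvd_prime_pow Nat.prime_two).1 (Dvd.intro _ h1)
  rw [ha, ht, ← pow_add] at h1
  have hrt : a + t = r := Nat.pow_right_injective le_rfl h1
  have hT := T4_le_Tsq hodd S hS2 hSsq
  have h2 := Tsq_index (K := K) S
  have h3 := Subgroup.relIndex_mul_relIndex _ _ _ (sq_le_T4 S) hT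
  obtain ⟨h4, h5⟩ := T4_inj S hS2
  have h6 := A4_index k
  have hTne : (T4 S).relIndex (Tsq K S) ≠ 0 := by
    intro h0
    have := Subgroup.relIndex_dvd_index_of_normal (T4 S) (Tsq K S)
    rw [h0, ht, zero_dvd_iff] at this
    exact absurd this (by positivity)
  have hae : 2 ^ a * (T4 S).relIndex (Tsq K S) ≤ 2 ^ e := by
    rw [← ha, h3, ← he]; exact h2
  have hae' : a ≤ e := by
    apply (Nat.pow_le_pow_iff_right (a := 2) (by norm_num)).1
    exact le_trans (Nat.le_mul_of_pos_right _ (Nat.pos_of_ne_zero hTne)) hae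
  have htN : t ≤ finrank ℚ k := by
    apply (Nat.pow_le_pow_iff_right (a := 2) (by norm_num)).1
    rw [← ht]; exact h4.trans h6
  refine ⟨by omega, ?_, ?_⟩
  · intro u hu hno
    have h7 : t < finrank ℚ k := by
      apply (Nat.pow_lt_pow_iff_right (a := 2) (by norm_num)).1
      rw [← ht]; exact (h5 u hu hno).trans_le h6
    omega
  · rintro ⟨y, hy⟩ hno
    have hne1 : (T4 S).relIndex (Tsq K S) ≠ 1 := by
      intro h0
      rw [Subgroup.relIndex_eq_one] at h0
      have hm : (⟨-1, neg_one_mem_SU S⟩ : SU S) ∈ Tsq K S := ⟨y, by simp [hy]⟩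
      obtain ⟨z, δ, b, h, hb⟩ := h0 hm
      have hcop := coprime_two hS2 δ (su_not_mem _ δ h)
      have hz : -(((z : kˣ) : k)) ^ 2 = δ := by
        rw [← h]; simp
      have hzi : IsIntegral ℤ (((z : kˣ) : k)) := by
        refine quad_int (a := 0) (b := -(δ : k)) isIntegral_zero (IsIntegral.neg (RingOfIntegers.isIntegral_coe δ)) ?_
        rw [← hz]; ring
      let z' : 𝓞 k := ⟨_, hzi⟩
      have hz' : z' ^ 2 = -δ := by
        apply RingOfIntegers.ext
        change (((z : kˣ) : k)) ^ 2 = -(δ : k)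
        rw [← hz, neg_neg]
      have hcz : IsCoprime z' 2 := by
        have : IsCoprime (z' ^ 2) 2 := by rw [hz']; exact hcop.neg_left
        exact (IsCoprime.pow_left_iff two_pos).1 this
      obtain ⟨p, q, hpq⟩ := coprime_four hcz
      obtain ⟨c, hc⟩ := hb
      refine hno (b * p) ⟨-c * p ^ 2 + q + q * p * z', ?_⟩
      linear_combination (-p ^ 2) * hc + p ^ 2 * hz' - (1 + p * z') * hpq
    have h2' : 2 ≤ (T4 S).relIndex (Tsq K S) := by omega
    have h8 : a + 1 ≤ e := by
      apply (Nat.pow_le_pow_iff_right (a := 2) (by norm_num)).1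
      rw [pow_succ]
      exact le_trans (Nat.mul_le_mul_left _ h2') hae
    omega

end counting
end S18

open Module NumberField IsDedekindDomain

namespace S18
set_option linter.unusedSectionVars false

section tr
variable {K : Type*} [Field K] [NumberField K]

/-- divisibility of integral elements by a rational integer -/
def Dv (a : ℤ) (x : K) : Prop := ∃ y : K, IsIntegral ℤ y ∧ x = a * y

lemma rat_int (q : ℚ) (h : IsIntegral ℤ (q : K)) : ∃ t : ℤ, q = t := by
  have h1 : IsIntegral ℤ q := by
    have h2 : IsIntegral ℤ (algebraMap ℚ K q) := by simpa using h
    exact (isIntegral_algebraMap_iff (algebraMap ℚ K).injective).1 h2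
  obtain ⟨t, ht⟩ := IsIntegrallyClosed.isIntegral_iff.1 h1
  exact ⟨t, by rw [← ht]; simp⟩

lemma Dv.int {a b : ℤ} (h : Dv a (b : K)) : a ∣ b := by
  obtain ⟨y, hy, h⟩ := h
  by_cases ha : a = 0
  · subst ha
    have : (b : K) = 0 := by rw [h]; simp
    have : b = 0 := by exact_mod_cast this
    simp [this]
  · have ha' : (a : K) ≠ 0 := by exact_mod_cast ha
    have : y = (((b : ℚ) / a : ℚ) : K) := by
      push_cast; field_simp; linear_combination -h
    rw [this] at hy
    obtain ⟨t, ht⟩ := rat_int _ hy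
    refine ⟨t, ?_⟩
    have ha'' : (a : ℚ) ≠ 0 := by exact_mod_cast ha
    field_simp at ht
    exact_mod_cast ht

lemma Dv.add {a : ℤ} {x y : K} (hx : Dv a x) (hy : Dv a y) : Dv a (x + y) := by
  obtain ⟨u, hu, rfl⟩ := hx
  obtain ⟨v, hv, rfl⟩ := hy
  exact ⟨u + v, hu.add hv, by ring⟩

lemma Dv.mul {a : ℤ} {x y : K} (hx : Dv a x) (hy : IsIntegral ℤ y) : Dv a (x * y) := by
  obtain ⟨u, hu, rfl⟩ := hx
  exact ⟨u * y, hu.mul hy, by ring⟩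

lemma Dv.neg {a : ℤ} {x : K} (hx : Dv a x) : Dv a (-x) := by
  obtain ⟨u, hu, rfl⟩ := hx
  exact ⟨-u, hu.neg, by ring⟩

lemma Dv.sub {a : ℤ} {x y : K} (hx : Dv a x) (hy : Dv a y) : Dv a (x - y) := by
  rw [sub_eq_add_neg]; exact hx.add hy.neg

lemma Dv.map {a : ℤ} {x : K} (hx : Dv a x) (g : K ≃ₐ[ℚ] K) : Dv a (g x) := by
  obtain ⟨u, hu, rfl⟩ := hx
  exact ⟨g u, map_isIntegral_int g hu, by simp⟩

lemma isInt_int (a : ℤ) : IsIntegral ℤ (a : K) := by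
  simpa using (isIntegral_algebraMap (R := ℤ) (A := K) (x := a))

lemma Dv.of_int {a b : ℤ} (h : a ∣ b) : Dv a (b : K) := by
  obtain ⟨c, rfl⟩ := h
  exact ⟨c, isInt_int c, by push_cast; ring⟩

lemma Dv.isInt {a : ℤ} {x : K} (hx : Dv a x) : IsIntegral ℤ x := by
  obtain ⟨u, hu, rfl⟩ := hx
  exact (isInt_int a).mul hu

lemma isInt_sqrt {x : K} {m : ℤ} (h : x ^ 2 = m) : IsIntegral ℤ x :=
  quad_int (a := (0 : K)) (b := (m : K)) isIntegral_zero (isInt_int m) (by rw [h]; ring)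

lemma tr_int [IsGalois ℚ K] {x : K} (hx : IsIntegral ℤ x) : ∃ t : ℤ, Algebra.trace ℚ K x = t := by
  apply rat_int (K := K)
  have := (Algebra.isIntegral_trace (L := ℚ) (F := K) hx).algebraMap (B := K)
  simpa using this

lemma toO {L : Type*} [Field L] {x : L} (hx : IsIntegral ℤ x) : ∃ y : 𝓞 L, algebraMap (𝓞 L) L y = x := ⟨⟨x, hx⟩, rfl⟩

lemma Dv_coe {a : ℤ} {x : 𝓞 K} : Dv a (x : K) ↔ (a : 𝓞 K) ∣ x := by
  constructor
  · rintro ⟨y, hy, h⟩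
    obtain ⟨y, rfl⟩ := toO hy
    refine ⟨y, ?_⟩
    apply RingOfIntegers.coe_injective
    rw [map_mul, map_intCast]
    exact h
  · rintro ⟨y, rfl⟩
    exact ⟨y, y.isIntegral_coe, by simp⟩

/-- the trace of an element nilpotent mod `p` is divisible by `p` -/
lemma tr_nil [IsGalois ℚ K] {p : ℕ} (hp : p.Prime) {x : K} (hx : IsIntegral ℤ x) (h : Dv p (x ^ 2)) {t : ℤ}
    (ht : Algebra.trace ℚ K x = t) : (p : ℤ) ∣ t := by
  have hs := trace_eq_sum_automorphisms (K := ℚ) x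
  rw [ht] at hs
  let f : (K ≃ₐ[ℚ] K) → 𝓞 K := fun g => ⟨g x, map_isIntegral_int g hx⟩
  have hn : IsNilpotent (∑ g, Ideal.Quotient.mk (Ideal.span {((p : ℤ) : 𝓞 K)}) (f g)) := by
    apply isNilpotent_sum
    intro g _
    refine ⟨2, ?_⟩
    rw [← map_pow, Ideal.Quotient.eq_zero_iff_mem, Ideal.mem_span_singleton, ← Dv_coe]
    have := h.map g
    rw [map_pow] at this
    exact this
  obtain ⟨N, hN⟩ := hn
  rw [← map_sum, ← map_pow, Ideal.Quotient.eq_zero_iff_mem, Ideal.mem_span_singleton] at hN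
  have h1 : ∑ g, f g = (t : 𝓞 K) := by
    apply RingOfIntegers.coe_injective
    rw [map_sum]
    change ∑ g : K ≃ₐ[ℚ] K, g x = _
    rw [← hs]; simp
  rw [h1, ← Int.cast_pow, ← Dv_coe] at hN
  have h2 : Dv (p : ℤ) ((t ^ N : ℤ) : K) := by simpa using hN
  exact (Nat.prime_iff_prime_int.1 hp).dvd_of_dvd_pow h2.int

lemma tr_zero {x : K} (g : K ≃ₐ[ℚ] K) (h : g x = -x) : Algebra.trace ℚ K x = 0 := by
  have := Algebra.trace_eq_of_algEquiv g x
  rw [h, map_neg] at this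
  linarith

end tr

section rf
variable {K : Type*} [Field K] [NumberField K] {ι : Type*} [Fintype ι]

/-- a multiplicatively closed orthogonal family of square roots -/
structure RF (r : ι → K) (m : ι → ℤ) : Prop where
  hsq : ∀ i, r i ^ 2 = m i
  hne : ∀ i, m i ≠ 0
  hone : ∃ i, r i = 1
  hmul : ∀ i j, ∃ l, ∃ c : ℚ, r i * r j = c • r l
  horth : ∀ i j, i ≠ j → ∃ g : K ≃ₐ[ℚ] K, g (r i * r j) = -(r i * r j)

variable {r : ι → K} {m : ι → ℤ}

lemma RF.exists_field (h : RF r m) : ∃ k : IntermediateField ℚ K,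
    k.toSubalgebra.toSubmodule = Submodule.span ℚ (Set.range r) := by
  let A : Subalgebra ℚ K := (Submodule.span ℚ (Set.range r)).toSubalgebra (by
      obtain ⟨i, hi⟩ := h.hone
      rw [← hi]; exact Submodule.subset_span ⟨i, rfl⟩) (by
      intro x y hx hy
      have : x * y ∈ Submodule.span ℚ (Set.range r) * Submodule.span ℚ (Set.range r) := Submodule.mul_mem_mul hx hy
      rw [Submodule.span_mul_span] at this
      refine (Submodule.span_le.2 ?_) this
      rintro _ ⟨_, ⟨i, rfl⟩, _, ⟨j, rfl⟩, rfl⟩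
      obtain ⟨l, c, hc⟩ := h.hmul i j
      change r i * r j ∈ _
      rw [hc]
      exact Submodule.smul_mem _ _ (Submodule.subset_span ⟨l, rfl⟩))
  refine ⟨A.toIntermediateField (fun x hx => ?_), ?_⟩
  · exact A.inv_mem_of_algebraic (x := ⟨x, hx⟩) (Algebra.IsAlgebraic.isAlgebraic x)
  · rfl

lemma RF.tr_mul (h : RF r m) (c : ι → ℚ) (j : ι) :
    Algebra.trace ℚ K ((∑ i, c i • r i) * r j) = finrank ℚ K * (c j * m j) := by
  rw [Finset.sum_mul, map_sum, Finset.sum_eq_single j]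
  · rw [smul_mul_assoc, ← sq, h.hsq, map_smul]
    have : ((m j : ℤ) : K) = algebraMap ℚ K (m j) := by simp
    rw [this, Algebra.trace_algebraMap]
    simp; ring
  · intro i _ hij
    obtain ⟨g, hg⟩ := h.horth i j hij
    rw [smul_mul_assoc, map_smul, tr_zero g hg, smul_zero]
  · simp

lemma RF.linInd (h : RF r m) : LinearIndependent ℚ r := by
  rw [Fintype.linearIndependent_iff]
  intro c hc j
  have := h.tr_mul c j
  rw [hc, zero_mul, map_zero] at this
  have h1 : (finrank ℚ K : ℚ) ≠ 0 := by exact_mod_cast finrank_pos.ne'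
  have h2 : (m j : ℚ) ≠ 0 := by exact_mod_cast h.hne j
  by_contra h3
  exact mul_ne_zero h1 (mul_ne_zero h3 h2) this.symm

variable {k : IntermediateField ℚ K} 

lemma RF.fr (h : RF r m) (hk : k.toSubalgebra.toSubmodule = Submodule.span ℚ (Set.range r)) :
    finrank ℚ k = Fintype.card ι := by
  have := finrank_span_eq_card h.linInd
  rw [← hk] at this
  exact this

lemma mem_k_iff (hk : k.toSubalgebra.toSubmodule = Submodule.span ℚ (Set.range r)) (x : K) :
    x ∈ k ↔ ∃ c : ι → ℚ, ∑ i, c i • r i = x := by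
  rw [← Submodule.mem_span_range_iff_exists_fun, ← hk]
  rfl

lemma RF.rad [IsGalois ℚ K] (h : RF r m) (hk : k.toSubalgebra.toSubmodule = Submodule.span ℚ (Set.range r))
    {n : ℕ} (hn : finrank ℚ K = 2 ^ n) {p : ℕ} (hp : p.Prime) (hp2 : p ≠ 2) (hpm : ∀ i, ¬ (p : ℤ) ∣ m i)
    {w : K} (hwk : w ∈ k) (hw : IsIntegral ℤ w) (hpw : Dv p (w ^ 2)) : Dv p w := by
  obtain ⟨c, hc⟩ := (mem_k_iff hk w).1 hwk
  have key : ∀ j, ∃ t : ℤ, (2 ^ n * (c j * m j) : ℚ) = p * t := by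
    intro j
    have hj : IsIntegral ℤ (r j) := isInt_sqrt (h.hsq j)
    obtain ⟨t, ht⟩ := tr_int (hw.mul hj)
    obtain ⟨s, hs⟩ := tr_nil hp (hw.mul hj) (by rw [mul_pow]; exact hpw.mul (hj.pow 2)) ht
    refine ⟨s, ?_⟩
    have := h.tr_mul c j
    rw [hc, ht, hn, hs] at this
    push_cast at this
    exact this.symm
  choose t ht using key
  have hp' := Nat.prime_iff_prime_int.1 hp
  have hM : ¬ (p : ℤ) ∣ 2 ^ n * ∏ i, m i := by
    intro hd
    rcases hp'.dvd_or_dvd hd with hd | hd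
    · have := hp'.dvd_of_dvd_pow hd
      have : p ∣ 2 := by exact_mod_cast this
      exact hp2 ((Nat.prime_dvd_prime_iff_eq hp Nat.prime_two).1 this)
    · obtain ⟨i, _, hi⟩ := (Prime.dvd_finsetProd_iff hp' _).1 hd
      exact hpm i hi
  have h1 : Dv p (((2 ^ n * ∏ i, m i : ℤ) : K) * w) := by
    classical
    refine ⟨∑ i, ((t i * ∏ l ∈ Finset.univ.erase i, m l : ℤ) : K) * r i, ?_, ?_⟩
    · exact IsIntegral.sum _ fun i _ => (isInt_int _).mul (isInt_sqrt (h.hsq i))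
    · rw [← hc, Finset.mul_sum, Finset.mul_sum]
      apply Finset.sum_congr rfl
      intro i _
      have h2 := congrArg (algebraMap ℚ K) (ht i)
      rw [← Finset.mul_prod_erase Finset.univ m (Finset.mem_univ i), Algebra.smul_def]
      push_cast
      simp only [map_mul, map_pow, map_ofNat, map_intCast, map_natCast] at h2
      linear_combination (∏ l ∈ Finset.univ.erase i, (m l : K)) * r i * h2
  obtain ⟨a, b, hab⟩ := (hp'.coprime_iff_not_dvd.2 hM)
  have hab' : (a : K) * p + b * ((2 ^ n * ∏ i, m i : ℤ) : K) = 1 := by exact_mod_cast congrArg (Int.cast : ℤ → K) hab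
  have h2 : w = (p : ℤ) * (a * w) + ((2 ^ n * ∏ i, m i : ℤ) : K) * w * b := by
    push_cast at hab' ⊢
    linear_combination -w * hab'
  rw [h2]
  exact Dv.add ⟨_, (isInt_int a).mul hw, rfl⟩ (h1.mul (isInt_int b))

end rf
end S18

open Module NumberField IsDedekindDomain

namespace S18
set_option linter.unusedSectionVars false

section primes
variable {K : Type*} [Field K] [NumberField K] {ι : Type*} [Fintype ι]
variable {r : ι → K} {m : ι → ℤ} {k : IntermediateField ℚ K}

lemma coeO (x : 𝓞 k) : ((algebraMap (𝓞 k) (𝓞 K) x : 𝓞 K) : K) = ((x : k) : K) := rfl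

/-- divisibility in `𝓞 k` can be checked in `K` -/
lemma Dv_coe_k {a : ℤ} (ha : a ≠ 0) {x : 𝓞 k} : Dv a ((x : k) : K) ↔ (a : 𝓞 k) ∣ x := by
  constructor
  · rintro ⟨y, hy, h⟩
    have ha' : (a : K) ≠ 0 := by exact_mod_cast ha
    have hyk : y ∈ k := by
      have : y = ((x : k) : K) / a := by field_simp; linear_combination -h
      rw [this]
      exact k.div_mem (x : k).2 (by simp)
    have hy' : IsIntegral ℤ (⟨y, hyk⟩ : k) := by
      have : IsIntegral ℤ (algebraMap k K ⟨y, hyk⟩) := hy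
      exact (isIntegral_algebraMap_iff (algebraMap k K).injective).1 this
    obtain ⟨z, hz⟩ := toO hy'
    refine ⟨z, ?_⟩
    apply RingOfIntegers.coe_injective
    rw [map_mul, map_intCast, hz]
    apply Subtype.ext
    rw [h]; simp
  · rintro ⟨y, rfl⟩
    refine ⟨((y : k) : K), ?_, by simp⟩
    have := (y.isIntegral_coe).algebraMap (B := K)
    exact this

lemma radical_sup {R : Type*} [CommRing R] [IsDedekindDomain R] (p : R) (hp0 : p ≠ 0)
    (hrad : ∀ w : R, p ∣ w ^ 2 → p ∣ w) (P : Ideal R) (hP : P.IsPrime) (hpP : p ∈ P) :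
    P ^ 2 ⊔ Ideal.span {p} = P := by
  have hP0 : P ≠ ⊥ := by
    rintro rfl
    exact hp0 (by simpa using hpP)
  have hPp : Prime P := Ideal.prime_of_isPrime hP0 hP
  have hle : P ^ 2 ⊔ Ideal.span {p} ≤ P := sup_le (Ideal.pow_le_self two_ne_zero) ((Ideal.span_singleton_le_iff_mem _).2 hpP)
  have hdvd : P ^ 2 ⊔ Ideal.span {p} ∣ P ^ 2 := Ideal.dvd_iff_le.2 le_sup_left
  obtain ⟨i, hi, hi'⟩ := (dvd_prime_pow hPp 2).1 hdvd
  rw [associated_iff_eq] at hi'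
  interval_cases i
  · rw [pow_zero, Ideal.one_eq_top] at hi'
    rw [hi'] at hle
    exact absurd (top_le_iff.1 hle) hP.ne_top
  · rw [hi', pow_one]
  · exfalso
    have h1 : Ideal.span {p} ≤ P ^ 2 := by rw [← hi']; exact le_sup_right
    obtain ⟨I, hI⟩ := Ideal.dvd_iff_le.2 h1
    have h2 : P * I ≤ Ideal.span {p} := by
      intro w hw
      rw [Ideal.mem_span_singleton]
      apply hrad
      rw [← Ideal.mem_span_singleton, hI, sq w]
      have := Ideal.mul_mem_mul hw hw
      have h3 : P * I * (P * I) = (P ^ 2 * I) * I := by ring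
      rw [h3] at this
      exact (Ideal.mul_le_left : (P ^ 2 * I) * I ≤ P ^ 2 * I) this
    obtain ⟨J, hJ⟩ := Ideal.dvd_iff_le.2 h2
    have hPI : P * I ≠ 0 := by
      intro h0
      have : Ideal.span {p} = (⊥ : Ideal R) := by rw [hI, sq, mul_assoc, h0, mul_zero]; rfl
      exact hp0 (by simpa using this)
    have h4 : P * I * 1 = P * I * (P * J) := by
      rw [mul_one]; nth_rewrite 1 [hJ]; rw [hI]; ring
    have h5 := mul_left_cancel₀ hPI h4
    exact hPp.not_isUnit (IsUnit.of_mul_eq_one _ h5.symm)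

lemma RF.map_sq [IsGalois ℚ K] (h : RF r m) (hk : k.toSubalgebra.toSubmodule = Submodule.span ℚ (Set.range r))
    {n : ℕ} (hn : finrank ℚ K = 2 ^ n) {p : ℕ} (hp : p.Prime) (hp2 : p ≠ 2) (hpm : ∀ i, ¬ (p : ℤ) ∣ m i)
    {π : K} (hπ : π ^ 2 = p ∨ π ^ 2 = -p) (v : HeightOneSpectrum (𝓞 k)) (hv : (p : 𝓞 k) ∈ v.asIdeal) :
    ∃ Q : Ideal (𝓞 K), v.asIdeal.map (algebraMap (𝓞 k) (𝓞 K)) = Q ^ 2 := by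
  have hp0 : ((p : ℤ)) ≠ 0 := by exact_mod_cast hp.ne_zero
  have hrad : ∀ w : 𝓞 k, ((p : ℤ) : 𝓞 k) ∣ w ^ 2 → ((p : ℤ) : 𝓞 k) ∣ w := by
    intro w hw
    rw [← Dv_coe_k hp0] at hw ⊢
    have hwi : IsIntegral ℤ ((w : k) : K) := (w.isIntegral_coe).algebraMap (B := K)
    apply h.rad hk hn hp hp2 hpm (w : k).2 hwi
    simpa using hw
  have hsup := radical_sup ((p : ℤ) : 𝓞 k) (by exact_mod_cast hp.ne_zero) hrad v.asIdeal v.isPrime (by simpa using hv)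
  have hπi : IsIntegral ℤ π := by
    rcases hπ with h1 | h1
    · exact isInt_sqrt (m := p) (by simpa using h1)
    · exact isInt_sqrt (m := -p) (by simpa using h1)
  obtain ⟨ϖ, rfl⟩ := toO hπi
  have hϖ : ϖ ^ 2 = p ∨ ϖ ^ 2 = -p := by
    rcases hπ with h1 | h1
    · left; apply RingOfIntegers.coe_injective; simpa using h1
    · right; apply RingOfIntegers.coe_injective; simpa using h1
  have hspan : Ideal.span {ϖ ^ 2} = Ideal.span {((p : ℤ) : 𝓞 K)} := by
    rcases hϖ with h1 | h1
    · rw [h1]; simp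
    · rw [h1, Ideal.span_singleton_neg]; simp
  set J := v.asIdeal.map (algebraMap (𝓞 k) (𝓞 K)) with hJ
  have hJsup : J ^ 2 ⊔ Ideal.span {((p : ℤ) : 𝓞 K)} = J := by
    rw [hJ]
    conv_rhs => rw [← hsup]
    rw [Ideal.map_sup, Ideal.map_pow, Ideal.map_span, Set.image_singleton, map_intCast]
  refine ⟨J ⊔ Ideal.span {ϖ}, ?_⟩
  apply le_antisymm
  · conv_lhs => rw [← hJsup]
    refine sup_le (Ideal.pow_right_mono le_sup_left 2) ?_
    rw [← hspan, ← Ideal.span_singleton_pow]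
    exact Ideal.pow_right_mono le_sup_right 2
  · rw [sq, Ideal.sup_mul, Ideal.mul_sup, Ideal.mul_sup]
    refine sup_le (sup_le Ideal.mul_le_left Ideal.mul_le_left) (sup_le Ideal.mul_le_right ?_)
    rw [← sq, Ideal.span_singleton_pow, hspan]
    conv_rhs => rw [← hJsup]
    exact le_sup_right

lemma PS_finite (k : Type*) [Field k] [NumberField k] {p : ℕ} (hp : p ≠ 0) :
    {v : HeightOneSpectrum (𝓞 k) | (p : 𝓞 k) ∈ v.asIdeal}.Finite := by
  have := Ideal.finite_factors (I := Ideal.span {(p : 𝓞 k)}) (by simpa using hp)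
  refine this.subset ?_
  intro v hv
  exact Ideal.dvd_iff_le.2 ((Ideal.span_singleton_le_iff_mem _).2 hv)

lemma PS_ge (k : Type*) [Field k] [NumberField k] {p : ℕ} (hp : p ≠ 0) {t : ℕ} (I : Fin t → Ideal (𝓞 k))
    (hI : ∀ i, I i ≠ ⊤) (hpI : ∀ i, (p : 𝓞 k) ∈ I i) (hij : ∀ i j, i ≠ j → I i ⊔ I j = ⊤) :
    t ≤ {v : HeightOneSpectrum (𝓞 k) | (p : 𝓞 k) ∈ v.asIdeal}.ncard := by
  choose M hM hle using fun i => Ideal.exists_le_maximal _ (hI i)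
  have hM0 : ∀ i, M i ≠ ⊥ := by
    intro i h0
    have := hle i (hpI i)
    rw [h0, Ideal.mem_bot] at this
    exact hp (by exact_mod_cast this)
  let f : Fin t → {v : HeightOneSpectrum (𝓞 k) | (p : 𝓞 k) ∈ v.asIdeal} :=
    fun i => ⟨⟨M i, (hM i).isPrime, hM0 i⟩, hle i (hpI i)⟩
  have hf : Function.Injective f := by
    intro i j hfij
    by_contra hne
    have h1 : M i = M j := by
      have := congrArg (fun v => v.1.asIdeal) hfij
      exact this
    have h2 : I i ⊔ I j ≤ M i := sup_le (hle i) (by rw [h1]; exact hle j)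
    rw [hij i j hne] at h2
    exact (hM i).ne_top (top_le_iff.1 h2)
  have hfin := PS_finite k hp
  have := hfin.to_subtype
  have h3 := Nat.card_le_card_of_injective f hf
  rwa [Nat.card_fin, Nat.card_coe_set_eq] at h3

lemma exists_S (k : Type*) [Field k] [NumberField k] (T : Finset ℕ) (hT : ∀ p ∈ T, p.Prime) :
    ∃ S : Finset (HeightOneSpectrum (𝓞 k)), (∀ v, v ∈ S ↔ ∃ p ∈ T, (p : 𝓞 k) ∈ v.asIdeal) ∧
      S.card = ∑ p ∈ T, {v : HeightOneSpectrum (𝓞 k) | (p : 𝓞 k) ∈ v.asIdeal}.ncard := by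
  classical
  have hfin : ∀ p : T, {v : HeightOneSpectrum (𝓞 k) | ((p : ℕ) : 𝓞 k) ∈ v.asIdeal}.Finite :=
    fun p => PS_finite k (hT p p.2).ne_zero
  refine ⟨T.attach.biUnion fun p => (hfin p).toFinset, ?_, ?_⟩
  · intro v
    simp
  · rw [Finset.card_biUnion]
    · rw [← Finset.sum_attach T]
      apply Finset.sum_congr rfl
      intro p _
      rw [Set.ncard_eq_toFinset_card _ (hfin p)]
    · intro p _ q _ hpq
      refine Finset.disjoint_left.2 ?_
      intro v hv hv'
      simp only [Set.Finite.mem_toFinset, Set.mem_ofPred_eq] at hv hv'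
      have hne : (p : ℕ) ≠ q := fun h => hpq (Subtype.ext h)
      have hc := (Nat.isCoprime_iff_coprime.2 ((Nat.coprime_primes (hT p p.2) (hT q q.2)).2 hne))
      obtain ⟨a, b, hab⟩ := hc
      apply v.isPrime.ne_top
      rw [Ideal.eq_top_iff_one]
      have h1 : (1 : 𝓞 k) = a * (p : ℕ) + b * (q : ℕ) := by
        have := congrArg (Int.cast : ℤ → 𝓞 k) hab
        push_cast at this
        exact this.symm
      rw [h1]
      exact Ideal.add_mem _ (Ideal.mul_mem_left _ _ hv) (Ideal.mul_mem_left _ _ hv')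

end primes
end S18

open Module NumberField IsDedekindDomain

namespace S18
set_option linter.unusedSectionVars false

section counts
variable {K : Type*} [Field K] [NumberField K] [IsGalois ℚ K] {k : IntermediateField ℚ K}

lemma Dv.tr {a : ℤ} {x : K} (h : Dv a x) {t : ℤ} (ht : Algebra.trace ℚ K x = t) : a ∣ t := by
  obtain ⟨y, hy, rfl⟩ := h
  obtain ⟨s, hs⟩ := tr_int hy
  have h1 : ((a : ℤ) : K) * y = (a : ℚ) • y := by rw [Algebra.smul_def]; simp
  rw [h1, map_smul, hs] at ht
  rw [smul_eq_mul] at ht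
  exact ⟨s, by exact_mod_cast ht.symm⟩

lemma isInt_coe_k (x : 𝓞 k) : IsIntegral ℤ ((x : k) : K) := (x.isIntegral_coe).algebraMap (B := K)

lemma not_dvd_two_pow {p : ℕ} (hp : p.Prime) (hp2 : p ≠ 2) {a : ℤ} (ha : ¬ (p : ℤ) ∣ a) (n : ℕ) : ¬ (p : ℤ) ∣ 2 ^ n * a := by
  have hp' := Nat.prime_iff_prime_int.1 hp
  intro hd
  rcases hp'.dvd_or_dvd hd with hd | hd
  · have := hp'.dvd_of_dvd_pow hd
    have : p ∣ 2 := by exact_mod_cast this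
    exact hp2 ((Nat.prime_dvd_prime_iff_eq hp Nat.prime_two).1 this)
  · exact ha hd

lemma tr_intK {n : ℕ} (hn : finrank ℚ K = 2 ^ n) (a : ℤ) : Algebra.trace ℚ K (a : K) = ((2 ^ n * a : ℤ) : ℚ) := by
  have : ((a : ℤ) : K) = algebraMap ℚ K a := by simp
  rw [this, Algebra.trace_algebraMap, hn]
  simp

lemma prop4 {n : ℕ} (hn : finrank ℚ K = 2 ^ n) {p : ℕ} (hp : p.Prime) (hp2 : p ≠ 2) {m D ρ s : ℤ}
    (a b : 𝓞 k) (ha : a ^ 2 = m) (hb : b ^ 2 = D) (hta : Algebra.trace ℚ K ((a : k) : K) = 0)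
    (htb : Algebra.trace ℚ K ((b : k) : K) = 0) (htab : Algebra.trace ℚ K (((a : k) : K) * ((b : k) : K)) = 0)
    (hm : (p : ℤ) ∣ m - ρ ^ 2) (hD : (p : ℤ) ∣ D - s ^ 2) (hρ : ¬ (p : ℤ) ∣ ρ) (hs : ¬ (p : ℤ) ∣ s) :
    Ideal.span {(p : 𝓞 k), a - ρ, b - s} ≠ ⊤ := by
  intro htop
  rw [Ideal.eq_top_iff_one, Ideal.mem_span_insert] at htop
  obtain ⟨x, z, hz, hxz⟩ := htop
  rw [Ideal.mem_span_pair] at hz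
  obtain ⟨y, w, rfl⟩ := hz
  obtain ⟨c, hc⟩ := hm
  obtain ⟨d, hd⟩ := hD
  have hc' : (m : 𝓞 k) - ρ ^ 2 = p * c := by exact_mod_cast congrArg (Int.cast : ℤ → 𝓞 k) hc
  have hd' : (D : 𝓞 k) - s ^ 2 = p * d := by exact_mod_cast congrArg (Int.cast : ℤ → 𝓞 k) hd
  have h1 : ((p : ℤ) : 𝓞 k) ∣ (a + ρ) * (b + s) := by
    refine ⟨x * (a + ρ) * (b + s) + y * c * (b + s) + w * d * (a + ρ), ?_⟩
    push_cast
    linear_combination (a + ρ) * (b + s) * hxz + y * (b + s) * hc' + y * (b + s) * ha + w * (a + ρ) * hd' + w * (a + ρ) * hb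
  have hp0 : ((p : ℤ)) ≠ 0 := by exact_mod_cast hp.ne_zero
  rw [← Dv_coe_k hp0] at h1
  have h2 : (p : ℤ) ∣ 2 ^ n * (ρ * s) := by
    refine h1.tr ?_
    have : ((((a + ρ) * (b + s) : 𝓞 k) : k) : K) = ((a : k) : K) * ((b : k) : K) + (s : ℚ) • ((a : k) : K) + (ρ : ℚ) • ((b : k) : K)
        + ((ρ * s : ℤ) : K) := by
      rw [Algebra.smul_def, Algebra.smul_def]
      simp
      ring
    rw [this, map_add, map_add, map_add, map_smul, map_smul, hta, htb, htab, tr_intK hn]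
    simp
  refine not_dvd_two_pow hp hp2 ?_ n h2
  intro h3
  rcases (Nat.prime_iff_prime_int.1 hp).dvd_or_dvd h3 with h4 | h4
  exacts [hρ h4, hs h4]

lemma prop2 {n : ℕ} (hn : finrank ℚ K = 2 ^ n) {p : ℕ} (hp : p.Prime) (hp2 : p ≠ 2) {m ρ : ℤ}
    (a : 𝓞 k) (ha : a ^ 2 = m) (hta : Algebra.trace ℚ K ((a : k) : K) = 0)
    (hm : (p : ℤ) ∣ m - ρ ^ 2) (hρ : ¬ (p : ℤ) ∣ ρ) :
    Ideal.span {(p : 𝓞 k), a - ρ} ≠ ⊤ := by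
  intro htop
  rw [Ideal.eq_top_iff_one, Ideal.mem_span_pair] at htop
  obtain ⟨x, y, hxz⟩ := htop
  obtain ⟨c, hc⟩ := hm
  have hc' : (m : 𝓞 k) - ρ ^ 2 = p * c := by exact_mod_cast congrArg (Int.cast : ℤ → 𝓞 k) hc
  have h1 : ((p : ℤ) : 𝓞 k) ∣ (a + ρ) := by
    refine ⟨x * (a + ρ) + y * c, ?_⟩
    push_cast
    linear_combination -(a + ρ) * hxz + y * hc' + y * ha
  have hp0 : ((p : ℤ)) ≠ 0 := by exact_mod_cast hp.ne_zero
  rw [← Dv_coe_k hp0] at h1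
  have h2 : (p : ℤ) ∣ 2 ^ n * ρ := by
    refine h1.tr ?_
    have : (((a + ρ : 𝓞 k) : k) : K) = ((a : k) : K) + ((ρ : ℤ) : K) := by simp
    rw [this, map_add, hta, tr_intK hn]
    simp
  exact not_dvd_two_pow hp hp2 hρ n h2

lemma comax {R : Type*} [CommRing R] {p : ℕ} (hp : p.Prime) (hp2 : p ≠ 2) {ρ : ℤ} (hρ : ¬ (p : ℤ) ∣ ρ)
    (a : R) (I J : Ideal R) (hI : (p : R) ∈ I) (haI : a - ρ ∈ I) (haJ : a + ρ ∈ J) : I ⊔ J = ⊤ := by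
  have h1 := not_dvd_two_pow hp hp2 hρ 1
  obtain ⟨x, y, hxy⟩ := (Nat.prime_iff_prime_int.1 hp).coprime_iff_not_dvd.2 h1
  have hxy' : (x : R) * p + y * (2 ^ 1 * ρ) = 1 := by exact_mod_cast congrArg (Int.cast : ℤ → R) hxy
  rw [Ideal.eq_top_iff_one]
  have : (1 : R) = (x * p - y * (a - ρ)) + y * (a + ρ) := by linear_combination -hxy'
  rw [this]
  exact Submodule.add_mem_sup (I.sub_mem (I.mul_mem_left _ hI) (I.mul_mem_left _ haI)) (J.mul_mem_left _ haJ)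

lemma PS_one {p : ℕ} (hp : p.Prime) :
    1 ≤ {v : HeightOneSpectrum (𝓞 k) | (p : 𝓞 k) ∈ v.asIdeal}.ncard := by
  apply PS_ge k hp.ne_zero (fun _ : Fin 1 => Ideal.span {(p : 𝓞 k)})
  · intro _ h
    rw [Ideal.eq_top_iff_one, Ideal.mem_span_singleton] at h
    have hp0 : ((p : ℤ)) ≠ 0 := by exact_mod_cast hp.ne_zero
    have h1 : ((p : ℤ) : 𝓞 k) ∣ 1 := by simpa using h
    rw [← Dv_coe_k hp0] at h1
    have h2 : Dv (p : ℤ) ((1 : ℤ) : K) := by simpa using h1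
    have h3 := h2.int
    have : p ∣ 1 := by exact_mod_cast h3
    exact hp.one_lt.ne' (Nat.dvd_one.1 this)
  · intro _; exact Ideal.mem_span_singleton_self _
  · intro i j hij; exact absurd (Subsingleton.elim i j) hij

lemma PS_two {n : ℕ} (hn : finrank ℚ K = 2 ^ n) {p : ℕ} (hp : p.Prime) (hp2 : p ≠ 2) {m ρ : ℤ}
    (a : 𝓞 k) (ha : a ^ 2 = m) (hta : Algebra.trace ℚ K ((a : k) : K) = 0)
    (hm : (p : ℤ) ∣ m - ρ ^ 2) (hρ : ¬ (p : ℤ) ∣ ρ) :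
    2 ≤ {v : HeightOneSpectrum (𝓞 k) | (p : 𝓞 k) ∈ v.asIdeal}.ncard := by
  have h1 := prop2 hn hp hp2 a ha hta hm hρ
  have h2 := prop2 hn hp hp2 (ρ := -ρ) a ha hta (by simpa using hm) (by simpa using hρ)
  have h12 := comax hp hp2 hρ a (Ideal.span {(p : 𝓞 k), a - ρ}) (Ideal.span {(p : 𝓞 k), a - ((-ρ : ℤ) : 𝓞 k)})
    (Ideal.subset_span (by simp)) (Ideal.subset_span (by simp)) (Ideal.subset_span (by simp))
  apply PS_ge k hp.ne_zero ![Ideal.span {(p : 𝓞 k), a - ρ}, Ideal.span {(p : 𝓞 k), a - ((-ρ : ℤ) : 𝓞 k)}]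
  · intro i; fin_cases i
    exacts [h1, h2]
  · intro i; fin_cases i <;> exact Ideal.subset_span (by simp)
  · intro i j hij
    fin_cases i <;> fin_cases j
    · exact absurd rfl hij
    · exact h12
    · rw [sup_comm]; exact h12
    · exact absurd rfl hij

lemma PS_four {n : ℕ} (hn : finrank ℚ K = 2 ^ n) {p : ℕ} (hp : p.Prime) (hp2 : p ≠ 2) {m D ρ s : ℤ}
    (a b : 𝓞 k) (ha : a ^ 2 = m) (hb : b ^ 2 = D) (hta : Algebra.trace ℚ K ((a : k) : K) = 0)
    (htb : Algebra.trace ℚ K ((b : k) : K) = 0) (htab : Algebra.trace ℚ K (((a : k) : K) * ((b : k) : K)) = 0)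
    (hm : (p : ℤ) ∣ m - ρ ^ 2) (hD : (p : ℤ) ∣ D - s ^ 2) (hρ : ¬ (p : ℤ) ∣ ρ) (hs : ¬ (p : ℤ) ∣ s) :
    4 ≤ {v : HeightOneSpectrum (𝓞 k) | (p : 𝓞 k) ∈ v.asIdeal}.ncard := by
  let I : ℤ → ℤ → Ideal (𝓞 k) := fun ρ s => Ideal.span {(p : 𝓞 k), a - ρ, b - s}
  have hp1 : I ρ s ≠ ⊤ := prop4 hn hp hp2 (ρ := ρ) (s := s) a b ha hb hta htb htab hm hD hρ hs
  have hp3 : I ρ (-s) ≠ ⊤ := prop4 hn hp hp2 (ρ := ρ) (s := -s) a b ha hb hta htb htab hm (by simpa using hD) hρ (by simpa using hs)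
  have hp4 : I (-ρ) s ≠ ⊤ := prop4 hn hp hp2 (ρ := -ρ) (s := s) a b ha hb hta htb htab (by simpa using hm) hD (by simpa using hρ) hs
  have hp5 : I (-ρ) (-s) ≠ ⊤ := prop4 hn hp hp2 (ρ := -ρ) (s := -s) a b ha hb hta htb htab (by simpa using hm) (by simpa using hD)
    (by simpa using hρ) (by simpa using hs)
  have hpI : ∀ ρ s, (p : 𝓞 k) ∈ I ρ s := fun ρ s => Ideal.subset_span (by simp)
  have haI : ∀ ρ s, a - ρ ∈ I ρ s := fun ρ s => Ideal.subset_span (by simp)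
  have hbI : ∀ ρ s, b - s ∈ I ρ s := fun ρ s => Ideal.subset_span (by simp)
  have hA : ∀ s s', I ρ s ⊔ I (-ρ) s' = ⊤ := fun s s' => comax hp hp2 hρ a _ _ (hpI _ _) (haI _ _)
    (by have := haI (-ρ) s'; simpa using this)
  have hB : ∀ ρ ρ', I ρ s ⊔ I ρ' (-s) = ⊤ := fun ρ ρ' => comax hp hp2 hs b _ _ (hpI _ _) (hbI _ _)
    (by have := hbI ρ' (-s); simpa using this)
  have hA' : ∀ s s', I (-ρ) s' ⊔ I ρ s = ⊤ := fun s s' => by rw [sup_comm]; exact hA s s'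
  have hB' : ∀ ρ ρ', I ρ' (-s) ⊔ I ρ s = ⊤ := fun ρ ρ' => by rw [sup_comm]; exact hB ρ ρ'
  clear_value I
  have c12 := hB ρ ρ
  have c13 := hA s s
  have c14 := hA s (-s)
  have c23 := hA (-s) s
  have c24 := hA (-s) (-s)
  have c34 := hB (-ρ) (-ρ)
  have q1 := hpI ρ s
  have q2 := hpI ρ (-s)
  have q3 := hpI (-ρ) s
  have q4 := hpI (-ρ) (-s)
  generalize I ρ s = I1 at *
  generalize I ρ (-s) = I2 at *
  generalize I (-ρ) s = I3 at *
  generalize I (-ρ) (-s) = I4 at *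
  apply PS_ge k hp.ne_zero ![I1, I2, I3, I4]
  · intro i; fin_cases i
    exacts [hp1, hp3, hp4, hp5]
  · intro i; fin_cases i
    exacts [q1, q2, q3, q4]
  · intro i j hij
    have d12 : I2 ⊔ I1 = ⊤ := by rw [sup_comm]; exact c12
    have d13 : I3 ⊔ I1 = ⊤ := by rw [sup_comm]; exact c13
    have d14 : I4 ⊔ I1 = ⊤ := by rw [sup_comm]; exact c14
    have d23 : I3 ⊔ I2 = ⊤ := by rw [sup_comm]; exact c23
    have d24 : I4 ⊔ I2 = ⊤ := by rw [sup_comm]; exact c24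
    have d34 : I4 ⊔ I3 = ⊤ := by rw [sup_comm]; exact c34
    fin_cases i <;> fin_cases j
    exacts [absurd rfl hij, c12, c13, c14, d12, absurd rfl hij, c23, c24, d13, d23, absurd rfl hij, c34, d14, d24, d34, absurd rfl hij]

/-- some of `m`, `D`, `mD` is a residue -/
lemma residue {p : ℕ} (hp : p.Prime) (m D : ℤ) :
    (∃ ρ : ℤ, (p : ℤ) ∣ m - ρ ^ 2) ∨ (∃ ρ : ℤ, (p : ℤ) ∣ D - ρ ^ 2) ∨ (∃ ρ : ℤ, (p : ℤ) ∣ m * D - ρ ^ 2) := by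
  have := Fact.mk hp
  have key : ∀ x : ℤ, IsSquare (x : ZMod p) → ∃ ρ : ℤ, (p : ℤ) ∣ x - ρ ^ 2 := by
    rintro x ⟨y, hy⟩
    obtain ⟨ρ, rfl⟩ := ZMod.intCast_surjective y
    refine ⟨ρ, ?_⟩
    rw [← ZMod.intCast_zmod_eq_zero_iff_dvd]
    push_cast
    rw [hy]; ring
  by_cases h1 : IsSquare (m : ZMod p)
  · exact Or.inl (key m h1)
  by_cases h2 : IsSquare (D : ZMod p)
  · exact Or.inr (Or.inl (key D h2))
  right; right
  apply key
  push_cast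
  rw [← quadraticChar_neg_one_iff_not_isSquare] at h1 h2
  have h3 : quadraticChar (ZMod p) (m * D) = 1 := by rw [map_mul, h1, h2]; norm_num
  refine (quadraticChar_one_iff_isSquare ?_).1 h3
  intro h0
  rw [h0, quadraticChar_zero] at h3
  exact zero_ne_one h3

end counts
end S18

open Module NumberField IsDedekindDomain

namespace S18
set_option linter.unusedSectionVars false

section inf
variable {K : Type*} [Field K] [NumberField K] {ι : Type*} [Fintype ι]
variable {r : ι → K} {m : ι → ℤ} {k : IntermediateField ℚ K}

lemma inf_ge (k : Type*) [Field k] [NumberField k] : finrank ℚ k ≤ 2 * Fintype.card (InfinitePlace k) := by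
  rw [InfinitePlace.card_eq_nrRealPlaces_add_nrComplexPlaces, ← InfinitePlace.card_add_two_mul_card_eq_rank]
  omega

lemma RF.mem (hk : k.toSubalgebra.toSubmodule = Submodule.span ℚ (Set.range r)) (i : ι) : r i ∈ k := by
  have : r i ∈ k.toSubalgebra.toSubmodule := by rw [hk]; exact Submodule.subset_span ⟨i, rfl⟩
  exact this

lemma RF.inf_real (h : RF r m) (hk : k.toSubalgebra.toSubmodule = Submodule.span ℚ (Set.range r))
    (hpos : ∀ i, 0 < m i) : Fintype.card (InfinitePlace k) = finrank ℚ k := by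
  have hreal : IsTotallyReal k := by
    refine ⟨fun v => ?_⟩
    rw [InfinitePlace.isReal_iff, ComplexEmbedding.isReal_iff]
    set φ := v.embedding
    ext x
    rw [ComplexEmbedding.conjugate_coe_eq]
    obtain ⟨c, hc⟩ := (mem_k_iff hk x).1 x.2
    have hx : x = ∑ i, c i • (⟨r i, RF.mem hk i⟩ : k) := by
      apply Subtype.ext
      rw [← hc]
      simp
    rw [hx, map_sum, map_sum]
    apply Finset.sum_congr rfl
    intro i _
    rw [Algebra.smul_def, map_mul, map_mul]
    have h1 : φ (⟨r i, RF.mem hk i⟩ : k) ^ 2 = m i := by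
      rw [← map_pow]
      have : (⟨r i, RF.mem hk i⟩ : k) ^ 2 = (m i : k) := by
        apply Subtype.ext
        simpa using h.hsq i
      rw [this, map_intCast]
    set z := φ (⟨r i, RF.mem hk i⟩ : k)
    have hz : z.im = 0 := by
      have hre := congrArg Complex.re h1
      have him := congrArg Complex.im h1
      rw [sq] at hre him
      simp at hre him
      have hm : (0 : ℝ) < m i := by exact_mod_cast hpos i
      have him' : z.re * z.im = 0 := by linarith
      rcases mul_eq_zero.1 him' with h2 | h2
      · rw [h2] at hre; nlinarith
      · exact h2
    congr 1
    · simp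
    · exact Complex.conj_eq_iff_im.2 hz
  have h0 : InfinitePlace.nrComplexPlaces k = 0 := IsTotallyReal.nrComplexPlaces_eq_zero k
  rw [InfinitePlace.card_eq_nrRealPlaces_add_nrComplexPlaces, ← InfinitePlace.card_add_two_mul_card_eq_rank, h0]

end inf

section bq
variable {K : Type*} [Field K] [NumberField K] [IsGalois ℚ K]

lemma exists_neg {y : K} {d : ℤ} (hy : y ^ 2 = d) (hd : ¬ IsSquare (d : ℚ)) : ∃ g : K ≃ₐ[ℚ] K, g y = -y := by
  by_contra hno
  push Not at hno
  have h1 : ∀ g : K ≃ₐ[ℚ] K, g y = y := by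
    intro g
    have : g y ^ 2 = y ^ 2 := by rw [← map_pow, hy]; simp
    rcases sq_eq_sq_iff_eq_or_eq_neg.1 this with h | h
    · exact h
    · exact absurd h (hno g)
  have h2 : y ∈ (⊥ : IntermediateField ℚ K) := (IsGalois.mem_bot_iff_fixed _).2 h1
  obtain ⟨w, hw⟩ := IntermediateField.mem_bot.1 h2
  apply hd
  refine ⟨w, ?_⟩
  have : algebraMap ℚ K (d : ℚ) = algebraMap ℚ K (w * w) := by
    rw [map_mul, hw, ← sq, hy]; simp
  exact (algebraMap ℚ K).injective this

lemma nonsq_ne {d : ℤ} (hd : ¬ IsSquare (d : ℚ)) : d ≠ 0 := by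
  rintro rfl
  exact hd (by simp)

lemma RF_bq {α β : K} {m D : ℤ} (hα : α ^ 2 = m) (hβ : β ^ 2 = D) (hm : ¬ IsSquare (m : ℚ)) (hD : ¬ IsSquare (D : ℚ))
    (hmD : ¬ IsSquare ((m * D : ℤ) : ℚ)) : RF ![1, α, β, α * β] ![1, m, D, m * D] := by
  have hαβ : (α * β) ^ 2 = ((m * D : ℤ) : K) := by rw [mul_pow, hα, hβ]; simp
  obtain ⟨g1, hg1⟩ := exists_neg hα hm
  obtain ⟨g2, hg2⟩ := exists_neg hβ hD
  obtain ⟨g3, hg3⟩ := exists_neg hαβ hmD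
  have e1 : α * (α * β) = m * β := by rw [← hα]; ring
  have e2 : β * (α * β) = D * α := by rw [← hβ]; ring
  have e3 : (α * β) * α = m * β := by rw [← hα]; ring
  have e4 : (α * β) * β = D * α := by rw [← hβ]; ring
  have e5 : β * α = α * β := by ring
  refine ⟨?_, ?_, ⟨0, rfl⟩, ?_, ?_⟩
  · intro i; fin_cases i
    · simp
    · simpa using hα
    · simpa using hβ
    · simpa using hαβ
  · intro i; fin_cases i
    · simp
    · exact nonsq_ne hm
    · exact nonsq_ne hD
    · exact nonsq_ne hmD
  · intro i j
    fin_cases i <;> fin_cases j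
    · exact ⟨0, 1, by simp⟩
    · exact ⟨1, 1, by simp⟩
    · exact ⟨2, 1, by simp⟩
    · exact ⟨3, 1, by simp⟩
    · exact ⟨1, 1, by simp⟩
    · exact ⟨0, m, by simp [Algebra.smul_def, ← hα, sq]⟩
    · exact ⟨3, 1, by simp⟩
    · exact ⟨2, m, by simp [Algebra.smul_def, e1]⟩
    · exact ⟨2, 1, by simp⟩
    · exact ⟨3, 1, by simp [e5]⟩
    · exact ⟨0, D, by simp [Algebra.smul_def, ← hβ, sq]⟩
    · exact ⟨1, D, by simp [Algebra.smul_def, e2]⟩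
    · exact ⟨3, 1, by simp⟩
    · exact ⟨2, m, by simp [Algebra.smul_def, e3]⟩
    · exact ⟨1, D, by simp [Algebra.smul_def, e4]⟩
    · exact ⟨0, m * D, by have := hαβ; simp [Algebra.smul_def]; rw [← hα, ← hβ]; ring⟩
  · intro i j hij
    fin_cases i <;> fin_cases j
    · exact absurd rfl hij
    · exact ⟨g1, by simp [hg1]⟩
    · exact ⟨g2, by simp [hg2]⟩
    · exact ⟨g3, by simpa using hg3⟩
    · exact ⟨g1, by simp [hg1]⟩
    · exact absurd rfl hij
    · exact ⟨g3, by simpa using hg3⟩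
    · exact ⟨g2, by change g2 (α * (α * β)) = -(α * (α * β)); rw [e1]; simp [hg2]⟩
    · exact ⟨g2, by simp [hg2]⟩
    · exact ⟨g3, by change g3 (β * α) = -(β * α); rw [e5]; exact hg3⟩
    · exact absurd rfl hij
    · exact ⟨g1, by change g1 (β * (α * β)) = -(β * (α * β)); rw [e2]; simp [hg1]⟩
    · exact ⟨g3, by simpa using hg3⟩
    · exact ⟨g2, by change g2 ((α * β) * α) = -((α * β) * α); rw [e3]; simp [hg2]⟩
    · exact ⟨g1, by change g1 ((α * β) * β) = -((α * β) * β); rw [e4]; simp [hg1]⟩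
    · exact absurd rfl hij

lemma RF_q {α : K} {m : ℤ} (hα : α ^ 2 = m) (hm : ¬ IsSquare (m : ℚ)) : RF ![1, α] ![1, m] := by
  obtain ⟨g1, hg1⟩ := exists_neg hα hm
  refine ⟨?_, ?_, ⟨0, rfl⟩, ?_, ?_⟩
  · intro i; fin_cases i
    · simp
    · simpa using hα
  · intro i; fin_cases i
    · simp
    · exact nonsq_ne hm
  · intro i j
    fin_cases i <;> fin_cases j
    · exact ⟨0, 1, by simp⟩
    · exact ⟨1, 1, by simp⟩
    · exact ⟨1, 1, by simp⟩
    · exact ⟨0, m, by simp [Algebra.smul_def, ← hα, sq]⟩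
  · intro i j hij
    fin_cases i <;> fin_cases j
    · exact absurd rfl hij
    · exact ⟨g1, by simp [hg1]⟩
    · exact ⟨g1, by simp [hg1]⟩
    · exact absurd rfl hij

/-- independent automorphisms -/
lemma exists_auts {α β : K} {m D : ℤ} (hα : α ^ 2 = m) (hβ : β ^ 2 = D) (hm : ¬ IsSquare (m : ℚ)) (hD : ¬ IsSquare (D : ℚ))
    (hmD : ¬ IsSquare ((m * D : ℤ) : ℚ)) : ∃ σ τ : K ≃ₐ[ℚ] K, σ α = α ∧ σ β = -β ∧ τ α = -α ∧ τ β = β := by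
  have hαβ : (α * β) ^ 2 = ((m * D : ℤ) : K) := by rw [mul_pow, hα, hβ]; simp
  obtain ⟨g1, hg1⟩ := exists_neg hα hm
  obtain ⟨g2, hg2⟩ := exists_neg hβ hD
  obtain ⟨g3, hg3⟩ := exists_neg hαβ hmD
  have pm : ∀ (g : K ≃ₐ[ℚ] K) (y : K) (d : ℤ), y ^ 2 = d → g y = y ∨ g y = -y := by
    intro g y d h
    apply sq_eq_sq_iff_eq_or_eq_neg.1
    rw [← map_pow, h]; simp
  have hα0 : α ≠ 0 := by
    rintro rfl
    exact nonsq_ne hm (by exact_mod_cast (by simpa using hα.symm : (m : K) = 0))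
  have hβ0 : β ≠ 0 := by
    rintro rfl
    exact nonsq_ne hD (by exact_mod_cast (by simpa using hβ.symm : (D : K) = 0))
  have hab0 : α * β ≠ 0 := mul_ne_zero hα0 hβ0
  have hne : α * β ≠ -(α * β) := by
    intro h
    exact hab0 (self_eq_neg.1 h)
  have h3 : (g3 α = α ∧ g3 β = -β) ∨ (g3 α = -α ∧ g3 β = β) := by
    rw [map_mul] at hg3
    rcases pm g3 α m hα with h | h <;> rcases pm g3 β D hβ with h' | h' <;> rw [h, h'] at hg3
    · exact absurd hg3 hne
    · exact Or.inl ⟨h, h'⟩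
    · exact Or.inr ⟨h, h'⟩
    · exact absurd (by rw [← hg3]; ring) hne
  rcases h3 with ⟨h3a, h3b⟩ | ⟨h3a, h3b⟩
  · rcases pm g1 β D hβ with h | h
    · exact ⟨g3, g1, h3a, h3b, hg1, h⟩
    · refine ⟨g3, g1 * g3, h3a, h3b, ?_, ?_⟩
      · rw [AlgEquiv.mul_apply, h3a, hg1]
      · rw [AlgEquiv.mul_apply, h3b, map_neg, h, neg_neg]
  · rcases pm g2 α m hα with h | h
    · exact ⟨g2, g3, h, hg2, h3a, h3b⟩
    · refine ⟨g2 * g3, g3, ?_, ?_, h3a, h3b⟩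
      · rw [AlgEquiv.mul_apply, h3a, map_neg, h, neg_neg]
      · rw [AlgEquiv.mul_apply, h3b, hg2]

end bq
end S18

open Module NumberField IsDedekindDomain

namespace S18
set_option linter.unusedSectionVars false

section main
variable {K : Type*} [Field K] [NumberField K] [IsGalois ℚ K]

lemma exists_e {k : IntermediateField ℚ K} {n w : ℕ} (hn : finrank ℚ K = 2 ^ n) (hw : finrank ℚ k = 2 ^ w) :
    ∃ e, finrank k K = 2 ^ e ∧ w + e = n := by
  have h := finrank_mul_finrank ℚ k K
  rw [hn] at h
  obtain ⟨e, -, he⟩ := (Nat.dvd_prime_pow Nat.prime_two).1 (Dvd.intro_left _ h)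
  refine ⟨e, he, ?_⟩
  rw [he, hw, ← pow_add] at h
  exact Nat.pow_right_injective le_rfl h

lemma liftk {k : IntermediateField ℚ K} {α : K} (hαk : α ∈ k) (hα : IsIntegral ℤ α) : ∃ a : 𝓞 k, ((a : k) : K) = α := by
  have hy' : IsIntegral ℤ (⟨α, hαk⟩ : k) := by
    have : IsIntegral ℤ (algebraMap k K ⟨α, hαk⟩) := hα
    exact (isIntegral_algebraMap_iff (algebraMap k K).injective).1 this
  obtain ⟨z, hz⟩ := toO hy'
  exact ⟨z, congrArg (algebraMap k K) hz⟩

lemma liftk_sqrt {k : IntermediateField ℚ K} {α : K} (hαk : α ∈ k) {m : ℤ} (hα : α ^ 2 = m) :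
    ∃ a : 𝓞 k, ((a : k) : K) = α ∧ a ^ 2 = m := by
  obtain ⟨a, ha⟩ := liftk hαk (isInt_sqrt hα)
  refine ⟨a, ha, ?_⟩
  apply RingOfIntegers.coe_injective
  apply Subtype.ext
  simp only [map_pow, map_intCast]
  rw [SubmonoidClass.coe_pow, ha, hα]
  simp

lemma PS_two' {k : IntermediateField ℚ K} {n : ℕ} (hn : finrank ℚ K = 2 ^ n) {p : ℕ} (hp : p.Prime) (hp2 : p ≠ 2) {m ρ : ℤ}
    {α : K} (hαk : α ∈ k) (hα : α ^ 2 = m) (hm : ¬ IsSquare (m : ℚ)) (hpm : ¬ (p : ℤ) ∣ m)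
    (hρ : (p : ℤ) ∣ m - ρ ^ 2) :
    2 ≤ {v : HeightOneSpectrum (𝓞 k) | (p : 𝓞 k) ∈ v.asIdeal}.ncard := by
  obtain ⟨a, ha, ha2⟩ := liftk_sqrt hαk hα
  obtain ⟨g, hg⟩ := exists_neg hα hm
  refine PS_two hn hp hp2 a ha2 (by rw [ha]; exact tr_zero g hg) hρ ?_
  intro hd
  apply hpm
  have := dvd_add hρ (dvd_pow hd two_ne_zero)
  simpa using this

lemma not_dvd_res {p : ℕ} {m ρ : ℤ} (hpm : ¬ (p : ℤ) ∣ m) (hρ : (p : ℤ) ∣ m - ρ ^ 2) : ¬ (p : ℤ) ∣ ρ := by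
  intro hd
  apply hpm
  have := dvd_add hρ (dvd_pow hd two_ne_zero)
  simpa using this

theorem bq_count [IsTotallyComplex K] (hodd : Odd (Nat.card (ClassGroup (𝓞 K)))) {n : ℕ} (hn : finrank ℚ K = 2 ^ n)
    {α β : K} {m D : ℤ} (hα : α ^ 2 = m) (hβ : β ^ 2 = D) (hm : ¬ IsSquare (m : ℚ)) (hD : ¬ IsSquare (D : ℚ))
    (hmD : ¬ IsSquare ((m * D : ℤ) : ℚ)) (T : Finset ℕ) (hT : ∀ p ∈ T, p.Prime ∧ p ≠ 2 ∧ ¬ (p : ℤ) ∣ m * D ∧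
      ∃ π : K, π ^ 2 = p ∨ π ^ 2 = -p) :
    ∃ (k : IntermediateField ℚ K) (S : Finset (HeightOneSpectrum (𝓞 k))) (I : ℕ),
      k.toSubalgebra.toSubmodule = Submodule.span ℚ (Set.range ![1, α, β, α * β]) ∧
      (∀ v, v ∈ S ↔ ∃ p ∈ T, (p : 𝓞 k) ∈ v.asIdeal) ∧
      2 * T.card ≤ S.card ∧
      (∀ q ∈ T, (∃ ρ : ℤ, (q : ℤ) ∣ m - ρ ^ 2) → (∃ ρ : ℤ, (q : ℤ) ∣ D - ρ ^ 2) → 2 * T.card + 2 ≤ S.card) ∧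
      2 ≤ I ∧ (0 < m → 0 < D → I = 4) ∧ I + S.card + 2 ≤ 4 + n ∧
      (∀ u : 𝓞 k, IsCoprime u 2 → (∀ δ c : 𝓞 k, (∀ v, v ∉ S → δ ∉ v.asIdeal) → ¬ (4 : 𝓞 k) ∣ δ - u * c ^ 2) →
        I + S.card + 3 ≤ 4 + n) ∧
      ((∃ y : K, y ^ 2 = -1) → (∀ c : 𝓞 k, ¬ (4 : 𝓞 k) ∣ c ^ 2 + 1) → I + S.card + 3 ≤ 4 + n) := by
  have hRF := RF_bq hα hβ hm hD hmD
  obtain ⟨k, hk⟩ := hRF.exists_field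
  have hfr : finrank ℚ k = 4 := by rw [hRF.fr hk]; rfl
  obtain ⟨e, he, hen⟩ := exists_e (w := 2) hn hfr
  obtain ⟨S, hS, hScard⟩ := exists_S k T (fun p hp => (hT p hp).1)
  have hαk : α ∈ k := RF.mem hk 1
  have hβk : β ∈ k := RF.mem hk 2
  have hαβk : α * β ∈ k := RF.mem hk 3
  have hαβ : (α * β) ^ 2 = ((m * D : ℤ) : K) := by rw [mul_pow, hα, hβ]; simp
  have hpm : ∀ p ∈ T, ¬ (p : ℤ) ∣ m := fun p hp h => (hT p hp).2.2.1 (Dvd.dvd.mul_right h _)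
  have hpD : ∀ p ∈ T, ¬ (p : ℤ) ∣ D := fun p hp h => (hT p hp).2.2.1 (Dvd.dvd.mul_left h _)
  have hge2 : ∀ p ∈ T, 2 ≤ {v : HeightOneSpectrum (𝓞 k) | (p : 𝓞 k) ∈ v.asIdeal}.ncard := by
    intro p hp
    obtain ⟨hpp, hp2, hpmD, -⟩ := hT p hp
    rcases residue hpp m D with ⟨ρ, h⟩ | ⟨ρ, h⟩ | ⟨ρ, h⟩
    · exact PS_two' hn hpp hp2 hαk hα hm (hpm p hp) h
    · exact PS_two' hn hpp hp2 hβk hβ hD (hpD p hp) h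
    · exact PS_two' hn hpp hp2 hαβk hαβ hmD hpmD h
  have hcount := counting (k := k) (K := K) hodd S (by
      intro v hv h2
      obtain ⟨p, hp, hpv⟩ := (hS v).1 hv
      obtain ⟨a, b, hab⟩ := (Nat.isCoprime_iff_coprime.2 ((Nat.coprime_primes (hT p hp).1 Nat.prime_two).2 (hT p hp).2.1))
      apply v.isPrime.ne_top
      rw [Ideal.eq_top_iff_one]
      have h1 : (1 : 𝓞 k) = a * p + b * 2 := by
        have := congrArg (Int.cast : ℤ → 𝓞 k) hab
        push_cast at this
        exact this.symm
      rw [h1]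
      exact Ideal.add_mem _ (Ideal.mul_mem_left _ _ hpv) (Ideal.mul_mem_left _ _ h2)) (by
      intro v hv
      obtain ⟨p, hp, hpv⟩ := (hS v).1 hv
      obtain ⟨hpp, hp2, hpmD, π, hπ⟩ := hT p hp
      refine hRF.map_sq hk hn hpp hp2 ?_ hπ v hpv
      intro i
      fin_cases i
      · intro h1
        change (p : ℤ) ∣ 1 at h1
        have : p ∣ 1 := by exact_mod_cast h1
        exact hpp.one_lt.ne' (Nat.dvd_one.1 this)
      · exact hpm p hp
      · exact hpD p hp
      · exact hpmD) e he
  rw [hfr] at hcount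
  obtain ⟨c1, c2, c3⟩ := hcount
  refine ⟨k, S, Fintype.card (InfinitePlace k), hk, hS, ?_, ?_, ?_, ?_, by omega, ?_, ?_⟩
  · rw [hScard, mul_comm, ← smul_eq_mul]
    exact Finset.card_nsmul_le_sum _ _ _ hge2
  · rintro q hq ⟨ρ, hρ⟩ ⟨s, hs⟩
    obtain ⟨hpp, hp2, hpmD, -⟩ := hT q hq
    obtain ⟨a, ha, ha2⟩ := liftk_sqrt hαk hα
    obtain ⟨b, hb, hb2⟩ := liftk_sqrt hβk hβ
    obtain ⟨g1, hg1⟩ := exists_neg hα hm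
    obtain ⟨g2, hg2⟩ := exists_neg hβ hD
    obtain ⟨g3, hg3⟩ := exists_neg hαβ hmD
    have h4 := PS_four hn hpp hp2 a b ha2 hb2 (by rw [ha]; exact tr_zero g1 hg1) (by rw [hb]; exact tr_zero g2 hg2)
      (by rw [ha, hb]; exact tr_zero g3 hg3) hρ hs (not_dvd_res (hpm q hq) hρ) (not_dvd_res (hpD q hq) hs)
    rw [hScard, ← Finset.add_sum_erase _ _ hq]
    have h5 : (T.erase q).card • 2 ≤ ∑ p ∈ T.erase q, {v : HeightOneSpectrum (𝓞 k) | (p : 𝓞 k) ∈ v.asIdeal}.ncard :=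
      Finset.card_nsmul_le_sum _ _ _ (fun p hp => hge2 p (Finset.mem_of_mem_erase hp))
    rw [Finset.card_erase_of_mem hq, smul_eq_mul] at h5
    have : 0 < T.card := Finset.card_pos.2 ⟨q, hq⟩
    omega
  · have := inf_ge k
    omega
  · intro h1 h2
    rw [hRF.inf_real hk, hfr]
    intro i
    fin_cases i
    · exact one_pos
    · exact h1
    · exact h2
    · exact mul_pos h1 h2
  · intro u hu h
    have := c2 u hu h
    omega
  · intro hy h
    have := c3 hy h
    omega

/-- quadratic version -/
theorem q_count [IsTotallyComplex K] (hodd : Odd (Nat.card (ClassGroup (𝓞 K)))) {n : ℕ} (hn : finrank ℚ K = 2 ^ n)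
    {α : K} {m : ℤ} (hα : α ^ 2 = m) (hm : ¬ IsSquare (m : ℚ)) (T : Finset ℕ) (hT : ∀ p ∈ T, p.Prime ∧ p ≠ 2 ∧ ¬ (p : ℤ) ∣ m ∧
      ∃ π : K, π ^ 2 = p ∨ π ^ 2 = -p) (f : ℕ → ℕ)
      (hf : ∀ p ∈ T, f p ≤ 1 ∨ (f p = 2 ∧ ∃ ρ : ℤ, (p : ℤ) ∣ m - ρ ^ 2)) :
    ∃ (k : IntermediateField ℚ K) (I : ℕ),
      k.toSubalgebra.toSubmodule = Submodule.span ℚ (Set.range ![1, α]) ∧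
      1 ≤ I ∧ (0 < m → I = 2) ∧
      ((∃ y : K, y ^ 2 = -1) → (∀ c : 𝓞 k, ¬ (4 : 𝓞 k) ∣ c ^ 2 + 1) → I + ∑ p ∈ T, f p + 2 ≤ 2 + n) := by
  have hRF := RF_q hα hm
  obtain ⟨k, hk⟩ := hRF.exists_field
  have hfr : finrank ℚ k = 2 := by rw [hRF.fr hk]; rfl
  obtain ⟨e, he, hen⟩ := exists_e (w := 1) hn hfr
  obtain ⟨S, hS, hScard⟩ := exists_S k T (fun p hp => (hT p hp).1)
  have hαk : α ∈ k := RF.mem hk 1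
  have hge : ∀ p ∈ T, f p ≤ {v : HeightOneSpectrum (𝓞 k) | (p : 𝓞 k) ∈ v.asIdeal}.ncard := by
    intro p hp
    obtain ⟨hpp, hp2, hpm, -⟩ := hT p hp
    rcases hf p hp with h | ⟨h, ρ, hρ⟩
    · exact h.trans (PS_one hpp)
    · rw [h]; exact PS_two' hn hpp hp2 hαk hα hm hpm hρ
  have hcount := counting (k := k) (K := K) hodd S (by
      intro v hv h2
      obtain ⟨p, hp, hpv⟩ := (hS v).1 hv
      obtain ⟨a, b, hab⟩ := (Nat.isCoprime_iff_coprime.2 ((Nat.coprime_primes (hT p hp).1 Nat.prime_two).2 (hT p hp).2.1))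
      apply v.isPrime.ne_top
      rw [Ideal.eq_top_iff_one]
      have h1 : (1 : 𝓞 k) = a * p + b * 2 := by
        have := congrArg (Int.cast : ℤ → 𝓞 k) hab
        push_cast at this
        exact this.symm
      rw [h1]
      exact Ideal.add_mem _ (Ideal.mul_mem_left _ _ hpv) (Ideal.mul_mem_left _ _ h2)) (by
      intro v hv
      obtain ⟨p, hp, hpv⟩ := (hS v).1 hv
      obtain ⟨hpp, hp2, hpm, π, hπ⟩ := hT p hp
      refine hRF.map_sq hk hn hpp hp2 ?_ hπ v hpv
      intro i
      fin_cases i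
      · intro h1
        change (p : ℤ) ∣ 1 at h1
        have : p ∣ 1 := by exact_mod_cast h1
        exact hpp.one_lt.ne' (Nat.dvd_one.1 this)
      · exact hpm) e he
  rw [hfr] at hcount
  obtain ⟨c1, c2, c3⟩ := hcount
  refine ⟨k, Fintype.card (InfinitePlace k), hk, ?_, ?_, ?_⟩
  · have := inf_ge k
    omega
  · intro h1
    rw [hRF.inf_real hk, hfr]
    intro i
    fin_cases i
    · exact one_pos
    · exact h1
  · intro hy h
    have := c3 hy h
    have h5 : ∑ p ∈ T, f p ≤ S.card := by rw [hScard]; exact Finset.sum_le_sum hge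
    omega

end main
end S18

open Module NumberField IsDedekindDomain

namespace S18
set_option linter.unusedSectionVars false

section arith

lemma dvd_both {q : ℕ} (hq : q.Prime) {D : ℤ} (hD : ∀ ρ : ℤ, ¬ (q : ℤ) ∣ D - ρ ^ 2) {X Y : ℤ}
    (h : (q : ℤ) ∣ X ^ 2 - D * Y ^ 2) : (q : ℤ) ∣ X ∧ (q : ℤ) ∣ Y := by
  have hq' : Prime (q : ℤ) := Nat.prime_iff_prime_int.1 hq
  have hY : (q : ℤ) ∣ Y := by
    by_contra hY
    have hc : IsCoprime (q : ℤ) Y := (Prime.coprime_iff_not_dvd hq').2 hY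
    obtain ⟨a, b, hab⟩ := hc
    apply hD (b * X)
    have e : D - (b * X) ^ 2 = -(b ^ 2 * (X ^ 2 - D * Y ^ 2)) + q * (D * a * (1 + b * Y)) := by
      have h1 : b * Y = 1 - a * q := by linarith
      have : D - (b * X) ^ 2 + (b ^ 2 * (X ^ 2 - D * Y ^ 2)) = D * (1 - (b * Y)) * (1 + b * Y) := by ring
      have h2 : D * (1 - (b * Y)) * (1 + b * Y) = q * (D * a * (1 + b * Y)) := by
        have : 1 - b * Y = a * q := by linarith
        rw [this]; ring
      linarith
    rw [e]
    exact dvd_add (dvd_neg.2 (Dvd.dvd.mul_left h _)) (dvd_mul_right _ _)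
  refine ⟨?_, hY⟩
  have : (q : ℤ) ∣ X ^ 2 := by
    have h2 : (q : ℤ) ∣ D * Y ^ 2 := Dvd.dvd.mul_left (dvd_pow hY two_ne_zero) _
    have := dvd_add h h2
    simpa using this
  exact hq'.dvd_of_dvd_pow this

lemma val_even {q : ℕ} (hq : q.Prime) {D : ℤ} (hD : ∀ ρ : ℤ, ¬ (q : ℤ) ∣ D - ρ ^ 2) :
    ∀ (N : ℕ) (X Y : ℤ), X.natAbs + Y.natAbs = N → X ^ 2 - D * Y ^ 2 ≠ 0 → Even (padicValInt q (X ^ 2 - D * Y ^ 2)) := by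
  have : Fact q.Prime := ⟨hq⟩
  intro N
  induction N using Nat.strong_induction_on with
  | _ N ih =>
    intro X Y hN h0
    by_cases h : (q : ℤ) ∣ X ^ 2 - D * Y ^ 2
    · obtain ⟨⟨x, rfl⟩, ⟨y, rfl⟩⟩ := dvd_both hq hD h
      have e : ((q : ℤ) * x) ^ 2 - D * (q * y) ^ 2 = q * (q * (x ^ 2 - D * y ^ 2)) := by ring
      have h1 : x ^ 2 - D * y ^ 2 ≠ 0 := by
        intro h1; apply h0; rw [e, h1]; simp
      have hq0 : (q : ℤ) ≠ 0 := by exact_mod_cast hq.ne_zero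
      rw [e, padicValInt.mul hq0 (mul_ne_zero hq0 h1), padicValInt.mul hq0 h1, padicValInt.self hq.one_lt]
      have hlt : x.natAbs + y.natAbs < N := by
        rw [Int.natAbs_mul, Int.natAbs_mul, Int.natAbs_natCast] at hN
        have : 0 < x.natAbs + y.natAbs := by
          by_contra hc
          have hx : x = 0 := by omega
          have hy : y = 0 := by omega
          apply h1; rw [hx, hy]; simp
        have := hq.two_le
        nlinarith
      have := ih _ hlt x y rfl h1
      obtain ⟨j, hj⟩ := this
      exact ⟨j + 1, by omega⟩
    · rw [padicValInt.eq_zero_of_not_dvd h]; exact ⟨0, rfl⟩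

lemma clear_denom {M D : ℤ} {A B : ℚ} (h : (M : ℚ) = A ^ 2 - D * B ^ 2) :
    ∃ X Y Z : ℤ, Z ≠ 0 ∧ M * Z ^ 2 = X ^ 2 - D * Y ^ 2 := by
  refine ⟨A.num * B.den, B.num * A.den, A.den * B.den, ?_, ?_⟩
  · exact mul_ne_zero (by exact_mod_cast A.den_nz) (by exact_mod_cast B.den_nz)
  · have h1 : (A.num : ℚ) = A * A.den := (Rat.mul_den_eq_num A).symm
    have h2 : (B.num : ℚ) = B * B.den := (Rat.mul_den_eq_num B).symm
    have : ((M * ((A.den : ℤ) * B.den) ^ 2 : ℤ) : ℚ) = (((A.num * B.den) ^ 2 - D * (B.num * A.den) ^ 2 : ℤ) : ℚ) := by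
      push_cast
      rw [h1, h2, h]; ring
    exact_mod_cast this

lemma val_form {q : ℕ} (hq : q.Prime) {M D : ℤ} (hD : ∀ ρ : ℤ, ¬ (q : ℤ) ∣ D - ρ ^ 2) (hM : M ≠ 0) {A B : ℚ}
    (h : (M : ℚ) = A ^ 2 - D * B ^ 2) : Even (padicValInt q M) := by
  have : Fact q.Prime := ⟨hq⟩
  obtain ⟨X, Y, Z, hZ, h⟩ := clear_denom h
  have h0 : M * Z ^ 2 ≠ 0 := mul_ne_zero hM (pow_ne_zero _ hZ)
  have := val_even hq hD _ X Y rfl (h ▸ h0)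
  rw [← h, sq, padicValInt.mul hM (mul_ne_zero hZ hZ), padicValInt.mul hZ hZ] at this
  rw [Nat.even_add] at this
  exact this.2 ⟨_, rfl⟩

/-- `-1` is not a square mod `ℓ ≡ 3 mod 4`. -/
lemma neg_one_nonres {l : ℕ} (hl : l.Prime) (hl4 : l % 4 = 3) (ρ : ℤ) : ¬ (l : ℤ) ∣ (-1) - ρ ^ 2 := by
  intro h
  have : Fact l.Prime := ⟨hl⟩
  have h1 : (((-1 - ρ ^ 2 : ℤ)) : ZMod l) = 0 := (ZMod.intCast_zmod_eq_zero_iff_dvd _ _).2 h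
  push_cast at h1
  have h2 : IsSquare (-1 : ZMod l) := ⟨ρ, by linear_combination h1⟩
  exact ZMod.exists_sq_eq_neg_one_iff.1 h2 hl4

lemma sign_form {l : ℕ} (hl : l.Prime) (hl4 : l % 4 = 3) {D D' c : ℤ} (hD : D = l * D') (hD' : ¬ (l : ℤ) ∣ D') (hc : c ≠ 0) {A B : ℚ}
    (h : ((-c ^ 2 : ℤ) : ℚ) = A ^ 2 - D * B ^ 2) : False := by
  have : Fact l.Prime := ⟨hl⟩
  obtain ⟨X, Y, Z, hZ, h⟩ := clear_denom h
  have hcz : 0 < (c * Z) ^ 2 := by positivity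
  have e : X ^ 2 - (-1) * (c * Z) ^ 2 = D * Y ^ 2 := by linarith
  have h0 : X ^ 2 - (-1) * (c * Z) ^ 2 ≠ 0 := by nlinarith [sq_nonneg X]
  have h1 := val_even hl (neg_one_nonres hl hl4) _ X (c * Z) rfl h0
  rw [e] at h1 h0
  have hD0 : D ≠ 0 := left_ne_zero_of_mul h0
  have hY0 : Y ≠ 0 := fun hy => h0 (by rw [hy]; simp)
  have hl0 : (l : ℤ) ≠ 0 := by exact_mod_cast hl.ne_zero
  have hD'0 : D' ≠ 0 := fun hy => hD0 (by rw [hD, hy]; simp)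
  rw [sq, padicValInt.mul hD0 (mul_ne_zero hY0 hY0), padicValInt.mul hY0 hY0, hD, padicValInt.mul hl0 hD'0, padicValInt.self hl.one_lt,
    padicValInt.eq_zero_of_not_dvd hD'] at h1
  obtain ⟨j, hj⟩ := h1
  omega

/-- A number with a single odd prime and suitable forms is an odd square. -/
lemma is_sq {q : ℕ} (hq : q.Prime) {M m D : ℤ} (hM : M ≠ 0) (hMq : ∀ p : ℕ, p.Prime → (p : ℤ) ∣ M → p = q)
    {A1 B1 A2 B2 : ℚ} (h1 : (M : ℚ) = A1 ^ 2 - m * B1 ^ 2) (h2 : (M : ℚ) = A2 ^ 2 - D * B2 ^ 2)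
    (hnr : (∀ ρ : ℤ, ¬ (q : ℤ) ∣ m - ρ ^ 2) ∨ (∀ ρ : ℤ, ¬ (q : ℤ) ∣ D - ρ ^ 2))
    {l : ℕ} (hl : l.Prime) (hl4 : l % 4 = 3) (hlm : (∃ m', m = l * m' ∧ ¬ (l : ℤ) ∣ m') ∨ (∃ D', D = l * D' ∧ ¬ (l : ℤ) ∣ D')) :
    ∃ c : ℤ, M = c ^ 2 := by
  have hev : Even (padicValInt q M) := by
    rcases hnr with h | h
    · exact val_form hq h hM h1
    · exact val_form hq h hM h2
  have hpow : M.natAbs = q ^ M.natAbs.primeFactorsList.length :=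
    Nat.eq_prime_pow_of_unique_prime_dvd (Int.natAbs_ne_zero.2 hM) (fun {d} hd hdm => hMq d hd (Int.natCast_dvd.2 hdm))
  set j := M.natAbs.primeFactorsList.length
  have hj : padicValInt q M = j := by
    have : Fact q.Prime := ⟨hq⟩
    rw [padicValInt, hpow, padicValNat.prime_pow]
  rw [hj] at hev
  obtain ⟨i, hi⟩ := hev
  have hMi : (M.natAbs : ℤ) = ((q : ℤ) ^ i) ^ 2 := by
    rw [hpow, hi]; push_cast; ring
  rcases Int.natAbs_eq M with h | h
  · exact ⟨(q : ℤ) ^ i, by rw [h, hMi]⟩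
  · exfalso
    have hMc : M = -((q : ℤ) ^ i) ^ 2 := by rw [h, hMi]
    have hc : (q : ℤ) ^ i ≠ 0 := pow_ne_zero _ (by exact_mod_cast hq.ne_zero)
    rw [hMc] at h1 h2
    rcases hlm with ⟨m', e, h'⟩ | ⟨m', e, h'⟩
    · exact sign_form hl hl4 e h' hc h1
    · exact sign_form hl hl4 e h' hc h2

lemma odd_sq_mod8 {c : ℤ} (h : c % 2 = 1) : c ^ 2 % 8 = 1 := by
  have : c % 8 = 1 ∨ c % 8 = 3 ∨ c % 8 = 5 ∨ c % 8 = 7 := by omega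
  rcases this with h | h | h | h <;> simp [pow_two, Int.mul_emod, h]

lemma one_mod4 : ∀ (M : ℕ), (∀ p : ℕ, p.Prime → p ∣ M → p % 4 = 1) → M ≠ 0 → M % 4 = 1 := by
  intro M
  induction M using Nat.recOnMul with
  | zero => intro _ h; exact absurd rfl h
  | one => intros; rfl
  | prime p hp => intro h _; exact h p hp dvd_rfl
  | mul a b ha hb =>
    intro h h0
    have h1 := ha (fun p hp hd => h p hp (Dvd.dvd.mul_right hd _)) (left_ne_zero_of_mul h0)
    have h2 := hb (fun p hp hd => h p hp (Dvd.dvd.mul_left hd _)) (right_ne_zero_of_mul h0)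
    rw [Nat.mul_mod, h1, h2]

end arith
end S18

open Module NumberField IsDedekindDomain

namespace S18
set_option linter.unusedSectionVars false

section norm
variable {K : Type*} [Field K] [NumberField K] [IsGalois ℚ K]

/-- biquadratic data -/
structure BQ (k : IntermediateField ℚ K) (α β : K) (m D : ℤ) (σ τ : K ≃ₐ[ℚ] K) : Prop where
  hk : k.toSubalgebra.toSubmodule = Submodule.span ℚ (Set.range ![1, α, β, α * β])
  hα : α ^ 2 = m
  hβ : β ^ 2 = D
  s1 : σ α = α
  s2 : σ β = -β
  t1 : τ α = -α
  t2 : τ β = β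

/-- norm as a product of four conjugates -/
def Nm (σ τ : K ≃ₐ[ℚ] K) (x : K) : K := x * σ x * (τ x * σ (τ x))

lemma Nm_mul (σ τ : K ≃ₐ[ℚ] K) (x y : K) : Nm σ τ (x * y) = Nm σ τ x * Nm σ τ y := by
  simp only [Nm, map_mul]; ring

lemma isInt_map {x : K} (hx : IsIntegral ℤ x) (g : K ≃ₐ[ℚ] K) : IsIntegral ℤ (g x) :=
  hx.map (g.toAlgHom.restrictScalars ℤ)

lemma Nm_int {σ τ : K ≃ₐ[ℚ] K} {x : K} (hx : IsIntegral ℤ x) : IsIntegral ℤ (Nm σ τ x) :=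
  (hx.mul (isInt_map hx σ)).mul ((isInt_map hx τ).mul (isInt_map (isInt_map hx τ) σ))

lemma Dv.mul_sub {a : ℤ} {x x' y y' : K} (h : Dv a (x - x')) (h' : Dv a (y - y')) (hx : IsIntegral ℤ x) (hy' : IsIntegral ℤ y') :
    Dv a (x * y - x' * y') := by
  have e : x * y - x' * y' = (y - y') * x + (x - x') * y' := by ring
  rw [e]
  exact (h'.mul hx).add (h.mul hy')

lemma Nm_congr {σ τ : K ≃ₐ[ℚ] K} {a : ℤ} {x y : K} (hx : IsIntegral ℤ x) (hy : IsIntegral ℤ y) (h : Dv a (x - y)) :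
    Dv a (Nm σ τ x - Nm σ τ y) := by
  have hs : Dv a (σ x - σ y) := by rw [← map_sub]; exact h.map σ
  have ht : Dv a (τ x - τ y) := by rw [← map_sub]; exact h.map τ
  have hst : Dv a (σ (τ x) - σ (τ y)) := by rw [← map_sub]; exact ht.map σ
  have ix := isInt_map hx σ
  have iy := isInt_map hy σ
  exact (h.mul_sub hs hx iy).mul_sub (ht.mul_sub hst (isInt_map hx τ) (isInt_map (isInt_map hy τ) σ))
    (hx.mul ix) ((isInt_map hy τ).mul (isInt_map (isInt_map hy τ) σ))

variable {k : IntermediateField ℚ K} {α β : K} {m D : ℤ} {σ τ : K ≃ₐ[ℚ] K}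

lemma mem_bq (h : BQ k α β m D σ τ) {x : K} (hx : x ∈ k) : ∃ a b c d : ℚ, x = a + b * α + c * β + d * (α * β) := by
  obtain ⟨c, hc⟩ := (mem_k_iff h.hk x).1 hx
  refine ⟨c 0, c 1, c 2, c 3, ?_⟩
  rw [← hc]
  simp [Fin.sum_univ_four, Algebra.smul_def]

lemma conj_bq (h : BQ k α β m D σ τ) (a b c d : ℚ) :
    σ ((a : K) + b * α + c * β + d * (α * β)) = a + b * α - c * β - d * (α * β) ∧
    τ ((a : K) + b * α + c * β + d * (α * β)) = a - b * α + c * β - d * (α * β) ∧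
    σ (τ ((a : K) + b * α + c * β + d * (α * β))) = a - b * α - c * β + d * (α * β) := by
  refine ⟨?_, ?_, ?_⟩ <;> simp [h.s1, h.s2, h.t1, h.t2] <;> ring

/-- explicit norm forms -/
lemma Nm_form (h : BQ k α β m D σ τ) (a b c d : ℚ) :
    Nm σ τ ((a : K) + b * α + c * β + d * (α * β)) =
      (((a ^ 2 + m * b ^ 2 - D * (c ^ 2 + m * d ^ 2)) ^ 2 - m * (2 * (a * b - D * (c * d))) ^ 2 : ℚ) : K) ∧
    Nm σ τ ((a : K) + b * α + c * β + d * (α * β)) =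
      (((a ^ 2 + D * c ^ 2 - m * (b ^ 2 + D * d ^ 2)) ^ 2 - D * (2 * (a * c - m * (b * d))) ^ 2 : ℚ) : K) := by
  obtain ⟨h1, h2, h3⟩ := conj_bq h a b c d
  have ha := h.hα
  have hb := h.hβ
  unfold Nm
  rw [h3, h1, h2]
  push_cast
  rw [← ha, ← hb]
  constructor <;> ring

lemma Nm_rat (h : BQ k α β m D σ τ) {x : K} (hx : x ∈ k) (hxi : IsIntegral ℤ x) :
    ∃ (M : ℤ) (A1 B1 A2 B2 : ℚ), Nm σ τ x = M ∧ (M : ℚ) = A1 ^ 2 - m * B1 ^ 2 ∧ (M : ℚ) = A2 ^ 2 - D * B2 ^ 2 := by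
  obtain ⟨a, b, c, d, rfl⟩ := mem_bq h hx
  obtain ⟨h1, h2⟩ := Nm_form h a b c d
  have hi := Nm_int (σ := σ) (τ := τ) hxi
  have hi1 := hi
  rw [h1] at hi1
  obtain ⟨M, hM⟩ := rat_int _ hi1
  refine ⟨M, _, _, a ^ 2 + D * c ^ 2 - m * (b ^ 2 + D * d ^ 2), 2 * (a * c - m * (b * d)), ?_, hM.symm, ?_⟩
  · rw [h1, hM]; simp
  · rw [h1] at h2
    have := (algebraMap ℚ K).injective h2
    rw [← hM, this]

/-- primes dividing the norm -/
lemma Nm_coprime {T : Finset ℕ} (hT : ∀ p ∈ T, p.Prime)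
    {S : Finset (HeightOneSpectrum (𝓞 k))} (hS : ∀ v, v ∈ S ↔ ∃ p ∈ T, (p : 𝓞 k) ∈ v.asIdeal)
    {δ : 𝓞 k} (hδ : ∀ v, v ∉ S → δ ∉ v.asIdeal) {M : ℤ} (hM : Nm σ τ ((δ : k) : K) = M) {q : ℕ} (hq : q.Prime) (hqT : q ∉ T) :
    ¬ (q : ℤ) ∣ M := by
  intro hd
  have htop : Ideal.span {δ, (q : 𝓞 k)} = ⊤ := by
    by_contra hne
    obtain ⟨P, hP, hle⟩ := Ideal.exists_le_maximal _ hne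
    have hqP : (q : 𝓞 k) ∈ P := hle (Ideal.subset_span (by simp))
    have hδP : δ ∈ P := hle (Ideal.subset_span (by simp))
    have hP0 : P ≠ ⊥ := by
      rintro rfl
      have : (q : 𝓞 k) = 0 := by simpa using hqP
      exact hq.ne_zero (by exact_mod_cast this)
    refine hδ ⟨P, hP.isPrime, hP0⟩ ?_ hδP
    rw [hS]
    rintro ⟨p, hp, hpP⟩
    have hne : p ≠ q := fun e => hqT (e ▸ hp)
    obtain ⟨a, b, hab⟩ := (Nat.isCoprime_iff_coprime.2 ((Nat.coprime_primes (hT p hp) hq).2 hne))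
    apply hP.ne_top
    rw [Ideal.eq_top_iff_one]
    have h1 : (1 : 𝓞 k) = a * p + b * q := by
      have := congrArg (Int.cast : ℤ → 𝓞 k) hab
      push_cast at this
      exact this.symm
    rw [h1]
    exact Ideal.add_mem _ (Ideal.mul_mem_left _ _ hpP) (Ideal.mul_mem_left _ _ hqP)
  rw [Ideal.eq_top_iff_one, Ideal.mem_span_pair] at htop
  obtain ⟨a, b, hab⟩ := htop
  have hab' : ((a : k) : K) * ((δ : k) : K) + ((b : k) : K) * q = 1 := by
    have := congrArg (fun x : 𝓞 k => ((x : k) : K)) hab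
    simpa using this
  have ia := isInt_coe_k (K := K) a
  have ib := isInt_coe_k (K := K) b
  have iδ := isInt_coe_k (K := K) δ
  have hc : Dv q (1 - ((a : k) : K) * ((δ : k) : K)) := by
    refine ⟨((b : k) : K), ib, ?_⟩
    rw [← hab']; push_cast; ring
  have h1 := Nm_congr (σ := σ) (τ := τ) isIntegral_one (ia.mul iδ) hc
  rw [Nm_mul, hM] at h1
  have h2 : Dv q (Nm σ τ ((a : k) : K) * (M : K)) := by
    rw [mul_comm]
    exact (Dv.of_int hd).mul (Nm_int ia)
  have h3 := h1.add h2
  have h4 : Nm σ τ (1 : K) - Nm σ τ ((a : k) : K) * (M : K) + Nm σ τ ((a : k) : K) * (M : K) = ((1 : ℤ) : K) := by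
    simp [Nm]
  rw [h4] at h3
  have h5 := h3.int
  exact hq.one_lt.ne' (by exact_mod_cast Int.eq_one_of_dvd_one (by positivity) h5)

lemma u_coprime {u : 𝓞 k} {U : ℤ} (hU : Nm σ τ ((u : k) : K) = U) (hodd : U % 2 = 1) : IsCoprime u 2 := by
  have iu := isInt_coe_k (K := K) u
  have hu0 : ((u : k) : K) ≠ 0 := by
    intro h0
    rw [h0] at hU
    have : (U : K) = 0 := by rw [← hU]; simp [Nm]
    have : U = 0 := by exact_mod_cast this
    omega
  have hw : IsIntegral ℤ ((U : K) * (((u : k) : K))⁻¹) := by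
    have e : (U : K) * (((u : k) : K))⁻¹ = σ ((u : k) : K) * (τ ((u : k) : K) * σ (τ ((u : k) : K))) := by
      rw [← hU]
      unfold Nm
      field_simp
    rw [e]
    exact (isInt_map iu σ).mul ((isInt_map iu τ).mul (isInt_map (isInt_map iu τ) σ))
  have hmem : (U : K) * (((u : k) : K))⁻¹ ∈ k := k.mul_mem (intCast_mem k U) (k.inv_mem (u : k).2)
  obtain ⟨w, hw'⟩ := liftk hmem hw
  refine ⟨w, -((U / 2 : ℤ) : 𝓞 k), ?_⟩
  apply RingOfIntegers.coe_injective
  apply Subtype.ext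
  have e : (U : K) = 2 * ((U / 2 : ℤ) : K) + 1 := by
    have : U = 2 * (U / 2) + 1 := by omega
    exact_mod_cast congrArg (Int.cast : ℤ → K) this
  have : ((w : k) : K) * ((u : k) : K) = U := by rw [hw']; field_simp
  have h2 : (((2 : 𝓞 k) : k) : K) = 2 := rfl
  simp
  rw [this, e, h2]
  ring

end norm
end S18

open Module NumberField IsDedekindDomain

namespace S18
set_option linter.unusedSectionVars false

section norm
variable {K : Type*} [Field K] [NumberField K] [IsGalois ℚ K]
variable {k : IntermediateField ℚ K} {α β : K} {m D : ℤ} {σ τ : K ≃ₐ[ℚ] K}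

lemma BQ.mems (h : BQ k α β m D σ τ) (a b c d : ℚ) : (a : K) + b * α + c * β + d * (α * β) ∈ k := by
  have hα : α ∈ k := RF.mem h.hk 1
  have hβ : β ∈ k := RF.mem h.hk 2
  have hq : ∀ q : ℚ, (q : K) ∈ k := fun q => k.algebraMap_mem q
  exact k.add_mem (k.add_mem (k.add_mem (hq _) (k.mul_mem (hq _) hα)) (k.mul_mem (hq _) hβ))
    (k.mul_mem (hq _) (k.mul_mem hα hβ))

lemma BQ.conj (h : BQ k α β m D σ τ) {x : K} (hx : x ∈ k) :
    σ x ∈ k ∧ τ x ∈ k ∧ σ (σ x) = x ∧ τ (τ x) = x ∧ τ (σ x) = σ (τ x) := by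
  obtain ⟨a, b, c, d, rfl⟩ := mem_bq h hx
  obtain ⟨h1, h2, h3⟩ := conj_bq h a b c d
  refine ⟨?_, ?_, ?_, ?_, ?_⟩
  · rw [h1]
    have := h.mems a b (-c) (-d)
    push_cast at this
    convert this using 1; ring
  · rw [h2]
    have := h.mems a (-b) c (-d)
    push_cast at this
    convert this using 1; ring
  · rw [h1]; simp [h.s1, h.s2]
  · rw [h2]; simp [h.t1, h.t2]
  · rw [h1, h3]; simp [h.t1, h.t2]; ring

lemma odd_contra {w m x y : ℤ} (hw : w % 4 = 1) (hm : m % 4 = 3) (hxy : IsCoprime x y) (h : m * x ^ 2 = w * y ^ 2) : False := by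
  have hsq : ∀ z : ℤ, (z % 2 = 0 ∧ z ^ 2 % 4 = 0) ∨ (z % 2 = 1 ∧ z ^ 2 % 4 = 1) := by
    intro z
    have : z % 4 = 0 ∨ z % 4 = 1 ∨ z % 4 = 2 ∨ z % 4 = 3 := by omega
    rcases this with h | h | h | h
    · left; refine ⟨by omega, by simp [pow_two, Int.mul_emod, h]⟩
    · right; refine ⟨by omega, by simp [pow_two, Int.mul_emod, h]⟩
    · left; refine ⟨by omega, by simp [pow_two, Int.mul_emod, h]⟩
    · right; refine ⟨by omega, by simp [pow_two, Int.mul_emod, h]⟩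
  have h4 := congrArg (· % 4) h
  rw [Int.mul_emod, Int.mul_emod w, hw, hm] at h4
  rcases hsq x with ⟨a1, a2⟩ | ⟨a1, a2⟩ <;> rcases hsq y with ⟨b1, b2⟩ | ⟨b1, b2⟩ <;> rw [a2, b2] at h4 <;> norm_num at h4
  have : (2 : ℤ) ∣ 1 := by
    obtain ⟨a, b, hab⟩ := hxy
    rw [← hab]
    exact dvd_add (Dvd.dvd.mul_left (by omega) _) (Dvd.dvd.mul_left (by omega) _)
  norm_num at this

lemma tr_even (h : BQ k α β m D σ τ) (hm : m % 4 = 3) {z : K} (hz : z ∈ k) (hi : IsIntegral ℤ z) :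
    Dv 2 (z + σ z + τ z + σ (τ z)) := by
  have iy : IsIntegral ℤ (z + σ z) := hi.add (isInt_map hi σ)
  have it := isInt_map iy τ
  obtain ⟨a, b, c, d, rfl⟩ := mem_bq h hz
  obtain ⟨h1, h2, h3⟩ := conj_bq h a b c d
  have e1 : ((a : K) + b * α + c * β + d * (α * β)) + σ ((a : K) + b * α + c * β + d * (α * β)) = 2 * a + 2 * b * α := by
    rw [h1]; ring
  have e2 : τ (2 * (a : K) + 2 * b * α) = 2 * a - 2 * b * α := by
    simp only [map_add, map_mul, map_ofNat, h.t1, map_ratCast]; ring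
  rw [e1] at iy it
  rw [e2] at it
  have i1 := iy.add it
  have i2 := iy.mul it
  have e3 : (2 * (a : K) + 2 * b * α) + (2 * a - 2 * b * α) = ((4 * a : ℚ) : K) := by push_cast; ring
  have e4 : (2 * (a : K) + 2 * b * α) * (2 * a - 2 * b * α) = ((4 * a ^ 2 - 4 * m * b ^ 2 : ℚ) : K) := by
    push_cast; rw [← h.hα]; ring
  rw [e3] at i1
  rw [e4] at i2
  obtain ⟨s, hs⟩ := rat_int _ i1
  obtain ⟨t, ht⟩ := rat_int _ i2
  have e5 : ((a : K) + b * α + c * β + d * (α * β)) + σ ((a : K) + b * α + c * β + d * (α * β)) + τ ((a : K) + b * α + c * β + d * (α * β)) +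
     σ (τ ((a : K) + b * α + c * β + d * (α * β))) = (s : K) := by
    have : (s : K) = ((4 * a : ℚ) : K) := by rw [hs]; simp
    rw [h1, h3, h2, this]; push_cast; ring
  rw [e5]
  apply Dv.of_int
  by_contra hodd
  have hw : (s ^ 2 - 4 * t) % 4 = 1 := by
    have := odd_sq_mod8 (c := s) (by omega)
    omega
  have hq : (m : ℚ) * (4 * b) ^ 2 = ((s ^ 2 - 4 * t : ℤ) : ℚ) := by
    push_cast; rw [← hs, ← ht]; ring
  set B : ℚ := 4 * b
  have hB : (B.num : ℚ) = B * B.den := (Rat.mul_den_eq_num B).symm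
  refine odd_contra (x := B.num) (y := B.den) hw hm ?_ ?_
  · have := B.reduced
    rw [Int.isCoprime_iff_nat_coprime]; simpa using this
  · have : ((m * B.num ^ 2 : ℤ) : ℚ) = (((s ^ 2 - 4 * t) * (B.den : ℤ) ^ 2 : ℤ) : ℚ) := by
      rw [Int.cast_mul, Int.cast_mul, ← hq]
      push_cast; rw [hB]; ring
    exact_mod_cast this

lemma delta4 (h : BQ k α β m D σ τ) {δ u c : 𝓞 k} {M U : ℤ} (hM : Nm σ τ ((δ : k) : K) = M) (hU : Nm σ τ ((u : k) : K) = U)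
    (hodd : M % 2 = 1) (hd : (4 : 𝓞 k) ∣ δ - u * c ^ 2) : (4 : ℤ) ∣ M - U := by
  have iδ := isInt_coe_k (K := K) δ
  have iu := isInt_coe_k (K := K) u
  have ic := isInt_coe_k (K := K) c
  obtain ⟨C, -, -, -, -, hC, -, -⟩ := Nm_rat h (c : k).2 ic
  have h1 : Dv 4 (((δ : k) : K) - ((u : k) : K) * ((c : k) : K) ^ 2) := by
    have := (Dv_coe_k (K := K) (a := 4) (by norm_num) (x := δ - u * c ^ 2)).2 (by exact_mod_cast hd)
    simpa using this
  have h2 := Nm_congr (σ := σ) (τ := τ) iδ (iu.mul (ic.pow 2)) h1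
  rw [sq, Nm_mul, Nm_mul, hM, hU, hC] at h2
  have h3 : (4 : ℤ) ∣ M - U * (C * C) := by
    apply Dv.int (K := K)
    push_cast; exact h2
  have hCo : C % 2 = 1 := by
    by_contra hc
    have : (2 : ℤ) ∣ U * (C * C) := Dvd.dvd.mul_left (Dvd.dvd.mul_right (by omega) _) _
    omega
  have h8 := odd_sq_mod8 hCo
  have h4 : (4 : ℤ) ∣ U * (C * C - 1) := Dvd.dvd.mul_left (by rw [← sq]; omega) _
  have h5 := dvd_add h3 h4
  have e : M - U * (C * C) + U * (C * C - 1) = M - U := by ring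
  rwa [e] at h5

lemma delta8 (h : BQ k α β m D σ τ) (hm : m % 4 = 3) {δ u c : 𝓞 k} {M U : ℤ} (hM : Nm σ τ ((δ : k) : K) = M)
    (hU : Nm σ τ ((u : k) : K) = U)
    (hodd : M % 2 = 1) (hd : (4 : 𝓞 k) ∣ δ - u * c ^ 2) : (8 : ℤ) ∣ M - U := by
  have iu := isInt_coe_k (K := K) u
  have ic := isInt_coe_k (K := K) c
  obtain ⟨C, -, -, -, -, hC, -, -⟩ := Nm_rat h (c : k).2 ic
  obtain ⟨v, hv⟩ := hd
  have iv := isInt_coe_k (K := K) v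
  have hwk : ((u : k) : K) * ((c : k) : K) ^ 2 ∈ k := k.mul_mem (u : k).2 (pow_mem (c : k).2 2)
  have hvk : ((v : k) : K) ∈ k := (v : k).2
  have iw := iu.mul (ic.pow 2)
  have hδ : ((δ : k) : K) = ((u : k) : K) * ((c : k) : K) ^ 2 + 4 * ((v : k) : K) := by
    have e : δ = u * c ^ 2 + 4 * v := by rw [← hv]; ring
    rw [e]
    rfl
  have hNw : Nm σ τ (((u : k) : K) * ((c : k) : K) ^ 2) = ((U * (C * C) : ℤ) : K) := by
    rw [sq, Nm_mul, Nm_mul, hU, hC]; push_cast; ring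
  set w := ((u : k) : K) * ((c : k) : K) ^ 2
  set x := ((v : k) : K)
  rw [hδ] at hM
  obtain ⟨w1, w2, w3, w4, w5⟩ := h.conj hwk
  obtain ⟨x1, x2, x3, x4, x5⟩ := h.conj hvk
  obtain ⟨-, -, y3, -, y5⟩ := h.conj w2
  have z1 : σ (τ w) ∈ k := (h.conj w2).1
  have htr := tr_even h hm (k.mul_mem hvk (k.mul_mem w1 (k.mul_mem w2 z1)))
    (iv.mul ((isInt_map iw σ).mul ((isInt_map iw τ).mul (isInt_map (isInt_map iw τ) σ))))
  simp only [map_mul, w3, w4, w5, y3, y5] at htr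
  obtain ⟨r, hr, htr⟩ := htr
  have h3 : (8 : ℤ) ∣ M - U * (C * C) := by
    apply Dv.int (K := K)
    push_cast at hNw ⊢
    rw [← hM, ← hNw]
    have iw1 := isInt_map iw σ
    have iw2 := isInt_map iw τ
    have iw3 := isInt_map iw2 σ
    have iv1 := isInt_map iv σ
    have iv2 := isInt_map iv τ
    have iv3 := isInt_map iv2 σ
    have i4 : IsIntegral ℤ (4 : K) := by exact_mod_cast isInt_int (K := K) 4
    have i2 : IsIntegral ℤ (2 : K) := by exact_mod_cast isInt_int (K := K) 2
    -- first pair and second pair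
    refine ⟨r + 2 * ((x * σ x) * (τ w * σ (τ w)) + (w * σ w) * (τ x * σ (τ x))
      + (x * σ w + σ x * w) * (τ x * σ (τ w) + σ (τ x) * τ w)
      + 4 * ((x * σ x) * (τ x * σ (τ w) + σ (τ x) * τ w) + (x * σ w + σ x * w) * (τ x * σ (τ x)))
      + 4 * (4 * ((x * σ x) * (τ x * σ (τ x))))), ?_, ?_⟩
    · have p1 := iv.mul iv1
      have p2 := iw2.mul iw3
      have p3 := iw.mul iw1
      have p4 := iv2.mul iv3
      have p5 := (iv.mul iw1).add (iv1.mul iw)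
      have p6 := (iv2.mul iw3).add (iv3.mul iw2)
      exact hr.add (i2.mul (((((p1.mul p2).add (p3.mul p4)).add (p5.mul p6)).add (i4.mul ((p1.mul p6).add (p5.mul p4)))).add
        (i4.mul (i4.mul (p1.mul p4)))))
    · have e4 : (4 : K) = ((4 : ℚ) : K) := by norm_num
      unfold Nm
      simp only [map_add, map_mul, map_ofNat]
      push_cast at htr ⊢
      linear_combination 4 * htr
  have hCo : C % 2 = 1 := by
    by_contra hc
    have : (2 : ℤ) ∣ U * (C * C) := Dvd.dvd.mul_left (Dvd.dvd.mul_right (by omega) _) _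
    omega
  have h8 := odd_sq_mod8 hCo
  have h4 : (8 : ℤ) ∣ U * (C * C - 1) := Dvd.dvd.mul_left (by rw [← sq]; omega) _
  have h5 := dvd_add h3 h4
  have e : M - U * (C * C) + U * (C * C - 1) = M - U := by ring
  rwa [e] at h5

/-- existence of the special element `u` -/
lemma exists_u (h : BQ k α β m D σ τ) (hD : D % 4 = 1) (hm : m % 4 ≠ 0) :
    ∃ (u : 𝓞 k) (U : ℤ), Nm σ τ ((u : k) : K) = U ∧ U % 2 = 1 ∧ ((U % 4 = 3 ∧ m % 4 ≠ 3) ∨ (m % 4 = 3 ∧ U % 8 = 5)) := by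
  obtain ⟨t, ht⟩ : ∃ t, D = 1 + 4 * t := ⟨D / 4, by omega⟩
  have hα := h.hα
  have hβ := h.hβ
  have iα := isInt_sqrt hα
  have iβ := isInt_sqrt hβ
  have half : ∀ (y : K) (d : ℤ), y ^ 2 = d → d % 4 = 1 → IsIntegral ℤ ((1 + y) / 2) := by
    intro y d hy hd
    obtain ⟨r, hr⟩ : ∃ r, d = 1 + 4 * r := ⟨d / 4, by omega⟩
    refine quad_int (a := 1) (b := (r : K)) isIntegral_one (isInt_int r) ?_
    have : y ^ 2 = 1 + 4 * (r : K) := by rw [hy, hr]; push_cast; ring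
    linear_combination this / 4
  have mk : ∀ (a b c d : ℚ) (U : ℤ) (x : K), IsIntegral ℤ x → (a : K) + b * α + c * β + d * (α * β) = x →
      ((a ^ 2 + m * b ^ 2 - D * (c ^ 2 + m * d ^ 2)) ^ 2 - m * (2 * (a * b - D * (c * d))) ^ 2 : ℚ) = U →
      ∃ u : 𝓞 k, Nm σ τ ((u : k) : K) = U := by
    intro a b c d U x hi hx hU
    rw [← hx] at hi
    obtain ⟨u, hu⟩ := liftk (h.mems a b c d) hi
    refine ⟨u, ?_⟩
    rw [hu, (Nm_form h a b c d).1, hU]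
    simp
  have h123 : m % 4 = 1 ∨ m % 4 = 2 ∨ m % 4 = 3 := by omega
  rcases h123 with h1 | h2 | h3
  · obtain ⟨u, hu⟩ := mk (1 / 2) (-1 / 2) (-1 / 2) (-1 / 2) ((t * (1 + m)) ^ 2 - m * (1 + 2 * t) ^ 2) _ (by
      have := isIntegral_one.sub ((half α m hα h1).mul ((isIntegral_one (R := ℤ) (B := K)).add iβ))
      exact this) (by push_cast; ring) (by rw [ht]; push_cast; ring)
    refine ⟨u, _, hu, ?_⟩
    obtain ⟨r, hr⟩ : ∃ r, m = 1 + 4 * r := ⟨m / 4, by omega⟩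
    have : (t * (1 + m)) ^ 2 - m * (1 + 2 * t) ^ 2 = 4 * ((t * (1 + 2 * r)) ^ 2 - (t + t ^ 2) - r * (1 + 2 * t) ^ 2) - 1 := by rw [hr]; ring
    rw [this]
    omega
  · obtain ⟨u, hu⟩ := mk 1 (1 / 2) 0 (1 / 2) ((1 - m * t) ^ 2 - m) _ (by
      have := (isIntegral_one (R := ℤ) (B := K)).add (iα.mul (half β D hβ hD))
      exact this) (by push_cast; ring) (by rw [ht]; push_cast; ring)
    refine ⟨u, _, hu, ?_⟩
    obtain ⟨r, hr⟩ : ∃ r, m = 2 + 4 * r := ⟨m / 4, by omega⟩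
    have : (1 - m * t) ^ 2 - m = 4 * (((1 + 2 * r) * t) ^ 2 - (1 + 2 * r) * t - r) - 1 := by rw [hr]; ring
    rw [this]
    omega
  · obtain ⟨u, hu⟩ := mk 1 1 0 1 ((1 - 4 * (m * t)) ^ 2 - 4 * m) _ (by
      have := ((isIntegral_one (R := ℤ) (B := K)).add iα).add (iα.mul iβ)
      exact this) (by push_cast; ring) (by rw [ht]; push_cast; ring)
    refine ⟨u, _, hu, ?_⟩
    have : (1 - 4 * (m * t)) ^ 2 - 4 * m = 8 * (2 * (m * t) ^ 2 - m * t) + 1 - 4 * m := by ring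
    rw [this]
    omega

end norm
end S18

open Module NumberField IsDedekindDomain

namespace S18
set_option linter.unusedSectionVars false

section norm
variable {K : Type*} [Field K] [NumberField K] [IsGalois ℚ K]

theorem RN [IsTotallyComplex K] (hodd : Odd (Nat.card (ClassGroup (𝓞 K)))) (hn : finrank ℚ K = 2 ^ 4)
    {α β : K} {m D : ℤ} (hα : α ^ 2 = m) (hβ : β ^ 2 = D) (hm : ¬ IsSquare (m : ℚ)) (hD : ¬ IsSquare (D : ℚ))
    (hmD : ¬ IsSquare ((m * D : ℤ) : ℚ)) (hm0 : 0 < m) (hD0 : 0 < D) (hm4 : m % 4 ≠ 0) (hD4 : D % 4 = 1)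
    {q : ℕ} (hq : q.Prime) (hq2 : q ≠ 2) (hqmD : ¬ (q : ℤ) ∣ m * D) (hqπ : ∃ π : K, π ^ 2 = q ∨ π ^ 2 = -q)
    {l : ℕ} (hl : l.Prime) (hl4 : l % 4 = 3) (hlm : (∃ m', m = l * m' ∧ ¬ (l : ℤ) ∣ m') ∨ (∃ D', D = l * D' ∧ ¬ (l : ℤ) ∣ D')) :
    False := by
  obtain ⟨k, S, I, hk, hS, hc1, hc2, -, hI, hplain, hN, -⟩ := bq_count hodd hn hα hβ hm hD hmD {q} (by
    intro p hp
    rw [Finset.mem_singleton] at hp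
    subst hp
    exact ⟨hq, hq2, hqmD, hqπ⟩)
  have hI4 := hI hm0 hD0
  rw [Finset.card_singleton] at hc1 hc2
  by_cases hr : (∃ ρ : ℤ, (q : ℤ) ∣ m - ρ ^ 2) ∧ (∃ ρ : ℤ, (q : ℤ) ∣ D - ρ ^ 2)
  · have := hc2 q (Finset.mem_singleton_self q) hr.1 hr.2
    omega
  · obtain ⟨σ, τ, s1, s2, t1, t2⟩ := exists_auts hα hβ hm hD hmD
    have hbq : BQ k α β m D σ τ := ⟨hk, hα, hβ, s1, s2, t1, t2⟩
    obtain ⟨u, U, hU, hU2, hU3⟩ := exists_u hbq hD4 hm4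
    have := hN u (u_coprime hU hU2) (by
      intro δ c hδ hd
      obtain ⟨M, A1, B1, A2, B2, hM, f1, f2⟩ := Nm_rat hbq (δ : k).2 (isInt_coe_k (K := K) δ)
      have hcop : ∀ p : ℕ, p.Prime → (p : ℤ) ∣ M → p = q := by
        intro p hp hpM
        by_contra hne
        exact Nm_coprime (by simpa using hq) hS hδ hM hp (by simpa using hne) hpM
      have hM2 : M % 2 = 1 := by
        by_contra h
        exact hq2 (hcop 2 Nat.prime_two (by push_cast; omega)).symm
      obtain ⟨c', hc'⟩ := is_sq hq (by omega) hcop f1 f2 (by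
        by_contra hh
        push Not at hh
        exact hr hh) hl hl4 hlm
      have hc'2 : c' % 2 = 1 := by
        by_contra h
        have : (2 : ℤ) ∣ c' ^ 2 := Dvd.dvd.pow (by omega) two_ne_zero
        omega
      have h8 := odd_sq_mod8 hc'2
      rw [← hc'] at h8
      rcases hU3 with ⟨h3, -⟩ | ⟨h3, h5⟩
      · have := delta4 hbq hM hU hM2 hd
        omega
      · have := delta8 hbq h3 hM hU hM2 hd
        omega)
    omega

theorem ImN [IsTotallyComplex K] (hodd : Odd (Nat.card (ClassGroup (𝓞 K)))) (hn : finrank ℚ K = 2 ^ 4)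
    {α β : K} {m D : ℤ} (hα : α ^ 2 = m) (hβ : β ^ 2 = D) (hm : ¬ IsSquare (m : ℚ)) (hD : ¬ IsSquare (D : ℚ))
    (hmD : ¬ IsSquare ((m * D : ℤ) : ℚ)) (hm0 : m < 0) (hm4 : m % 4 = 2) (hD4 : D % 4 = 1)
    {T : Finset ℕ} (hT2 : T.card = 2) (hT : ∀ p ∈ T, p.Prime ∧ p ≠ 2 ∧ ¬ (p : ℤ) ∣ m * D ∧
      ∃ π : K, π ^ 2 = p ∨ π ^ 2 = -p) (hT4 : ∀ p ∈ T, p % 4 = 1) :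
    False := by
  obtain ⟨k, S, I, hk, hS, hc1, hc2, hI2, -, -, hN, -⟩ := bq_count hodd hn hα hβ hm hD hmD T hT
  obtain ⟨σ, τ, s1, s2, t1, t2⟩ := exists_auts hα hβ hm hD hmD
  have hbq : BQ k α β m D σ τ := ⟨hk, hα, hβ, s1, s2, t1, t2⟩
  obtain ⟨u, U, hU, hU2, hU3⟩ := exists_u hbq hD4 (by omega)
  have := hN u (u_coprime hU hU2) (by
      intro δ c hδ hd
      obtain ⟨M, A1, B1, A2, B2, hM, f1, f2⟩ := Nm_rat hbq (δ : k).2 (isInt_coe_k (K := K) δ)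
      have hcop : ∀ p : ℕ, p.Prime → (p : ℤ) ∣ M → p ∈ T := by
        intro p hp hpM
        by_contra hne
        exact Nm_coprime (fun p hp => (hT p hp).1) hS hδ hM hp hne hpM
      have hM2 : M % 2 = 1 := by
        by_contra h
        exact (hT 2 (hcop 2 Nat.prime_two (by push_cast; omega))).2.1 rfl
      have hM0 : 0 ≤ M := by
        have : (0 : ℚ) ≤ M := by
          rw [f1]
          have : (m : ℚ) < 0 := by exact_mod_cast hm0
          nlinarith [sq_nonneg A1, sq_nonneg B1]
        exact_mod_cast this
      lift M to ℕ using hM0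
      have h1 := one_mod4 M (fun p hp hd => hT4 p (hcop p hp (by exact_mod_cast hd))) (by omega)
      have := delta4 hbq hM hU hM2 hd
      omega)
  omega

end norm
end S18

open Module NumberField IsDedekindDomain

namespace S18
set_option linter.unusedSectionVars false

section qgain
variable {K : Type*} [Field K] [NumberField K] [IsGalois ℚ K]

lemma half_int {y : K} {d : ℤ} (hy : y ^ 2 = d) (hd : d % 4 = 1) : IsIntegral ℤ ((1 + y) / 2) := by
  obtain ⟨r, hr⟩ : ∃ r, d = 1 + 4 * r := ⟨d / 4, by omega⟩
  refine quad_int (a := 1) (b := (r : K)) isIntegral_one (isInt_int r) ?_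
  have : y ^ 2 = 1 + 4 * (r : K) := by rw [hy, hr]; push_cast; ring
  linear_combination this / 4

lemma dv_sq_add {x : K} (g : K ≃ₐ[ℚ] K) (hx : IsIntegral ℤ x) (h : Dv 2 (x ^ 2)) : Dv 2 ((x + g x) ^ 2) := by
  have e : (x + g x) ^ 2 = x ^ 2 + g (x ^ 2) + (2 : ℤ) * (x * g x) := by rw [map_pow]; push_cast; ring
  rw [e]
  exact (h.add (h.map g)).add ⟨_, hx.mul (isInt_map hx g), rfl⟩

lemma dv_odd {d : ℤ} (hd : d % 2 = 1) {x : K} (hx : IsIntegral ℤ x) (h : Dv 2 ((d : K) * x)) : Dv 2 x := by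
  have e : x = (d : K) * x - (2 : ℤ) * (((d / 2 : ℤ) : K) * x) := by
    have : (d : K) = 2 * ((d / 2 : ℤ) : K) + 1 := by
      have : d = 2 * (d / 2) + 1 := by omega
      exact_mod_cast congrArg (Int.cast : ℤ → K) this
    rw [this]; push_cast; ring
  rw [e]
  exact h.sub ⟨_, (isInt_int _).mul hx, rfl⟩

lemma rad_step {x y : K} {d : ℤ} (g : K ≃ₐ[ℚ] K) (hy : y ^ 2 = d) (hd : d % 4 = 1) (hg : g y = -y) (hx : IsIntegral ℤ x)
    (h0 : Dv 2 (x + g x)) (h1 : Dv 2 ((1 + y) / 2 * x + g ((1 + y) / 2 * x))) : Dv 2 x := by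
  have iy := isInt_sqrt hy
  have iω' : IsIntegral ℤ ((1 - y) / 2) := by
    have := isInt_map (half_int hy hd) g
    rwa [map_div₀, map_add, hg, map_one, map_ofNat, ← sub_eq_add_neg] at this
  have e : y * x = ((1 + y) / 2 * x + g ((1 + y) / 2 * x)) - (x + g x) * ((1 - y) / 2) := by
    rw [map_mul, map_div₀, map_add, hg, map_one, map_ofNat]; ring
  have h2 : Dv 2 (y * x) := by
    rw [e]; exact h1.sub (h0.mul iω')
  apply dv_odd (d := d) (by omega) hx
  rw [← hy]
  have := h2.mul iy
  have e2 : y ^ 2 * x = y * x * y := by ring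
  rwa [e2]

variable {k : IntermediateField ℚ K} {α β : K} {m D : ℤ} {σ τ : K ≃ₐ[ℚ] K}

lemma trq (p q : ℚ) (ht : τ α = -α) (hz : IsIntegral ℤ ((p : K) + q * α)) (h : Dv 2 (((p : K) + q * α) ^ 2)) :
    Dv 2 (((p : K) + q * α) + τ ((p : K) + q * α)) := by
  have h1 := dv_sq_add τ hz h
  have i1 := hz.add (isInt_map hz τ)
  have e : ((p : K) + q * α) + τ ((p : K) + q * α) = ((2 * p : ℚ) : K) := by
    simp [ht]; ring
  rw [e] at h1 i1 ⊢
  obtain ⟨t, ht⟩ := rat_int _ i1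
  rw [ht] at h1 ⊢
  have h2 : (2 : ℤ) ∣ t ^ 2 := by
    apply Dv.int (K := K)
    simpa using h1
  have h3 := Int.prime_two.dvd_of_dvd_pow h2
  simpa using Dv.of_int (K := K) h3

lemma radq (hα : α ^ 2 = m) (hm : m % 4 = 1) (ht : τ α = -α) (p q : ℚ)
    (hz : IsIntegral ℤ ((p : K) + q * α)) (h : Dv 2 (((p : K) + q * α) ^ 2)) : Dv 2 ((p : K) + q * α) := by
  refine rad_step τ hα hm ht hz (trq p q ht hz h) ?_
  have e : (1 + α) / 2 * ((p : K) + q * α) = (((p + q * m) / 2 : ℚ) : K) + ((p + q) / 2 : ℚ) * α := by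
    push_cast; rw [← hα]; ring
  have i : IsIntegral ℤ ((1 + α) / 2 * ((p : K) + q * α)) := (half_int hα hm).mul hz
  have h' : Dv 2 (((1 + α) / 2 * ((p : K) + q * α)) ^ 2) := by
    rw [mul_pow, mul_comm]; exact h.mul ((half_int hα hm).pow 2)
  rw [e] at i h' ⊢
  exact trq _ _ ht i h'

lemma BQ.add_conj (h : BQ k α β m D σ τ) {x : K} (hx : x ∈ k) : ∃ p q : ℚ, x + σ x = p + q * α := by
  obtain ⟨a, b, c, d, rfl⟩ := mem_bq h hx
  refine ⟨2 * a, 2 * b, ?_⟩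
  rw [(conj_bq h a b c d).1]; push_cast; ring

lemma BQ.mul_conj (h : BQ k α β m D σ τ) {x : K} (hx : x ∈ k) : ∃ p q : ℚ, x * σ x = p + q * α := by
  obtain ⟨a, b, c, d, rfl⟩ := mem_bq h hx
  refine ⟨a ^ 2 + m * b ^ 2 - D * (c ^ 2 + m * d ^ 2), 2 * (a * b - D * (c * d)), ?_⟩
  rw [(conj_bq h a b c d).1]; push_cast
  rw [← h.hα, ← h.hβ]; ring

lemma BQ.ω_mem (h : BQ k α β m D σ τ) : (1 + β) / 2 ∈ k := by
  have := h.mems (1 / 2) 0 (1 / 2) 0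
  push_cast at this
  convert this using 1; ring

lemma rad_bq (h : BQ k α β m D σ τ) (hm : m % 4 = 1) (hD : D % 4 = 1) {x : K} (hx : x ∈ k) (hi : IsIntegral ℤ x)
    (h2 : Dv 2 (x ^ 2)) : Dv 2 x := by
  have key : ∀ z : K, z ∈ k → IsIntegral ℤ z → Dv 2 (z ^ 2) → Dv 2 (z + σ z) := by
    intro z hz iz hz2
    have h3 := dv_sq_add σ iz hz2
    have i3 := iz.add (isInt_map iz σ)
    obtain ⟨p, q, hpq⟩ := h.add_conj hz
    rw [hpq] at h3 i3 ⊢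
    exact radq h.hα hm h.t1 p q i3 h3
  refine rad_step σ h.hβ hD h.s2 hi (key x hx hi h2) (key _ (k.mul_mem h.ω_mem hx) ((half_int h.hβ hD).mul hi) ?_)
  rw [mul_pow, mul_comm]; exact h2.mul ((half_int h.hβ hD).pow 2)

/-- first Q-gain lemma -/
lemma q1 (h : BQ k α β m D σ τ) (hm : m % 4 = 1) (hD : D % 4 = 1) (c : 𝓞 k) : ¬ (4 : 𝓞 k) ∣ c ^ 2 + 1 := by
  intro hd
  have ic := isInt_coe_k (K := K) c
  have h1 : Dv 4 (((c : k) : K) ^ 2 + 1) := by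
    have := (Dv_coe_k (K := K) (a := 4) (by norm_num) (x := c ^ 2 + 1)).2 (by exact_mod_cast hd)
    simpa using this
  have hck : ((c : k) : K) ∈ k := (c : k).2
  set x := ((c : k) : K)
  have h2 : Dv 2 (x - 1) := by
    apply rad_bq h hm hD (k.sub_mem hck k.one_mem) (ic.sub isIntegral_one)
    obtain ⟨y, hy, e⟩ := h1
    refine ⟨2 * y - x, ?_, ?_⟩
    · have i2 : IsIntegral ℤ (2 : K) := by exact_mod_cast isInt_int (K := K) 2
      exact (i2.mul hy).sub ic
    · push_cast at e ⊢; linear_combination e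
  have h4 : Dv 4 ((2 : ℤ) : K) := by
    obtain ⟨y, hy, e⟩ := h1
    obtain ⟨t, ht, e'⟩ := h2
    refine ⟨y - t - t ^ 2, (hy.sub ht).sub (ht.pow 2), ?_⟩
    push_cast at e e' ⊢
    have : x = 1 + 2 * t := by linear_combination e'
    rw [this] at e
    linear_combination e
  have := h4.int
  norm_num at this

lemma rat_two {r : ℚ} {t : ℤ} (h : 2 * r ^ 2 = t) : ∃ s : ℤ, r = s := by
  have hr : (r.num : ℚ) = r * r.den := (Rat.mul_den_eq_num r).symm
  have h1 : 2 * r.num ^ 2 = t * (r.den : ℤ) ^ 2 := by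
    have : ((2 * r.num ^ 2 : ℤ) : ℚ) = ((t * (r.den : ℤ) ^ 2 : ℤ) : ℚ) := by
      push_cast; rw [hr, ← h]; ring
    exact_mod_cast this
  have hcop : IsCoprime ((r.den : ℤ) ^ 2) (r.num ^ 2) := by
    apply IsCoprime.pow
    rw [Int.isCoprime_iff_nat_coprime]
    simpa using r.reduced.symm
  have h2 : ((r.den : ℤ) ^ 2) ∣ 2 := hcop.dvd_of_dvd_mul_right (Dvd.intro_left _ h1.symm)
  have h3 : r.den = 1 := by
    have h4 : (r.den : ℤ) ^ 2 ≤ 2 := Int.le_of_dvd (by norm_num) h2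
    have h5 : 0 < r.den := r.den_pos
    have : (r.den : ℤ) < 2 := by nlinarith
    omega
  exact ⟨r.num, by rw [hr, h3]; simp⟩

lemma intZ2 (hα : α ^ 2 = m) (hm : m = 2 ∨ m = -2) (ht : τ α = -α) {p q : ℚ}
    (hz : IsIntegral ℤ ((p : K) + q * α)) : ∃ x y : ℤ, p = x ∧ q = y := by
  have it := isInt_map hz τ
  have e2 : τ ((p : K) + q * α) = p - q * α := by simp [ht]; ring
  rw [e2] at it
  have i1 := hz.add it
  have i2 := hz.mul it
  have e3 : ((p : K) + q * α) + (p - q * α) = ((2 * p : ℚ) : K) := by push_cast; ring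
  have e4 : ((p : K) + q * α) * (p - q * α) = ((p ^ 2 - m * q ^ 2 : ℚ) : K) := by
    push_cast; rw [← hα]; ring
  rw [e3] at i1
  rw [e4] at i2
  obtain ⟨s, hs⟩ := rat_int _ i1
  obtain ⟨t, ht⟩ := rat_int _ i2
  have hr : ∃ r : ℤ, 2 * q = r := by
    rcases hm with rfl | rfl
    · apply rat_two (t := s ^ 2 - 4 * t)
      push_cast at ht ⊢; rw [← hs, ← ht]; ring
    · apply rat_two (t := -(s ^ 2 - 4 * t))
      push_cast at ht ⊢; rw [← hs, ← ht]; ring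
  obtain ⟨r, hr⟩ := hr
  have h1 : s ^ 2 = 4 * t + m * r ^ 2 := by
    have : (s : ℚ) ^ 2 = 4 * t + m * r ^ 2 := by rw [← hs, ← ht, ← hr]; ring
    exact_mod_cast this
  have hs2 : (2 : ℤ) ∣ s := by
    apply Int.prime_two.dvd_of_dvd_pow (n := 2)
    rw [h1]
    refine dvd_add (by omega) (Dvd.dvd.mul_right (by omega) _)
  obtain ⟨s', rfl⟩ := hs2
  have hr2 : (2 : ℤ) ∣ r := by
    apply Int.prime_two.dvd_of_dvd_pow (n := 2)
    rcases hm with rfl | rfl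
    · exact ⟨s' ^ 2 - t, by linarith⟩
    · exact ⟨-(s' ^ 2 - t), by linarith⟩
  obtain ⟨r', rfl⟩ := hr2
  refine ⟨s', r', ?_, ?_⟩
  · push_cast at hs; linarith
  · push_cast at hr; linarith

/-- reading off coefficients mod 4 -/
lemma z2_dv4 (hα : α ^ 2 = m) (hm : m = 2 ∨ m = -2) (ht : τ α = -α) {u v : ℤ}
    (h : Dv 4 ((u : K) + v * α)) : (4 : ℤ) ∣ u ∧ (4 : ℤ) ∣ v := by
  obtain ⟨y, hy, e⟩ := h
  have : y = ((u / 4 : ℚ) : K) + (v / 4 : ℚ) * α := by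
    push_cast at e ⊢; linear_combination -e / 4
  rw [this] at hy
  obtain ⟨a, b, ha, hb⟩ := intZ2 hα hm ht hy
  refine ⟨⟨a, ?_⟩, ⟨b, ?_⟩⟩
  · have : (u : ℚ) = 4 * a := by linarith
    exact_mod_cast this
  · have : (v : ℚ) = 4 * b := by linarith
    exact_mod_cast this

lemma z2_sq (hα : α ^ 2 = m) (hm : m = 2 ∨ m = -2) (ht : τ α = -α) {u v e : ℤ} (he : e % 2 = 1)
    (h : Dv 4 (((u : K) + v * α) ^ 2 + e)) : u % 2 = 1 ∧ v % 2 = 0 ∧ e % 4 = 3 := by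
  have e1 : ((u : K) + v * α) ^ 2 + e = ((u ^ 2 + m * v ^ 2 + e : ℤ) : K) + ((2 * u * v : ℤ) : K) * α := by
    push_cast; rw [← hα]; ring
  rw [e1] at h
  obtain ⟨h1, h2⟩ := z2_dv4 hα hm ht h
  have hu : u % 2 = 1 := by
    by_contra hu
    have : (2 : ℤ) ∣ u ^ 2 := Dvd.dvd.pow (by omega) two_ne_zero
    have : (2 : ℤ) ∣ m * v ^ 2 := Dvd.dvd.mul_right (by omega) _
    omega
  have hv : (2 : ℤ) ∣ v := by
    have : (2 : ℤ) ∣ u * v := by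
      rw [mul_assoc] at h2
      omega
    rcases Int.prime_two.dvd_or_dvd this with h | h
    · omega
    · exact h
  obtain ⟨w, rfl⟩ := hv
  have h8 := odd_sq_mod8 hu
  have : (4 : ℤ) ∣ m * (2 * w) ^ 2 := ⟨m * w ^ 2, by ring⟩
  omega

lemma q3 (hα : α ^ 2 = m) (hm : m = 2 ∨ m = -2) (ht : τ α = -α)
    (hk : k.toSubalgebra.toSubmodule = Submodule.span ℚ (Set.range ![1, α])) (c : 𝓞 k) : ¬ (4 : 𝓞 k) ∣ c ^ 2 + 1 := by
  intro hd
  have ic := isInt_coe_k (K := K) c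
  have h1 : Dv 4 (((c : k) : K) ^ 2 + 1) := by
    have := (Dv_coe_k (K := K) (a := 4) (by norm_num) (x := c ^ 2 + 1)).2 (by exact_mod_cast hd)
    simpa using this
  obtain ⟨f, hf⟩ := (mem_k_iff hk _).1 (c : k).2
  have e : ((c : k) : K) = (f 0 : K) + f 1 * α := by
    rw [← hf]; simp [Fin.sum_univ_two, Algebra.smul_def]
  rw [e] at ic h1
  obtain ⟨u, v, hu, hv⟩ := intZ2 hα hm ht ic
  rw [hu, hv] at h1
  have := z2_sq hα hm ht (u := u) (v := v) (e := 1) (by norm_num) (by simpa using h1)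
  omega

lemma q2 (h : BQ k α β m D σ τ) (hm : m = 2 ∨ m = -2) (hD : D % 4 = 1) (c : 𝓞 k) : ¬ (4 : 𝓞 k) ∣ c ^ 2 + 1 := by
  intro hd
  have ic := isInt_coe_k (K := K) c
  have h1 : Dv 4 (((c : k) : K) ^ 2 + 1) := by
    have := (Dv_coe_k (K := K) (a := 4) (by norm_num) (x := c ^ 2 + 1)).2 (by exact_mod_cast hd)
    simpa using this
  have hck : ((c : k) : K) ∈ k := (c : k).2
  set x := ((c : k) : K)
  have ix' := isInt_map ic σ
  have h1' : Dv 4 (σ x ^ 2 + 1) := by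
    have := h1.map σ
    simpa using this
  obtain ⟨y, hy, e⟩ := h1
  obtain ⟨y', hy', e'⟩ := h1'
  -- the norm is 1 mod 2
  obtain ⟨p, q, hpq⟩ := h.mul_conj hck
  have hnI := ic.mul ix'
  rw [hpq] at hnI
  obtain ⟨a, b, rfl, rfl⟩ := intZ2 h.hα hm h.t1 hnI
  have hn2 : Dv 4 (((a : K) + b * α) ^ 2 + ((-1 : ℤ) : K)) := by
    have : ((a : K) + b * α) = x * σ x := by rw [hpq]; simp
    rw [this]
    have i4 : IsIntegral ℤ (4 : K) := by exact_mod_cast isInt_int (K := K) 4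
    refine ⟨4 * (y * y') - y - y', ((i4.mul (hy.mul hy')).sub hy).sub hy', ?_⟩
    push_cast at e e' ⊢
    have e1 : x ^ 2 = 4 * y - 1 := by linear_combination e
    have e2 : σ x ^ 2 = 4 * y' - 1 := by linear_combination e'
    rw [mul_pow, e1, e2]; ring
  obtain ⟨ha, hb, -⟩ := z2_sq h.hα hm h.t1 (by norm_num) hn2
  obtain ⟨t, ht⟩ : ∃ t, D = 1 + 4 * t := ⟨D / 4, by omega⟩
  obtain ⟨a', ha'⟩ : ∃ a', a = 1 + 2 * a' := ⟨a / 2, by omega⟩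
  obtain ⟨b', hb'⟩ : ∃ b', b = 2 * b' := ⟨b / 2, by omega⟩
  have iω := half_int h.hβ hD
  have hωk := k.mul_mem h.ω_mem hck
  obtain ⟨p, q, hpq'⟩ := h.add_conj hωk
  have iωx := iω.mul ic
  have it := iωx.add (isInt_map iωx σ)
  rw [hpq'] at it
  obtain ⟨u, v, rfl, rfl⟩ := intZ2 h.hα hm h.t1 it
  have hfin : Dv 4 (((u : K) + v * α) ^ 2 + ((1 : ℤ) : K)) := by
    have e3 : ((u : K) + v * α) = (1 + β) / 2 * x + (1 - β) / 2 * σ x := by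
      have : σ ((1 + β) / 2 * x) = (1 - β) / 2 * σ x := by
        rw [map_mul, map_div₀, map_add, h.s2, map_one, map_ofNat, ← sub_eq_add_neg]
      rw [this] at hpq'
      rw [hpq']; simp
    have iω' : IsIntegral ℤ ((1 - β) / 2) := by
      have := isInt_map iω σ
      rwa [map_div₀, map_add, h.s2, map_one, map_ofNat, ← sub_eq_add_neg] at this
    rw [e3]
    refine ⟨((1 + β) / 2) ^ 2 * y + ((1 - β) / 2) ^ 2 * y' + ((-t : ℤ) : K) * (((1 + a' : ℤ) : K) + (b' : ℤ) * α),
      (((iω.pow 2).mul hy).add ((iω'.pow 2).mul hy')).add ((isInt_int _).mul ((isInt_int _).add ((isInt_int _).mul (isInt_sqrt h.hα)))), ?_⟩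
    have e1 : x ^ 2 = 4 * y - 1 := by push_cast at e; linear_combination e
    have e2 : σ x ^ 2 = 4 * y' - 1 := by push_cast at e'; linear_combination e'
    have e4 : x * σ x = 1 + 2 * (a' : K) + 2 * b' * α := by
      rw [hpq, ha', hb']; push_cast; ring
    have e5 : β ^ 2 = 1 + 4 * (t : K) := by rw [h.hβ, ht]; push_cast; ring
    push_cast
    linear_combination ((1 + β) / 2) ^ 2 * e1 + ((1 - β) / 2) ^ 2 * e2 + (1 - β ^ 2) / 2 * e4 + (-1 / 2 - (1 + 2 * (a' : K) + 2 * b' * α) / 2) * e5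
  have := z2_sq h.hα hm h.t1 (by norm_num) hfin
  omega

end qgain
end S18

open Module NumberField IsDedekindDomain

namespace S18
set_option linter.unusedSectionVars false

section struct
variable {K : Type*} [Field K] [NumberField K]

/-- `d` is a square in `K` -/
def Rt (K : Type*) [Field K] (d : ℤ) : Prop := ∃ y : K, y ^ 2 = (d : K)

lemma Rt.mul {a b : ℤ} (ha : Rt K a) (hb : Rt K b) : Rt K (a * b) := by
  obtain ⟨x, hx⟩ := ha
  obtain ⟨y, hy⟩ := hb
  exact ⟨x * y, by rw [mul_pow, hx, hy]; push_cast; ring⟩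

lemma Rt.div {a b : ℤ} (hab : Rt K (a * b)) (ha : Rt K a) (h0 : a ≠ 0) : Rt K b := by
  obtain ⟨x, hx⟩ := ha
  obtain ⟨y, hy⟩ := hab
  have h0' : (a : K) ≠ 0 := by exact_mod_cast h0
  exact ⟨y / x, by rw [div_pow, hx, hy]; push_cast; field_simp⟩

lemma Rt.one : Rt K 1 := ⟨1, by simp⟩

/-- `p* = ±p ≡ 1 mod 4` -/
def star (p : ℕ) : ℤ := if p % 4 = 1 then p else -p

lemma star_mod {p : ℕ} (hp : p % 2 = 1) : star p % 4 = 1 := by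
  unfold star
  split_ifs <;> omega

lemma star_abs (p : ℕ) : (star p).natAbs = p := by
  unfold star
  split_ifs <;> simp

theorem R1 [IsTotallyComplex K] (hodd : Odd (Nat.card (ClassGroup (𝓞 K)))) {p : ℕ} (hp : p.Prime) (hp2 : p ≠ 2) {d d' : ℤ}
    (hd : Rt K d) (hdd : d = p * d') (hd' : ¬ (p : ℤ) ∣ d') : Rt K (star p) := by
  have hodd2 : p % 2 = 1 := hp.eq_two_or_odd.resolve_left hp2
  obtain ⟨y, hy⟩ := hd
  obtain ⟨s, hs⟩ := toO (isInt_sqrt hy)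
  have hs2 : s ^ 2 = (d : 𝓞 K) := by
    apply RingOfIntegers.coe_injective
    rw [map_pow, hs, hy]; simp
  obtain ⟨a, b, hab⟩ := (Prime.coprime_iff_not_dvd (Nat.prime_iff_prime_int.1 hp)).2 hd'
  have hspan : Ideal.span {(p : 𝓞 K), s} ^ 2 = Ideal.span {((star p : ℤ) : 𝓞 K)} := by
    have h1 : Ideal.span {((star p : ℤ) : 𝓞 K)} = Ideal.span {(p : 𝓞 K)} := by
      unfold star
      split_ifs
      · simp
      · push_cast
        rw [Ideal.span_singleton_neg]
    rw [h1, sq, Ideal.span_pair_mul_span_pair]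
    have hss : s * s = p * (d' : 𝓞 K) := by rw [← sq, hs2, hdd]; push_cast; ring
    apply le_antisymm
    · rw [Ideal.span_le]
      intro x hx
      simp only [Set.mem_insert_iff, Set.mem_singleton_iff] at hx
      rw [SetLike.mem_coe, Ideal.mem_span_singleton]
      rcases hx with rfl | rfl | rfl | rfl
      · exact dvd_mul_right _ _
      · exact dvd_mul_right _ _
      · exact dvd_mul_left _ _
      · rw [hss]; exact dvd_mul_right _ _
    · rw [Ideal.span_singleton_le_iff_mem]
      have h3 : (p : 𝓞 K) = (a : 𝓞 K) * (p * p) + (b : 𝓞 K) * (s * s) := by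
        have := congrArg (Int.cast : ℤ → 𝓞 K) hab
        push_cast at this
        rw [hss]
        linear_combination -(p : 𝓞 K) * this
      have m1 : (p : 𝓞 K) * p ∈ Ideal.span {(p : 𝓞 K) * p, p * s, s * p, s * s} := Ideal.subset_span (by simp)
      have m2 : s * s ∈ Ideal.span {(p : 𝓞 K) * p, p * s, s * p, s * s} := Ideal.subset_span (by simp)
      have := Ideal.add_mem _ (Ideal.mul_mem_left _ (a : 𝓞 K) m1) (Ideal.mul_mem_left _ (b : 𝓞 K) m2)
      rwa [← h3] at this
  have hm := star_mod hodd2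
  obtain ⟨r, hr⟩ : ∃ r, star p = 1 + 4 * r := ⟨star p / 4, by omega⟩
  obtain ⟨z, hz⟩ := ml hodd ((star p : ℤ) : 𝓞 K) 1 _ hspan ⟨1, -2 * r, by rw [hr]; push_cast; ring⟩
    ⟨r, by rw [hr]; push_cast; ring⟩
  exact ⟨z, by rw [hz]; simp⟩

variable [IsGalois ℚ K]

/-- Kummer radical for a quadratic character -/
lemma kummer (χ : (K ≃ₐ[ℚ] K) → ℤ) (hχ : ∀ g, χ g = 1 ∨ χ g = -1) (hmul : ∀ g h, χ (g * h) = χ g * χ h) :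
    ∃ (D : ℤ) (y : K), Squarefree D ∧ y ≠ 0 ∧ y ^ 2 = D ∧ ∀ g : K ≃ₐ[ℚ] K, g y = χ g * y := by
  classical
  have hex : ∃ x : K, ∑ g : K ≃ₐ[ℚ] K, (χ g : K) * g x ≠ 0 := by
    by_contra hno
    push Not at hno
    have hli := (linearIndependent_monoidHom K K).comp (fun g : K ≃ₐ[ℚ] K => ((g : K →+* K) : K →* K)) (by
      intro g h hgh
      ext x
      exact DFunLike.congr_fun hgh x)
    have := Fintype.linearIndependent_iff.1 hli (fun g => (χ g : K)) (by
      ext x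
      simpa using hno x) 1
    rcases hχ 1 with h | h <;> rw [h] at this <;> simp at this
  obtain ⟨x, hx⟩ := hex
  set y := ∑ g : K ≃ₐ[ℚ] K, (χ g : K) * g x with hy
  have hsq : ∀ g, χ g * χ g = 1 := by
    intro g; rcases hχ g with h | h <;> rw [h] <;> norm_num
  have hgy : ∀ g : K ≃ₐ[ℚ] K, g y = χ g * y := by
    intro g
    rw [hy, map_sum, Finset.mul_sum]
    refine Fintype.sum_equiv (Equiv.mulLeft g) _ _ ?_
    intro h
    simp only [Equiv.coe_mulLeft, map_mul, map_intCast, AlgEquiv.mul_apply, hmul]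
    push_cast
    have : (χ g : K) * χ g = 1 := by exact_mod_cast hsq g
    linear_combination -(χ h : K) * g (h x) * this
  have hfix : ∀ g : K ≃ₐ[ℚ] K, g (y ^ 2) = y ^ 2 := by
    intro g
    rw [map_pow, hgy, mul_pow]
    have : (χ g : K) ^ 2 = 1 := by rw [sq]; exact_mod_cast hsq g
    rw [this, one_mul]
  obtain ⟨r, hr⟩ := IntermediateField.mem_bot.1 ((IsGalois.mem_bot_iff_fixed _).2 hfix)
  have hr0 : r ≠ 0 := by
    rintro rfl
    rw [map_zero] at hr
    exact hx (pow_eq_zero_iff (two_ne_zero)|>.1 hr.symm)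
  obtain ⟨a, b, hab, hsf⟩ := Nat.sq_mul_squarefree (r.num * r.den).natAbs
  have hnd : r.num * r.den ≠ 0 := mul_ne_zero (Rat.num_ne_zero.2 hr0) (by exact_mod_cast r.den_nz)
  have hb0 : b ≠ 0 := by
    rintro rfl
    apply hnd
    rw [← Int.natAbs_eq_zero, ← hab]; simp
  obtain ⟨D, hD, hDab⟩ : ∃ D : ℤ, Squarefree D ∧ r.num * r.den = b ^ 2 * D := by
    rcases Int.natAbs_eq (r.num * r.den) with h | h
    · exact ⟨a, Int.squarefree_natCast.2 hsf, by rw [h, ← hab]; push_cast; ring⟩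
    · exact ⟨-a, (fun x hx => Int.squarefree_natCast.2 hsf x (dvd_neg.1 hx)), by rw [h, ← hab]; push_cast; ring⟩
  have hbK : (b : K) ≠ 0 := by exact_mod_cast hb0
  have hden : (r.den : K) ≠ 0 := by exact_mod_cast r.den_nz
  refine ⟨D, y * r.den / b, hD, ?_, ?_, ?_⟩
  · exact div_ne_zero (mul_ne_zero hx hden) hbK
  · rw [div_pow, mul_pow, ← hr, div_eq_iff (pow_ne_zero _ hbK)]
    have h1 : (r.num : ℚ) = r * r.den := (Rat.mul_den_eq_num r).symm
    have h2 : r * (r.den : ℚ) ^ 2 = D * (b : ℚ) ^ 2 := by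
      have := congrArg (Int.cast : ℤ → ℚ) hDab
      push_cast at this
      rw [h1] at this
      linear_combination this
    have := congrArg (algebraMap ℚ K) h2
    simpa using this
  · intro g
    simp only [map_div₀, map_mul, map_natCast, hgy]
    ring

end struct
end S18

open Module NumberField IsDedekindDomain

namespace S18
set_option linter.unusedSectionVars false

section struct

lemma sqf_decomp {D : ℤ} (hD : Squarefree D) :
    ∃ e : ℤ, (e = 1 ∨ e = -1 ∨ e = 2 ∨ e = -2) ∧ D = e * ∏ p ∈ D.natAbs.primeFactors.erase 2, star p := by
  have hsf : Squarefree D.natAbs := Int.squarefree_natAbs.2 hD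
  have h1 := Nat.prod_primeFactors_of_squarefree hsf
  have h2 : (∏ p ∈ D.natAbs.primeFactors.erase 2, star p).natAbs = ∏ p ∈ D.natAbs.primeFactors.erase 2, p := by
    rw [← Int.natAbsHom_apply, map_prod]
    exact Finset.prod_congr rfl (fun p _ => star_abs p)
  set X := ∏ p ∈ D.natAbs.primeFactors.erase 2, star p
  by_cases hm : 2 ∈ D.natAbs.primeFactors
  · rw [← Finset.mul_prod_erase _ _ hm] at h1
    rw [← h2] at h1
    have : D = 2 * X ∨ D = -2 * X := by omega
    rcases this with h | h
    · exact ⟨2, by simp, h⟩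
    · exact ⟨-2, by simp, h⟩
  · rw [Finset.erase_eq_of_notMem hm] at h2
    rw [h1] at h2
    have : D = 1 * X ∨ D = -1 * X := by omega
    rcases this with h | h
    · exact ⟨1, by simp, h⟩
    · exact ⟨-1, by simp, h⟩

variable {K : Type*} [Field K] [NumberField K] [IsGalois ℚ K]

lemma Rt.prod {S : Finset ℕ} {f : ℕ → ℤ} (h : ∀ p ∈ S, Rt K (f p)) : Rt K (∏ p ∈ S, f p) := by
  classical
  induction S using Finset.induction_on with
  | empty => simpa using Rt.one
  | insert a s ha ih =>
    rw [Finset.prod_insert ha]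
    exact (h a (Finset.mem_insert_self _ _)).mul (ih (fun p hp => h p (Finset.mem_insert_of_mem hp)))

lemma star_ne {p : ℕ} (hp : p.Prime) : star p ≠ 0 := by
  intro h
  have := star_abs p
  rw [h] at this
  exact hp.ne_zero this.symm

open Classical in
theorem structure_thm [IsTotallyComplex K] (hodd : Odd (Nat.card (ClassGroup (𝓞 K)))) {n : ℕ}
    (ψ : (K ≃ₐ[ℚ] K) ≃* (Fin n → Multiplicative (ZMod 2))) :
    ∃ P : Finset ℕ, (∀ p ∈ P, p.Prime ∧ p ≠ 2 ∧ Rt K (star p)) ∧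
      2 ^ n ≤ 2 ^ P.card * (({1, -1, 2, -2} : Finset ℤ).filter (Rt K)).card := by
  -- characters
  let χ : Finset (Fin n) → (K ≃ₐ[ℚ] K) → ℤ := fun A g => ∏ i ∈ A, if ψ g i = 1 then 1 else -1
  have hz : ∀ x y : Multiplicative (ZMod 2), (if x * y = 1 then (1 : ℤ) else -1) = (if x = 1 then 1 else -1) * (if y = 1 then 1 else -1) := by
    decide
  have hχ1 : ∀ A g, χ A g = 1 ∨ χ A g = -1 := by
    intro A g
    have : χ A g * χ A g = 1 := by
      simp only [χ, ← Finset.prod_mul_distrib]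
      apply Finset.prod_eq_one
      intro i _
      split_ifs <;> norm_num
    exact mul_self_eq_one_iff.1 this
  have hχ2 : ∀ A g h, χ A (g * h) = χ A g * χ A h := by
    intro A g h
    simp only [χ, ← Finset.prod_mul_distrib, map_mul, Pi.mul_apply, hz]
  have hχ3 : ∀ A B, (∀ g, χ A g = χ B g) → A = B := by
    intro A B hAB
    ext i
    have h1 := hAB (ψ.symm (Pi.mulSingle i (Multiplicative.ofAdd 1)))
    have h2 : ∀ A : Finset (Fin n), χ A (ψ.symm (Pi.mulSingle i (Multiplicative.ofAdd 1))) = if i ∈ A then -1 else 1 := by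
      intro A
      simp only [χ, MulEquiv.apply_symm_apply]
      have h3 : ∀ j, (if (Pi.mulSingle i (Multiplicative.ofAdd (1 : ZMod 2)) : Fin n → Multiplicative (ZMod 2)) j = 1 then (1 : ℤ) else -1) =
          if j = i then -1 else 1 := by
        intro j
        by_cases hj : j = i
        · subst hj
          rw [Pi.mulSingle_eq_same, if_pos rfl, if_neg (by decide)]
        · rw [Pi.mulSingle_eq_of_ne hj, if_pos rfl, if_neg hj]
      simp only [h3, Finset.prod_ite_eq']
    rw [h2, h2] at h1
    by_cases hA : i ∈ A <;> by_cases hB : i ∈ B <;> simp [hA, hB] at h1 ⊢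
  choose D y hsf hy0 hy2 hgy using fun A => kummer (χ A) (hχ1 A) (hχ2 A)
  have hDinj : ∀ A B, D A = D B → A = B := by
    intro A B hAB
    have h1 : y A ^ 2 = y B ^ 2 := by rw [hy2, hy2, hAB]
    apply hχ3
    intro g
    have h2 : (χ A g : K) * y A = χ B g * y A := by
      rcases sq_eq_sq_iff_eq_or_eq_neg.1 h1 with h | h
      · rw [← hgy A, h, ← hgy B]
      · rw [← hgy A, h, map_neg, hgy B]; ring
    exact_mod_cast mul_right_cancel₀ (hy0 A) h2
  let Q : Finset (Fin n) → Finset ℕ := fun A => (D A).natAbs.primeFactors.erase 2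
  let P : Finset ℕ := Finset.univ.biUnion Q
  have hP : ∀ p ∈ P, p.Prime ∧ p ≠ 2 ∧ Rt K (star p) := by
    intro p hp
    obtain ⟨A, -, hA⟩ := Finset.mem_biUnion.1 hp
    obtain ⟨h2, hpf⟩ := Finset.mem_erase.1 hA
    have hpp := Nat.prime_of_mem_primeFactors hpf
    refine ⟨hpp, h2, ?_⟩
    obtain ⟨d', hd'⟩ := Int.natCast_dvd.2 (Nat.dvd_of_mem_primeFactors hpf)
    refine R1 hodd hpp h2 ⟨y A, hy2 A⟩ hd' ?_
    rintro ⟨c, rfl⟩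
    have := hsf A p ⟨c, by rw [hd']; ring⟩
    exact (Nat.prime_iff_prime_int.1 hpp).not_unit this
  refine ⟨P, hP, ?_⟩
  choose e he hDe using fun A => sqf_decomp (hsf A)
  have hcard : (Finset.univ : Finset (Finset (Fin n))).card ≤ (P.powerset ×ˢ ({1, -1, 2, -2} : Finset ℤ).filter (Rt K)).card := by
    refine Finset.card_le_card_of_injOn (fun A => (Q A, e A)) ?_ ?_
    · intro A _
      simp only [Finset.coe_product, Set.mem_prod, Finset.mem_coe, Finset.mem_powerset, Finset.mem_filter]
      refine ⟨Finset.subset_biUnion_of_mem Q (Finset.mem_univ A), by simpa using he A, ?_⟩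
      have h1 : Rt K (∏ p ∈ Q A, star p) :=
        Rt.prod (fun p hp => (hP p (Finset.mem_biUnion.2 ⟨A, Finset.mem_univ A, hp⟩)).2.2)
      refine Rt.div (a := ∏ p ∈ Q A, star p) ?_ h1 ?_
      · rw [mul_comm, ← hDe]; exact ⟨y A, hy2 A⟩
      · refine Finset.prod_ne_zero_iff.2 (fun p hp => star_ne (hP p (Finset.mem_biUnion.2 ⟨A, Finset.mem_univ A, hp⟩)).1)
    · intro A _ B _ hAB
      simp only [Prod.mk.injEq] at hAB
      apply hDinj
      rw [hDe A, hDe B, hAB.2]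
      change _ * (∏ p ∈ Q A, star p) = _ * (∏ p ∈ Q B, star p)
      rw [hAB.1]
  rw [Finset.card_product, Finset.card_powerset, Finset.card_univ, Fintype.card_finset, Fintype.card_fin] at hcard
  exact hcard

lemma finrank_gal {n : ℕ} (ψ : (K ≃ₐ[ℚ] K) ≃* (Fin n → Multiplicative (ZMod 2))) : finrank ℚ K = 2 ^ n := by
  rw [← IsGalois.card_aut_eq_finrank, Nat.card_congr ψ.toEquiv, Nat.card_fun]
  simp [Nat.card_eq_fintype_card]

lemma tot_complex (him : ∃ φ : K →+* ℂ, ∃ x : K, (φ x).im ≠ 0) : IsTotallyComplex K := by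
  obtain ⟨φ, x, hx⟩ := him
  refine ⟨fun v => ?_⟩
  by_contra hv
  rw [InfinitePlace.not_isComplex_iff_isReal] at hv
  obtain ⟨g, hg⟩ := InfinitePlace.exists_smul_eq_of_comap_eq (k := ℚ) (K := K) (w := v) (w' := InfinitePlace.mk φ) (Subsingleton.elim _ _)
  have h1 : (InfinitePlace.mk φ).IsReal := by
    rw [← hg]; exact InfinitePlace.isReal_smul_iff.2 hv
  rw [InfinitePlace.isReal_mk_iff, ComplexEmbedding.isReal_iff] at h1
  apply hx
  have := congrArg (fun f : K →+* ℂ => f x) h1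
  simp only [ComplexEmbedding.conjugate_coe_eq] at this
  exact Complex.conj_eq_iff_im.1 this

end struct
end S18

open Module NumberField IsDedekindDomain

namespace S18
set_option linter.unusedSectionVars false

section dispatch

lemma ns_int {p : ℕ} (hp : p.Prime) {d d' : ℤ} (hd : d = p * d') (h : ¬ (p : ℤ) ∣ d') : ¬ IsSquare (d : ℚ) := by
  rw [Rat.isSquare_intCast_iff]
  rintro ⟨r, hr⟩
  have hp' := Nat.prime_iff_prime_int.1 hp
  have h1 : (p : ℤ) ∣ r := by
    have : (p : ℤ) ∣ r * r := by rw [← hr, hd]; exact dvd_mul_right _ _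
    rcases hp'.dvd_or_dvd this with h | h <;> exact h
  obtain ⟨c, rfl⟩ := h1
  apply h
  refine ⟨c * c, ?_⟩
  have hp0 : (p : ℤ) ≠ 0 := hp'.ne_zero
  apply mul_left_cancel₀ hp0
  rw [← hd, hr]; ring

lemma nd {p q : ℕ} (hp : p.Prime) (hq : q.Prime) (h : p ≠ q) : ¬ (p : ℤ) ∣ (q : ℤ) := by
  rw [Int.natCast_dvd_natCast]
  exact fun h' => h ((Nat.prime_dvd_prime_iff_eq hp hq).1 h')

lemma nd2 {p : ℕ} (hp : p.Prime) (h : p ≠ 2) : ¬ (p : ℤ) ∣ 2 := nd (q := 2) hp Nat.prime_two h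

lemma nd1 {p : ℕ} (hp : p.Prime) : ¬ (p : ℤ) ∣ 1 := (Nat.prime_iff_prime_int.1 hp).not_dvd_one

lemma ndm {p : ℕ} (hp : p.Prime) {a b : ℤ} (ha : ¬ (p : ℤ) ∣ a) (hb : ¬ (p : ℤ) ∣ b) : ¬ (p : ℤ) ∣ a * b :=
  (Nat.prime_iff_prime_int.1 hp).not_dvd_mul ha hb

variable {K : Type*} [Field K] [NumberField K] [IsGalois ℚ K]

lemma pi_of_star {p : ℕ} (h : Rt K (star p)) : ∃ π : K, π ^ 2 = p ∨ π ^ 2 = -p := by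
  obtain ⟨y, hy⟩ := h
  refine ⟨y, ?_⟩
  unfold star at hy
  split_ifs at hy
  · left; simpa using hy
  · right; simpa using hy

lemma star1 {p : ℕ} (h : Rt K (star p)) (h1 : p % 4 = 1) : Rt K (p : ℤ) := by
  rwa [star, if_pos h1] at h

lemma star3 {p : ℕ} (h : Rt K (star p)) (h1 : p % 4 = 3) : Rt K (-p : ℤ) := by
  rwa [star, if_neg (by omega)] at h

/-- data of a hypothetical counterexample -/
structure Ct (K : Type*) [Field K] [NumberField K] (n : ℕ) (P : Finset ℕ) : Prop where
  odd : Odd (Nat.card (ClassGroup (𝓞 K)))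
  fr : finrank ℚ K = 2 ^ n
  n4 : 4 ≤ n
  pr : ∀ p ∈ P, p.Prime
  p2 : ∀ p ∈ P, p ≠ 2
  rt : ∀ p ∈ P, Rt K (star p)

/-- admissible pair -/
structure Pr (K : Type*) [Field K] (P X : Finset ℕ) (m D : ℤ) : Prop where
  rm : Rt K m
  rD : Rt K D
  hm : ¬ IsSquare (m : ℚ)
  hD : ¬ IsSquare (D : ℚ)
  hmD : ¬ IsSquare ((m * D : ℤ) : ℚ)
  XP : X ⊆ P
  hX : ∀ p ∈ P, p ∉ X → ¬ (p : ℤ) ∣ m * D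

variable [IsTotallyComplex K] {n : ℕ} {P X : Finset ℕ} {m D : ℤ}

lemma Ct.hT (c : Ct K n P) (h : Pr K P X m D) : ∀ p ∈ P \ X, p.Prime ∧ p ≠ 2 ∧ ¬ (p : ℤ) ∣ m * D ∧
    ∃ π : K, π ^ 2 = p ∨ π ^ 2 = -p := by
  intro p hp
  obtain ⟨h1, h2⟩ := Finset.mem_sdiff.1 hp
  exact ⟨c.pr p h1, c.p2 p h1, h.hX p h1 h2, pi_of_star (c.rt p h1)⟩

lemma Ct.cnt (c : Ct K n P) (h : Pr K P X m D) (hm0 : 0 < m) (hD0 : 0 < D) : 2 * P.card + 2 ≤ n + 2 * X.card := by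
  obtain ⟨α, hα⟩ := h.rm
  obtain ⟨β, hβ⟩ := h.rD
  obtain ⟨k, S, I, hk, hS, hc1, hc2, -, hI, hplain, -, -⟩ := bq_count c.odd c.fr hα hβ h.hm h.hD h.hmD (P \ X) (c.hT h)
  have := Finset.card_sdiff_add_card_eq_card h.XP
  have := hI hm0 hD0
  omega

lemma Ct.cntQ (c : Ct K n P) (h : Pr K P X m D) (hm0 : 0 < m) (hD0 : 0 < D) (hi : Rt K (-1))
    (hm4 : m % 4 = 1 ∨ m = 2) (hD4 : D % 4 = 1) : 2 * P.card + 3 ≤ n + 2 * X.card := by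
  obtain ⟨α, hα⟩ := h.rm
  obtain ⟨β, hβ⟩ := h.rD
  obtain ⟨k, S, I, hk, hS, hc1, hc2, -, hI, hplain, -, hQ⟩ := bq_count c.odd c.fr hα hβ h.hm h.hD h.hmD (P \ X) (c.hT h)
  obtain ⟨σ, τ, s1, s2, t1, t2⟩ := exists_auts hα hβ h.hm h.hD h.hmD
  have hbq : BQ k α β m D σ τ := ⟨hk, hα, hβ, s1, s2, t1, t2⟩
  have := Finset.card_sdiff_add_card_eq_card h.XP
  have := hI hm0 hD0
  obtain ⟨y, hy⟩ := hi
  have := hQ ⟨y, by simpa using hy⟩ (by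
    intro x
    rcases hm4 with h | h
    · exact q1 hbq h hD4 x
    · exact q2 hbq (Or.inl h) hD4 x)
  omega

lemma Ct.rn (c : Ct K n P) (h : Pr K P X m D) (hm0 : 0 < m) (hD0 : 0 < D) (hm4 : m % 4 ≠ 0) (hD4 : D % 4 = 1)
    (hcard : n + X.card ≤ P.card + 3) {l : ℕ} (hl : l.Prime) (hl4 : l % 4 = 3)
    (hlm : (∃ m', m = l * m' ∧ ¬ (l : ℤ) ∣ m') ∨ (∃ D', D = l * D' ∧ ¬ (l : ℤ) ∣ D')) : False := by
  have h1 := c.cnt h hm0 hD0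
  have h2 := Finset.card_sdiff_add_card_eq_card h.XP
  have h4 := c.n4
  have hn : n = 4 := by omega
  obtain ⟨q, hq⟩ : (P \ X).Nonempty := Finset.card_pos.1 (by omega)
  obtain ⟨α, hα⟩ := h.rm
  obtain ⟨β, hβ⟩ := h.rD
  obtain ⟨a1, a2, a3, a4⟩ := c.hT h q hq
  exact RN c.odd (hn ▸ c.fr) hα hβ h.hm h.hD h.hmD hm0 hD0 hm4 hD4 a1 a2 a3 a4 hl hl4 hlm

/-- distinct primes `p`, `q` -/
lemma Ct.pair (c : Ct K n P) {p q : ℕ} (hp : p ∈ P) (hq : q ∈ P) (hpq : p ≠ q) (h1 : Rt K (p : ℤ)) (h2 : Rt K (q : ℤ)) :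
    Pr K P {p, q} p q where
  rm := h1
  rD := h2
  hm := ns_int (c.pr p hp) (d' := 1) (by simp) (nd1 (c.pr p hp))
  hD := ns_int (c.pr q hq) (d' := 1) (by simp) (nd1 (c.pr q hq))
  hmD := ns_int (c.pr p hp) rfl (nd (c.pr p hp) (c.pr q hq) hpq)
  XP := by intro x hx; simp only [Finset.mem_insert, Finset.mem_singleton] at hx; rcases hx with rfl | rfl <;> assumption
  hX := by
    intro x hx hx'
    simp only [Finset.mem_insert, Finset.mem_singleton, not_or] at hx'
    exact ndm (c.pr x hx) (nd (c.pr x hx) (c.pr p hp) hx'.1) (nd (c.pr x hx) (c.pr q hq) hx'.2)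

lemma Ct.caseA (c : Ct K n P) (hc : n ≤ P.card) (hmod : ∀ p ∈ P, p % 4 = 1 ∨ p % 4 = 3)
    (hAB : 1 < (P.filter (fun p => p % 4 = 1)).card ∨ 2 < (P.filter (fun p => p % 4 = 3)).card) : False := by
  have h4 := c.n4
  rcases hAB with h | h
  · obtain ⟨p, hp, q, hq, hpq⟩ := Finset.one_lt_card.1 h
    rw [Finset.mem_filter] at hp hq
    have := c.cnt (c.pair hp.1 hq.1 hpq (star1 (c.rt p hp.1) hp.2) (star1 (c.rt q hq.1) hq.2))
      (by have := (c.pr p hp.1).pos; omega) (by have := (c.pr q hq.1).pos; omega)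
    rw [Finset.card_pair hpq] at this
    omega
  · obtain ⟨p, hp, q, hq, r, hr, hpq, hpr, hqr⟩ := Finset.two_lt_card.1 h
    rw [Finset.mem_filter] at hp hq hr
    have pp := c.pr p hp.1
    have pq := c.pr q hq.1
    have pr := c.pr r hr.1
    have h1 := star3 (c.rt p hp.1) hp.2
    have h2 := star3 (c.rt q hq.1) hq.2
    have h3 := star3 (c.rt r hr.1) hr.2
    have hpair : Pr K P {p, q, r} (p * q) (p * r) :=
      { rm := by simpa using h1.mul h2
        rD := by simpa using h1.mul h3
        hm := ns_int pp rfl (nd pp pq hpq)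
        hD := ns_int pp rfl (nd pp pr hpr)
        hmD := ns_int pq (d' := p * p * r) (by ring) (ndm pq (ndm pq (nd pq pp hpq.symm) (nd pq pp hpq.symm)) (nd pq pr hqr))
        XP := by
          intro x hx
          simp only [Finset.mem_insert, Finset.mem_singleton] at hx
          rcases hx with rfl | rfl | rfl
          exacts [hp.1, hq.1, hr.1]
        hX := by
          intro x hx hx'
          simp only [Finset.mem_insert, Finset.mem_singleton, not_or] at hx'
          have px := c.pr x hx
          exact ndm px (ndm px (nd px pp hx'.1) (nd px pq hx'.2.1)) (ndm px (nd px pp hx'.1) (nd px pr hx'.2.2)) }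
    have hp0 : 0 < (p : ℤ) := by exact_mod_cast pp.pos
    have hq0 : 0 < (q : ℤ) := by exact_mod_cast pq.pos
    have hr0 : 0 < (r : ℤ) := by exact_mod_cast pr.pos
    have e1 : ((p : ℤ) * q) % 4 = 1 := by
      rw [Int.mul_emod, show (p : ℤ) % 4 = 3 by omega, show (q : ℤ) % 4 = 3 by omega]; rfl
    have e2 : ((p : ℤ) * r) % 4 = 1 := by
      rw [Int.mul_emod, show (p : ℤ) % 4 = 3 by omega, show (r : ℤ) % 4 = 3 by omega]; rfl
    refine c.rn hpair (by positivity) (by positivity) (by omega) e2 ?_ pq hq.2 (Or.inl ⟨p, by ring, nd pq pp hpq.symm⟩)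
    have := Finset.card_le_three (a := p) (b := q) (c := r)
    omega

/-- pair `2, q` -/
lemma Ct.pair2 (c : Ct K n P) {q : ℕ} (hq : q ∈ P) (h1 : Rt K (2 : ℤ)) (h2 : Rt K (q : ℤ)) :
    Pr K P {q} 2 q where
  rm := h1
  rD := h2
  hm := ns_int Nat.prime_two (d' := 1) (by simp) (nd1 Nat.prime_two)
  hD := ns_int (c.pr q hq) (d' := 1) (by simp) (nd1 (c.pr q hq))
  hmD := ns_int (c.pr q hq) (mul_comm _ _) (nd2 (c.pr q hq) (c.p2 q hq))
  XP := by simpa using hq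
  hX := by
    intro x hx hx'
    simp only [Finset.mem_singleton] at hx'
    exact ndm (c.pr x hx) (nd2 (c.pr x hx) (c.p2 x hx)) (nd (c.pr x hx) (c.pr q hq) hx')

lemma Ct.caseB (c : Ct K n P) (hc : n ≤ P.card + 1) (hmod : ∀ p ∈ P, p % 4 = 1 ∨ p % 4 = 3)
    (h2 : Rt K 2) : False := by
  have h4 := c.n4
  by_cases h : ∃ p ∈ P, p % 4 = 1
  · obtain ⟨p, hp, h1⟩ := h
    have := c.cnt (c.pair2 hp h2 (star1 (c.rt p hp) h1)) (by norm_num) (by exact_mod_cast (c.pr p hp).pos)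
    rw [Finset.card_singleton] at this
    omega
  · push Not at h
    have h3 : ∀ p ∈ P, p % 4 = 3 := fun p hp => (hmod p hp).resolve_left (h p hp)
    obtain ⟨p, hp, q, hq, hpq⟩ := Finset.one_lt_card.1 (show 1 < P.card by omega)
    have pp := c.pr p hp
    have pq := c.pr q hq
    have hpair : Pr K P {p, q} 2 (p * q) :=
      { rm := h2
        rD := by simpa using (star3 (c.rt p hp) (h3 p hp)).mul (star3 (c.rt q hq) (h3 q hq))
        hm := ns_int Nat.prime_two (d' := 1) (by simp) (nd1 Nat.prime_two)
        hD := ns_int pp rfl (nd pp pq hpq)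
        hmD := ns_int pp (d' := 2 * q) (by ring) (ndm pp (nd2 pp (c.p2 p hp)) (nd pp pq hpq))
        XP := by
          intro x hx
          simp only [Finset.mem_insert, Finset.mem_singleton] at hx
          rcases hx with rfl | rfl <;> assumption
        hX := by
          intro x hx hx'
          simp only [Finset.mem_insert, Finset.mem_singleton, not_or] at hx'
          have px := c.pr x hx
          exact ndm px (nd2 px (c.p2 x hx)) (ndm px (nd px pp hx'.1) (nd px pq hx'.2)) }
    have hp0 : 0 < (p : ℤ) := by exact_mod_cast pp.pos
    have hq0 : 0 < (q : ℤ) := by exact_mod_cast pq.pos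
    have := h3 p hp
    have := h3 q hq
    have e1 : ((p : ℤ) * q) % 4 = 1 := by
      rw [Int.mul_emod, show (p : ℤ) % 4 = 3 by omega, show (q : ℤ) % 4 = 3 by omega]; rfl
    refine c.rn hpair (by norm_num) (by positivity) (by norm_num) e1 ?_ pp (h3 p hp) (Or.inr ⟨q, rfl, nd pp pq hpq⟩)
    rw [Finset.card_pair hpq]
    omega

lemma Ct.caseC (c : Ct K n P) (hc : n ≤ P.card + 1) (hmod : ∀ p ∈ P, p % 4 = 1 ∨ p % 4 = 3)
    (h2 : Rt K (-2)) : False := by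
  have h4 := c.n4
  by_cases h : ∃ p ∈ P, p % 4 = 3
  · obtain ⟨p, hp, h3⟩ := h
    have pp := c.pr p hp
    have hp0 : 0 < (p : ℤ) := by exact_mod_cast pp.pos
    have hrp := star3 (c.rt p hp) h3
    have hr2p : Rt K (2 * p : ℤ) := by simpa using h2.mul hrp
    have hsq : ¬ IsSquare ((2 * p : ℤ) : ℚ) := ns_int pp (mul_comm _ _) (nd2 pp (c.p2 p hp))
    obtain ⟨q, hq, hqp⟩ := Finset.exists_mem_ne (show 1 < P.card by omega) p
    have pq := c.pr q hq
    have hq0 : 0 < (q : ℤ) := by exact_mod_cast pq.pos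
    have XP : ({p, q} : Finset ℕ) ⊆ P := by
      intro x hx
      simp only [Finset.mem_insert, Finset.mem_singleton] at hx
      rcases hx with rfl | rfl <;> assumption
    have hcc : n + ({p, q} : Finset ℕ).card ≤ P.card + 3 := by
      rw [Finset.card_pair hqp.symm]; omega
    have hl : ∃ m', (2 * p : ℤ) = p * m' ∧ ¬ (p : ℤ) ∣ m' := ⟨2, mul_comm _ _, nd2 pp (c.p2 p hp)⟩
    rcases hmod q hq with hq1 | hq3
    · have hpair : Pr K P {p, q} (2 * p) q :=
        { rm := hr2p
          rD := star1 (c.rt q hq) hq1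
          hm := hsq
          hD := ns_int pq (d' := 1) (by simp) (nd1 pq)
          hmD := ns_int pq (mul_comm _ _) (ndm pq (nd2 pq (c.p2 q hq)) (nd pq pp hqp))
          XP := XP
          hX := by
            intro x hx hx'
            simp only [Finset.mem_insert, Finset.mem_singleton, not_or] at hx'
            have px := c.pr x hx
            exact ndm px (ndm px (nd2 px (c.p2 x hx)) (nd px pp hx'.1)) (nd px pq hx'.2) }
      exact c.rn hpair (by positivity) hq0 (by omega) (by omega) hcc pp h3 (Or.inl hl)
    · have hpair : Pr K P {p, q} (2 * p) (p * q) :=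
        { rm := hr2p
          rD := by simpa using hrp.mul (star3 (c.rt q hq) hq3)
          hm := hsq
          hD := ns_int pp rfl (nd pp pq hqp.symm)
          hmD := ns_int pq (d' := 2 * p * p) (by ring) (ndm pq (ndm pq (nd2 pq (c.p2 q hq)) (nd pq pp hqp)) (nd pq pp hqp))
          XP := XP
          hX := by
            intro x hx hx'
            simp only [Finset.mem_insert, Finset.mem_singleton, not_or] at hx'
            have px := c.pr x hx
            exact ndm px (ndm px (nd2 px (c.p2 x hx)) (nd px pp hx'.1)) (ndm px (nd px pp hx'.1) (nd px pq hx'.2)) }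
      have e1 : ((p : ℤ) * q) % 4 = 1 := by
        rw [Int.mul_emod, show (p : ℤ) % 4 = 3 by omega, show (q : ℤ) % 4 = 3 by omega]; rfl
      exact c.rn hpair (by positivity) (by positivity) (by omega) e1 hcc pp h3 (Or.inl hl)
  · push Not at h
    have h1 : ∀ p ∈ P, p % 4 = 1 := fun p hp => (hmod p hp).resolve_right (h p hp)
    obtain ⟨p, hp, q, hq, hpq⟩ := Finset.one_lt_card.1 (show 1 < P.card by omega)
    have pp := c.pr p hp
    have hcnt := c.cnt (c.pair hp hq hpq (star1 (c.rt p hp) (h1 p hp)) (star1 (c.rt q hq) (h1 q hq)))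
      (by exact_mod_cast pp.pos) (by exact_mod_cast (c.pr q hq).pos)
    rw [Finset.card_pair hpq] at hcnt
    have hn : n = 4 := by omega
    have hpair : Pr K P {p} (-2) p :=
      { rm := h2
        rD := star1 (c.rt p hp) (h1 p hp)
        hm := ns_int Nat.prime_two (d' := -1) (by simp) (by norm_num)
        hD := ns_int pp (d' := 1) (by simp) (nd1 pp)
        hmD := ns_int pp (mul_comm _ _) (by rw [dvd_neg]; exact nd2 pp (c.p2 p hp))
        XP := by simpa using hp
        hX := by
          intro x hx hx'
          simp only [Finset.mem_singleton] at hx'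
          have px := c.pr x hx
          exact ndm px (by rw [dvd_neg]; exact nd2 px (c.p2 x hx)) (nd px pp hx') }
    have hcard := Finset.card_sdiff_add_card_eq_card hpair.XP
    rw [Finset.card_singleton] at hcard
    obtain ⟨α, hα⟩ := hpair.rm
    obtain ⟨β, hβ⟩ := hpair.rD
    have := h1 p hp
    exact ImN c.odd (hn ▸ c.fr) hα hβ hpair.hm hpair.hD hpair.hmD (by norm_num) (by norm_num) (by omega)
      (T := P \ {p}) (by omega) (c.hT hpair) (fun x hx => h1 x (Finset.mem_sdiff.1 hx).1)

lemma Ct.rtp (c : Ct K n P) (hi : Rt K (-1)) (hmod : ∀ p ∈ P, p % 4 = 1 ∨ p % 4 = 3) : ∀ p ∈ P, Rt K (p : ℤ) := by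
  intro p hp
  rcases hmod p hp with h | h
  · exact star1 (c.rt p hp) h
  · simpa using hi.mul (star3 (c.rt p hp) h)

lemma Ct.caseD (c : Ct K n P) (hc : n ≤ P.card + 1) (hmod : ∀ p ∈ P, p % 4 = 1 ∨ p % 4 = 3)
    (hi : Rt K (-1))
    (hAB : 1 < (P.filter (fun p => p % 4 = 1)).card ∨ 1 < (P.filter (fun p => p % 4 = 3)).card) : False := by
  have h4 := c.n4
  have hr := c.rtp hi hmod
  rcases hAB with h | h
  · obtain ⟨p, hp, q, hq, hpq⟩ := Finset.one_lt_card.1 h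
    rw [Finset.mem_filter] at hp hq
    have := c.cntQ (c.pair hp.1 hq.1 hpq (hr p hp.1) (hr q hq.1))
      (by exact_mod_cast (c.pr p hp.1).pos) (by exact_mod_cast (c.pr q hq.1).pos) hi (Or.inl (by omega)) (by omega)
    rw [Finset.card_pair hpq] at this
    omega
  · obtain ⟨p, hp, q, hq, hpq⟩ := Finset.one_lt_card.1 h
    rw [Finset.mem_filter] at hp hq
    have pp := c.pr p hp.1
    have pq := c.pr q hq.1
    have hpair : Pr K P {p, q} p (p * q) :=
      { rm := hr p hp.1
        rD := (hr p hp.1).mul (hr q hq.1)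
        hm := ns_int pp (d' := 1) (by simp) (nd1 pp)
        hD := ns_int pp rfl (nd pp pq hpq)
        hmD := ns_int pq (d' := p * p) (by ring) (ndm pq (nd pq pp hpq.symm) (nd pq pp hpq.symm))
        XP := by
          intro x hx
          simp only [Finset.mem_insert, Finset.mem_singleton] at hx
          rcases hx with rfl | rfl
          exacts [hp.1, hq.1]
        hX := by
          intro x hx hx'
          simp only [Finset.mem_insert, Finset.mem_singleton, not_or] at hx'
          have px := c.pr x hx
          exact ndm px (nd px pp hx'.1) (ndm px (nd px pp hx'.1) (nd px pq hx'.2)) }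
    have hp0 : 0 < (p : ℤ) := by exact_mod_cast pp.pos
    have hq0 : 0 < (q : ℤ) := by exact_mod_cast pq.pos
    have e1 : ((p : ℤ) * q) % 4 = 1 := by
      rw [Int.mul_emod, show (p : ℤ) % 4 = 3 by omega, show (q : ℤ) % 4 = 3 by omega]; rfl
    refine c.rn hpair hp0 (by positivity) (by omega) e1 ?_ pp hp.2 (Or.inl ⟨1, by simp, nd1 pp⟩)
    rw [Finset.card_pair hpq]
    omega

lemma res_of_isSquare {p : ℕ} {m : ℤ} (h : IsSquare (m : ZMod p)) : ∃ ρ : ℤ, (p : ℤ) ∣ m - ρ ^ 2 := by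
  obtain ⟨r, hr⟩ := h
  obtain ⟨ρ, rfl⟩ := ZMod.intCast_surjective r
  refine ⟨ρ, ?_⟩
  rw [← ZMod.intCast_zmod_eq_zero_iff_dvd]
  push_cast
  rw [hr]; ring

lemma Ct.caseE (c : Ct K n P) (hc : n ≤ P.card + 2) (hmod : ∀ p ∈ P, p % 4 = 1 ∨ p % 4 = 3)
    (hi : Rt K (-1)) (h2 : Rt K 2) (hm2 : Rt K (-2)) : False := by
  have h4 := c.n4
  have hr := c.rtp hi hmod
  have hi' : ∃ y : K, y ^ 2 = -1 := by
    obtain ⟨y, hy⟩ := hi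
    exact ⟨y, by simpa using hy⟩
  by_cases h : ∃ p ∈ P, p % 4 = 1
  · obtain ⟨p, hp, h1⟩ := h
    have := c.cntQ (c.pair2 hp h2 (hr p hp)) (by norm_num) (by exact_mod_cast (c.pr p hp).pos) hi (Or.inr rfl) (by omega)
    rw [Finset.card_singleton] at this
    omega
  · push Not at h
    have h3 : ∀ p ∈ P, p % 4 = 3 := fun p hp => (hmod p hp).resolve_left (h p hp)
    obtain ⟨p, hp⟩ : P.Nonempty := Finset.card_pos.1 (by omega)
    have hcnt := c.cnt (c.pair2 hp h2 (hr p hp)) (by norm_num) (by exact_mod_cast (c.pr p hp).pos)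
    rw [Finset.card_singleton] at hcnt
    have hs : P.card = 2 := by omega
    have hn : n = 4 := by omega
    have key : ∀ m : ℤ, (m = 2 ∨ m = -2) → ∀ f : ℕ → ℕ,
        (∀ p ∈ P, f p ≤ 1 ∨ (f p = 2 ∧ ∃ ρ : ℤ, (p : ℤ) ∣ m - ρ ^ 2)) →
        ∃ I : ℕ, 1 ≤ I ∧ (0 < m → I = 2) ∧ I + ∑ p ∈ P, f p + 2 ≤ 2 + n := by
      intro m hm f hf
      have hrt : Rt K m := by rcases hm with rfl | rfl <;> assumption
      obtain ⟨α, hα⟩ := hrt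
      have hns : ¬ IsSquare (m : ℚ) := by
        rcases hm with h | h
        · exact ns_int Nat.prime_two (d' := 1) (by simp [h]) (by norm_num)
        · exact ns_int Nat.prime_two (d' := -1) (by simp [h]) (by norm_num)
      obtain ⟨k, I, hk, hI1, hI2, hQ⟩ := q_count c.odd c.fr hα hns P (by
        intro x hx
        refine ⟨c.pr x hx, c.p2 x hx, ?_, pi_of_star (c.rt x hx)⟩
        rcases hm with rfl | rfl
        · exact nd2 (c.pr x hx) (c.p2 x hx)
        · rw [dvd_neg]; exact nd2 (c.pr x hx) (c.p2 x hx)) f hf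
      obtain ⟨τ, hτ⟩ := exists_neg hα hns
      exact ⟨I, hI1, hI2, hQ hi' (fun x => q3 hα hm hτ hk x)⟩
    by_cases h7 : ∃ q ∈ P, q % 8 = 7
    · obtain ⟨q, hq, hq7⟩ := h7
      obtain ⟨I, -, hI, hle⟩ := key 2 (Or.inl rfl) (fun x => if x = q then 2 else 1) (by
        intro x hx
        by_cases hxq : x = q
        · right
          subst hxq
          refine ⟨if_pos rfl, res_of_isSquare ?_⟩
          have : Fact x.Prime := ⟨c.pr x hx⟩
          push_cast
          exact (ZMod.exists_sq_eq_two_iff (c.p2 x hx)).2 (Or.inr hq7)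
        · left
          simp [hxq])
      have hI2 := hI (by norm_num)
      rw [← Finset.add_sum_erase _ _ hq] at hle
      have : ∑ x ∈ P.erase q, (if x = q then 2 else 1) = 1 := by
        rw [Finset.sum_congr rfl (g := fun _ => 1) (fun x hx => if_neg (Finset.ne_of_mem_erase hx)), Finset.sum_const,
          Finset.card_erase_of_mem hq, hs]
        rfl
      simp only [this, if_true] at hle
      omega
    · push Not at h7
      obtain ⟨I, hI, -, hle⟩ := key (-2) (Or.inr rfl) (fun _ => 2) (by
        intro x hx
        right
        refine ⟨rfl, res_of_isSquare ?_⟩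
        have : Fact x.Prime := ⟨c.pr x hx⟩
        push_cast
        have := h7 x hx
        have := h3 x hx
        exact (ZMod.exists_sq_eq_neg_two_iff (c.p2 x hx)).2 (Or.inr (by omega)))
      rw [Finset.sum_const, hs] at hle
      simp at hle
      omega

theorem final (hodd : Odd (Nat.card (ClassGroup (𝓞 K)))) (h4 : 4 ≤ n)
    (ψ : (K ≃ₐ[ℚ] K) ≃* (Fin n → Multiplicative (ZMod 2))) : False := by
  classical
  obtain ⟨P, hP, hle⟩ := structure_thm hodd ψ
  have c : Ct K n P := ⟨hodd, finrank_gal ψ, h4, fun p hp => (hP p hp).1, fun p hp => (hP p hp).2.1, fun p hp => (hP p hp).2.2⟩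
  have hmod : ∀ p ∈ P, p % 4 = 1 ∨ p % 4 = 3 := by
    intro p hp
    have := (c.pr p hp).eq_two_or_odd.resolve_left (c.p2 p hp)
    omega
  have hsum : (P.filter (fun p => p % 4 = 1)).card + (P.filter (fun p => p % 4 = 3)).card = P.card := by
    rw [← Finset.card_union_of_disjoint, ← Finset.filter_or, Finset.filter_true_of_mem hmod]
    rw [Finset.disjoint_filter]
    intro x _ h1 h2
    omega
  have bound : ∀ j : ℕ, (({1, -1, 2, -2} : Finset ℤ).filter (Rt K)).card ≤ 2 ^ j → n ≤ P.card + j := by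
    intro j hj
    have h1 : 2 ^ n ≤ 2 ^ (P.card + j) := by
      rw [pow_add]
      exact hle.trans (by convert Nat.mul_le_mul_left _ hj)
    exact (Nat.pow_le_pow_iff_right (by norm_num)).1 h1
  have hV : ∀ V : Finset ℤ, (∀ e ∈ ({1, -1, 2, -2} : Finset ℤ), Rt K e → e ∈ V) →
      (({1, -1, 2, -2} : Finset ℤ).filter (Rt K)).card ≤ V.card := by
    intro V hV
    apply Finset.card_le_card
    intro x hx
    rw [Finset.mem_filter] at hx
    exact hV x hx.1 hx.2
  by_cases h1 : Rt K (-1) <;> by_cases h2 : Rt K 2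
  · exact c.caseE (bound 2 ((hV {1, -1, 2, -2} (fun e he _ => he)).trans (by decide))) hmod h1 h2 (by simpa using h1.mul h2)
  · have h3 : ¬ Rt K (-2) := fun h => h2 (by simpa using h1.mul h)
    have := bound 1 ((hV {1, -1} (by
      intro e he hr
      simp only [Finset.mem_insert, Finset.mem_singleton] at he ⊢
      rcases he with rfl | rfl | rfl | rfl <;> simp_all)).trans (by decide))
    exact c.caseD this hmod h1 (by omega)
  · have h3 : ¬ Rt K (-2) := fun h => h1 (Rt.div (a := 2) (by simpa using h) h2 (by norm_num))
    have := bound 1 ((hV {1, 2} (by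
      intro e he hr
      simp only [Finset.mem_insert, Finset.mem_singleton] at he ⊢
      rcases he with rfl | rfl | rfl | rfl <;> simp_all)).trans (by decide))
    exact c.caseB this hmod h2
  · by_cases h3 : Rt K (-2)
    · have := bound 1 ((hV {1, -2} (by
        intro e he hr
        simp only [Finset.mem_insert, Finset.mem_singleton] at he ⊢
        rcases he with rfl | rfl | rfl | rfl <;> simp_all)).trans (by decide))
      exact c.caseC this hmod h3
    · have := bound 0 ((hV {1} (by
        intro e he hr
        simp only [Finset.mem_insert, Finset.mem_singleton] at he ⊢
        rcases he with rfl | rfl | rfl | rfl <;> simp_all)).trans (by decide))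
      exact c.caseA this hmod (by omega)

end dispatch
end S18

open NumberField

/-- For `n ≥ 4`, every imaginary `n`-quadratic field (a number field, Galois over `ℚ`,
with Galois group `(C₂)ⁿ`, not totally real) has even class number. -/
theorem stmt18 (n : ℕ) (hn : 4 ≤ n) (K : Type*) [Field K] [NumberField K]
    [IsGalois ℚ K]
    (hgal : Nonempty ((K ≃ₐ[ℚ] K) ≃* (Fin n → Multiplicative (ZMod 2))))
    (him : ∃ φ : K →+* ℂ, ∃ x : K, (φ x).im ≠ 0) :
    Even (Nat.card (ClassGroup (𝓞 K))) := by
  by_contra h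
  rw [Nat.not_even_iff_odd] at h
  obtain ⟨ψ⟩ := hgal
  have := S18.tot_complex him
  exact S18.final h hn ψ
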